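/- arXiv:math/0401324 — 3 statements merged into one kernel-verified Lean document; each statement's English description precedes it below -/
import Mathlib

section
/- The Hurwitz action of B_n is simply transitive on Red_T(c): for the universal Coxeter group W_n with Coxeter element c = s_1⋯s_n, the action of B_n on the set of n-tuples of reflections with product c is transitive and free. -/
/-- The elementary Hurwitz move `σ_i` on `n`-tuples of a group `G`
(0-indexed: acts on entries `i` and `i+1`). -/
def hmove (n : ℕ) (G : Type*) [Group G] (i : ℕ) (hi : i + 1 < n)
    (g : Fin n → G) : Fin n → G := fun j =>
  if (j : ℕ) = i then g ⟨i, by omega⟩ * g ⟨i + 1, hi⟩ * (g ⟨i, by omega⟩)⁻¹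
  else if (j : ℕ) = i + 1 then g ⟨i, by omega⟩
  else g j

/-- One elementary step of the Hurwitz action. -/
def hstep (n : ℕ) (G : Type*) [Group G] (a b : Fin n → G) : Prop :=
  ∃ (i : ℕ) (hi : i + 1 < n), b = hmove n G i hi a

/-- Braid relations: generators `σ_1, …, σ_{n-1}` indexed by `Fin (n-1)`. -/
def braidRels (n : ℕ) : Set (FreeGroup (Fin (n - 1))) :=
  { r | (∃ i j : Fin (n - 1), (i : ℕ) + 1 = (j : ℕ) ∧
          r = FreeGroup.of i * FreeGroup.of j * FreeGroup.of i *
            (FreeGroup.of j * FreeGroup.of i * FreeGroup.of j)⁻¹) ∨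
        (∃ i j : Fin (n - 1), (i : ℕ) + 1 < (j : ℕ) ∧
          r = FreeGroup.of i * FreeGroup.of j * (FreeGroup.of j * FreeGroup.of i)⁻¹) }

/-- The braid group `B_n`. -/
abbrev BraidGroup (n : ℕ) := PresentedGroup (braidRels n)

/-- Relations of the universal Coxeter group: each generator squares to 1. -/
def coxRels (n : ℕ) : Set (FreeGroup (Fin n)) :=
  { r | ∃ i, r = FreeGroup.of i * FreeGroup.of i }

/-- The universal Coxeter group `W_n`. -/
abbrev UCox (n : ℕ) := PresentedGroup (coxRels n)

/-- The generator `s_i` of `W_n`. -/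
def sgen {n : ℕ} (i : Fin n) : UCox n := PresentedGroup.of i

/-- The Coxeter element `c = s_1 ⋯ s_n`. -/
def coxElt (n : ℕ) : UCox n := (List.ofFn fun i => sgen i).prod

/-- The set `T` of reflections of `W_n`: conjugates of generators. -/
def Refl (n : ℕ) : Set (UCox n) := { t | ∃ w i, t = w * sgen i * w⁻¹ }

/-- `Red_T(c)`: `n`-tuples of reflections with product `c`. -/
def RedT (n : ℕ) : Set (Fin n → UCox n) :=
  { t | (∀ i, t i ∈ Refl n) ∧ (List.ofFn t).prod = coxElt n }

/-- The set `R` of braid reflections of the free group: conjugates of generators. -/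
def Rset (n : ℕ) : Set (FreeGroup (Fin n)) :=
  { r | ∃ w i, r = w * FreeGroup.of i * w⁻¹ }

/-- `g = f_1 ⋯ f_n`. -/
def gElt (n : ℕ) : FreeGroup (Fin n) := (List.ofFn fun i => FreeGroup.of i).prod

/-- `Red_R(g)`: `n`-tuples from `R` with product `g`. -/
def RedR (n : ℕ) : Set (Fin n → FreeGroup (Fin n)) :=
  { t | (∀ i, t i ∈ Rset n) ∧ (List.ofFn t).prod = gElt n }

/-- The canonical projection `π : F_n → W_n`, `f_i ↦ s_i`. -/
def pr (n : ℕ) : FreeGroup (Fin n) →* UCox n := FreeGroup.lift fun i => sgen i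

/-- Length of an element of `W_n`: the length of its normal form. -/
noncomputable def wordLength {n : ℕ} (w : UCox n) : ℕ :=
  sInf { m | ∃ l : List (Fin n),
    List.Chain' (· ≠ ·) l ∧ l.length = m ∧ (l.map sgen).prod = w }

namespace UCoxHurwitz

/-! ### An action of `W_n` on a cyclically ordered set -/

/-- The half-turn `q ↦ m - 1 / (q - m)` of the projective line over `ℚ`. -/
def halfTurn (m : ℚ) : WithTop ℚ → WithTop ℚ
  | none => (m : WithTop ℚ)
  | some q => if q = m then ⊤ else ((m - 1 / (q - m) : ℚ) : WithTop ℚ)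

lemma halfTurn_top (m : ℚ) : halfTurn m ⊤ = (m : WithTop ℚ) := rfl

lemma halfTurn_coe (m q : ℚ) :
    halfTurn m (q : WithTop ℚ) = if q = m then ⊤ else ((m - 1 / (q - m) : ℚ) : WithTop ℚ) := rfl

lemma halfTurn_involutive (m : ℚ) : Function.Involutive (halfTurn m) := by
  intro y
  induction y using WithTop.recTopCoe with
  | top => simp [halfTurn_top, halfTurn_coe]
  | coe q =>
    by_cases h : q = m
    · simp [halfTurn_top, halfTurn_coe, h]
    · have h' : q - m ≠ 0 := sub_ne_zero.mpr h
      have h2 : ¬ (m - 1 / (q - m) = m) := by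
        intro h3
        have : 1 / (q - m) = 0 := by linarith
        simp [h'] at this
      rw [halfTurn_coe, if_neg h, halfTurn_coe, if_neg h2]
      congr 1
      field_simp
      ring

/-- `x`, `y`, `z` are in increasing order up to a cyclic rotation. -/
def Cyc (x y z : WithTop ℚ) : Prop := (x < y ∧ y < z) ∨ (y < z ∧ z < x) ∨ (z < x ∧ x < y)

lemma halfTurn_of_le {m : ℚ} {y : WithTop ℚ} (h : y ≤ m) : (m : WithTop ℚ) < halfTurn m y := by
  induction y using WithTop.recTopCoe with
  | top => simp at h
  | coe q =>
    rw [halfTurn_coe]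
    split_ifs with hq
    · exact WithTop.coe_lt_top m
    · rw [WithTop.coe_lt_coe]
      have : q < m := lt_of_le_of_ne (WithTop.coe_le_coe.mp h) hq
      have : 1 / (q - m) < 0 := one_div_neg.mpr (by linarith)
      linarith

lemma halfTurn_of_gt {m : ℚ} {y : WithTop ℚ} (h : (m : WithTop ℚ) < y) :
    halfTurn m y ≤ (m : WithTop ℚ) := by
  induction y using WithTop.recTopCoe with
  | top => simp [halfTurn_top]
  | coe q =>
    have hq : m < q := WithTop.coe_lt_coe.mp h
    rw [halfTurn_coe, if_neg hq.ne', WithTop.coe_le_coe]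
    have : 0 < 1 / (q - m) := one_div_pos.mpr (by linarith)
    linarith

lemma halfTurn_lt_of_le {m : ℚ} {x y : WithTop ℚ} (hy : y ≤ m) (h : x < y) :
    halfTurn m x < halfTurn m y := by
  induction y using WithTop.recTopCoe with
  | top => simp at hy
  | coe q =>
    induction x using WithTop.recTopCoe with
    | top => simp at h
    | coe p =>
      have hq := WithTop.coe_le_coe.mp hy
      have hp := WithTop.coe_lt_coe.mp h
      rw [halfTurn_coe, halfTurn_coe, if_neg (by linarith : ¬ p = m)]
      split_ifs with hqm
      · exact WithTop.coe_lt_top _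
      · rw [WithTop.coe_lt_coe]
        have hq' : q < m := lt_of_le_of_ne hq hqm
        have := one_div_lt_one_div_of_neg_of_lt (by linarith : q - m < 0)
          (by linarith : p - m < q - m)
        linarith

lemma halfTurn_lt_of_gt {m : ℚ} {x y : WithTop ℚ} (hx : (m : WithTop ℚ) < x) (h : x < y) :
    halfTurn m x < halfTurn m y := by
  induction x using WithTop.recTopCoe with
  | top => simp at h
  | coe p =>
    have hp := WithTop.coe_lt_coe.mp hx
    have hp' : 0 < 1 / (p - m) := one_div_pos.mpr (by linarith)
    induction y using WithTop.recTopCoe with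
    | top =>
      rw [halfTurn_coe, halfTurn_top, if_neg hp.ne', WithTop.coe_lt_coe]
      linarith
    | coe q =>
      have hq := WithTop.coe_lt_coe.mp h
      rw [halfTurn_coe, halfTurn_coe, if_neg hp.ne', if_neg (by linarith : ¬ q = m),
        WithTop.coe_lt_coe]
      have := one_div_lt_one_div_of_lt (by linarith : 0 < p - m)
        (by linarith : p - m < q - m)
      linarith

lemma Cyc.halfTurn {x y z : WithTop ℚ} (m : ℚ) (h : Cyc x y z) :
    Cyc (halfTurn m x) (halfTurn m y) (halfTurn m z) := by
  unfold Cyc at h ⊢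
  have hle := @halfTurn_of_le m
  have hgt := @halfTurn_of_gt m
  have hle' := @halfTurn_lt_of_le m
  have hgt' := @halfTurn_lt_of_gt m
  have key : ∀ a b : WithTop ℚ, a ≤ m → m < b → UCoxHurwitz.halfTurn m b <
      UCoxHurwitz.halfTurn m a := fun a b ha hb => (hgt hb).trans_lt (hle ha)
  rcases le_or_gt x m with hx | hx <;> rcases le_or_gt y m with hy | hy <;>
    rcases le_or_gt z m with hz | hz <;> grind

/-- The action of `W_n` on the projective line in which `s_i` is the half-turn at `3 i`. -/
def mobius (n : ℕ) : UCox n →* Equiv.Perm (WithTop ℚ) :=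
  PresentedGroup.toGroup (f := fun i : Fin n => (halfTurn_involutive (3 * (i : ℕ))).toPerm _) (by
    rintro r ⟨i, rfl⟩
    ext y
    simp only [map_mul, FreeGroup.lift_apply_of, Equiv.Perm.mul_apply, Equiv.Perm.one_apply]
    exact halfTurn_involutive _ y)

lemma mobius_sgen {n : ℕ} (i : Fin n) (y : WithTop ℚ) :
    mobius n (sgen i) y = halfTurn (3 * (i : ℕ)) y := by
  simp [mobius, sgen]

/-- The generators of `W_n` generate it as a monoid. -/
lemma exists_word {n : ℕ} (w : UCox n) : ∃ l : List (Fin n), (l.map sgen).prod = w := by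
  obtain ⟨f, rfl⟩ := PresentedGroup.mk_surjective (coxRels n) w
  induction f using FreeGroup.induction_on with
  | C1 => exact ⟨[], by simp⟩
  | of i => exact ⟨[i], by simp [sgen, PresentedGroup.of]⟩
  | inv_of i _ =>
    refine ⟨[i], ?_⟩
    have : (PresentedGroup.mk (coxRels n)) (FreeGroup.of i * FreeGroup.of i) = 1 :=
      PresentedGroup.one_of_mem ⟨i, rfl⟩
    rw [map_mul] at this
    simpa [sgen, PresentedGroup.of] using eq_inv_of_mul_eq_one_left this
  | mul x y hx hy =>
    obtain ⟨l, hl⟩ := hx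
    obtain ⟨l', hl'⟩ := hy
    exact ⟨l ++ l', by simp [hl, hl']⟩

lemma sgen_mul_self {n : ℕ} (i : Fin n) : sgen i * sgen i = 1 := by
  have : (PresentedGroup.mk (coxRels n)) (FreeGroup.of i * FreeGroup.of i) = 1 :=
    PresentedGroup.one_of_mem ⟨i, rfl⟩
  rwa [map_mul] at this

lemma sgen_inv {n : ℕ} (i : Fin n) : (sgen i)⁻¹ = sgen i :=
  inv_eq_of_mul_eq_one_right (sgen_mul_self i)

lemma Cyc.mobius {n : ℕ} {x y z : WithTop ℚ} (w : UCox n) (h : Cyc x y z) :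
    Cyc (mobius n w x) (mobius n w y) (mobius n w z) := by
  obtain ⟨l, rfl⟩ := exists_word w
  induction l with
  | nil => simpa using h
  | cons i l ih =>
    simp only [List.map_cons, List.prod_cons, map_mul, Equiv.Perm.mul_apply, mobius_sgen]
    exact ih.halfTurn _

/-- The arc that `s_i` exchanges with its complement. -/
def arc (i : ℕ) : Set (WithTop ℚ) :=
  Set.Ioo ((3 * i - 1 : ℚ) : WithTop ℚ) ((3 * i + 1 : ℚ) : WithTop ℚ)

lemma coe_mem_arc {i : ℕ} {q : ℚ} :
    (q : WithTop ℚ) ∈ arc i ↔ 3 * (i : ℚ) - 1 < q ∧ q < 3 * i + 1 := by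
  rw [arc, Set.mem_Ioo, WithTop.coe_lt_coe, WithTop.coe_lt_coe]

lemma top_notMem_arc (i : ℕ) : ⊤ ∉ arc i := by
  simp [arc]

lemma notMem_arc_of_ne {i j : ℕ} (hij : i ≠ j) {y : WithTop ℚ} (hy : y ∈ arc i) : y ∉ arc j := by
  induction y using WithTop.recTopCoe with
  | top => exact top_notMem_arc j
  | coe q =>
    rw [coe_mem_arc] at hy ⊢
    rintro ⟨h1, h2⟩
    rcases lt_or_gt_of_ne hij with h | h
    · have : (i : ℚ) + 1 ≤ j := by exact_mod_cast h
      linarith [hy.1, hy.2]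
    · have : (j : ℚ) + 1 ≤ i := by exact_mod_cast h
      linarith [hy.1, hy.2]

lemma halfTurn_mem_arc_of_top (i : ℕ) : halfTurn (3 * i) ⊤ ∈ arc i := by
  rw [halfTurn_top, coe_mem_arc]
  constructor <;> linarith

lemma halfTurn_mem_arc {i j : ℕ} (hij : i ≠ j) {y : WithTop ℚ} (hy : y ∈ arc j) :
    halfTurn (3 * i) y ∈ arc i := by
  induction y using WithTop.recTopCoe with
  | top => exact absurd hy (top_notMem_arc j)
  | coe q =>
    rw [coe_mem_arc] at hy
    rcases lt_or_gt_of_ne hij with h | h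
    · have : (i : ℚ) + 1 ≤ j := by exact_mod_cast h
      have hq : 1 < q - 3 * i := by linarith [hy.1]
      rw [halfTurn_coe, if_neg (by linarith), coe_mem_arc]
      have h1 : 0 < 1 / (q - 3 * i) := one_div_pos.mpr (by linarith)
      have h2 : 1 / (q - 3 * i) < 1 := (div_lt_one (by linarith)).mpr hq
      constructor <;> linarith
    · have : (j : ℚ) + 1 ≤ i := by exact_mod_cast h
      have hq : 1 < 3 * i - q := by linarith [hy.2]
      rw [halfTurn_coe, if_neg (by linarith), coe_mem_arc]
      have h0 : 1 / (q - 3 * i) = - (1 / (3 * i - q)) := by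
        rw [← neg_sub, one_div_neg_eq_neg_one_div]
      have h1 : 0 < 1 / (3 * i - q) := one_div_pos.mpr (by linarith)
      have h2 : 1 / (3 * i - q) < 1 := (div_lt_one (by linarith)).mpr hq
      rw [h0]
      constructor <;> linarith

/-! ### Reduced words -/

/-- The element of `W_n` spelled by a word. -/
def word {n : ℕ} (l : List (Fin n)) : UCox n := (l.map sgen).prod

@[simp] lemma word_nil {n : ℕ} : word ([] : List (Fin n)) = 1 := rfl

@[simp] lemma word_cons {n : ℕ} (i : Fin n) (l : List (Fin n)) :
    word (i :: l) = sgen i * word l := by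
  simp [word]

@[simp] lemma word_append {n : ℕ} (l l' : List (Fin n)) : word (l ++ l') = word l * word l' := by
  simp [word]

lemma word_reverse {n : ℕ} (l : List (Fin n)) : word l.reverse = (word l)⁻¹ := by
  induction l with
  | nil => simp
  | cons i l ih => simp [ih, sgen_inv]

/-- A word is reduced if consecutive letters differ. -/
abbrev Reduced {n : ℕ} (l : List (Fin n)) : Prop := l.IsChain (· ≠ ·)

lemma Reduced.reverse {n : ℕ} {l : List (Fin n)} (h : Reduced l) : Reduced l.reverse := by
  rw [Reduced, List.isChain_reverse]
  exact h.imp fun _ _ hab => hab.symm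

lemma mobius_word_mem_arc {n : ℕ} (i : Fin n) (l : List (Fin n)) (h : Reduced (i :: l)) :
    mobius n (word (i :: l)) ⊤ ∈ arc i := by
  induction l generalizing i with
  | nil =>
    simp only [word_cons, word_nil, mul_one, mobius_sgen]
    exact halfTurn_mem_arc_of_top i
  | cons j l ih =>
    rw [word_cons, map_mul, Equiv.Perm.mul_apply, mobius_sgen]
    have := List.isChain_cons_cons.mp h
    exact halfTurn_mem_arc (fun hij => this.1 (Fin.ext hij)) (ih j this.2)

lemma mobius_word_notMem_arc {n : ℕ} {i : Fin n} {l : List (Fin n)} (h : Reduced (i :: l)) :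
    mobius n (word l) ⊤ ∉ arc i := by
  cases l with
  | nil => simpa using top_notMem_arc i
  | cons j l =>
    have := List.isChain_cons_cons.mp h
    exact notMem_arc_of_ne (fun hij => this.1 (Fin.ext hij.symm)) (mobius_word_mem_arc j l this.2)

lemma Reduced.word_injective {n : ℕ} {l l' : List (Fin n)} (h : Reduced l) (h' : Reduced l')
    (e : word l = word l') : l = l' := by
  induction l generalizing l' with
  | nil =>
    cases l' with
    | nil => rfl
    | cons j l' =>
      have := mobius_word_mem_arc j l' h'
      rw [← e] at this
      exact absurd (by simpa using this) (top_notMem_arc j)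
  | cons i l ih =>
    cases l' with
    | nil =>
      have := mobius_word_mem_arc i l h
      rw [e] at this
      exact absurd (by simpa using this) (top_notMem_arc i)
    | cons j l' =>
      have hij : i = j := by
        by_contra hne
        have h1 := mobius_word_mem_arc i l h
        rw [e] at h1
        exact notMem_arc_of_ne (fun hh => hne (Fin.ext hh)) h1 (mobius_word_mem_arc j l' h')
      subst hij
      rw [word_cons, word_cons] at e
      exact congrArg _ (ih (List.IsChain.tail h) (List.IsChain.tail h') (mul_left_cancel e))

lemma exists_reduced_cons {n : ℕ} (i : Fin n) {l : List (Fin n)} (h : Reduced l) :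
    ∃ l', Reduced l' ∧ word l' = sgen i * word l ∧ l'.length ≤ l.length + 1 := by
  cases l with
  | nil => exact ⟨[i], by simp [Reduced], by simp, by simp⟩
  | cons j l =>
    by_cases hij : i = j
    · subst hij
      exact ⟨l, List.IsChain.tail h, by simp [← mul_assoc, sgen_mul_self], by simp; omega⟩
    · exact ⟨i :: j :: l, List.isChain_cons_cons.mpr ⟨hij, h⟩, by simp, by simp⟩

lemma exists_reduced_of_word {n : ℕ} (l : List (Fin n)) :
    ∃ l', Reduced l' ∧ word l' = word l ∧ l'.length ≤ l.length := by
  induction l with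
  | nil => exact ⟨[], by simp [Reduced], rfl, le_rfl⟩
  | cons i l ih =>
    obtain ⟨l', h, e, hl⟩ := ih
    obtain ⟨k, hk, ek, hkl⟩ := exists_reduced_cons i h
    exact ⟨k, hk, by rw [ek, e, word_cons], by simp; omega⟩

lemma exists_reduced {n : ℕ} (w : UCox n) : ∃ l, Reduced l ∧ word l = w := by
  obtain ⟨l, rfl⟩ := exists_word w
  obtain ⟨l', h, e, -⟩ := exists_reduced_of_word l
  exact ⟨l', h, e⟩

/-- The length of the reduced word of an element of `W_n`. -/
noncomputable def len {n : ℕ} (w : UCox n) : ℕ := (exists_reduced w).choose.length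

lemma Reduced.len_word {n : ℕ} {l : List (Fin n)} (h : Reduced l) : len (word l) = l.length := by
  have := (exists_reduced (word l)).choose_spec
  rw [len, this.1.word_injective h this.2]

lemma len_word_le {n : ℕ} (l : List (Fin n)) : len (word l) ≤ l.length := by
  obtain ⟨l', h, e, hl⟩ := exists_reduced_of_word l
  rw [← e, h.len_word]
  exact hl

/-! ### Reflections and the prefix order -/

/-- The reflection `u s u⁻¹`. -/
def refl {n : ℕ} (u : List (Fin n)) (s : Fin n) : UCox n := word u * sgen s * (word u)⁻¹

lemma refl_eq_word {n : ℕ} (u : List (Fin n)) (s : Fin n) :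
    refl u s = word (u ++ s :: u.reverse) := by
  simp [refl, word_reverse, mul_assoc]

lemma refl_mul_self {n : ℕ} (u : List (Fin n)) (s : Fin n) : refl u s * refl u s = 1 := by
  have h := sgen_mul_self s
  rw [refl, show word u * sgen s * (word u)⁻¹ * (word u * sgen s * (word u)⁻¹) =
    word u * (sgen s * sgen s) * (word u)⁻¹ by group, h]
  group

lemma refl_inv {n : ℕ} (u : List (Fin n)) (s : Fin n) : (refl u s)⁻¹ = refl u s :=
  inv_eq_of_mul_eq_one_right (refl_mul_self u s)

lemma reduced_palindrome {n : ℕ} {u : List (Fin n)} {s : Fin n} (h : Reduced (u ++ [s])) :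
    Reduced (u ++ s :: u.reverse) := by
  rw [Reduced, List.isChain_split]
  refine ⟨h, ?_⟩
  simpa using h.reverse

lemma len_refl {n : ℕ} {u : List (Fin n)} {s : Fin n} (h : Reduced (u ++ [s])) :
    len (refl u s) = 2 * u.length + 1 := by
  rw [refl_eq_word, (reduced_palindrome h).len_word]
  simp
  omega

lemma len_refl_le {n : ℕ} (u : List (Fin n)) (s : Fin n) :
    len (refl u s) ≤ 2 * u.length + 1 := by
  rw [refl_eq_word]
  refine (len_word_le _).trans ?_
  simp
  omega

lemma refl_injective {n : ℕ} {u u' : List (Fin n)} {s s' : Fin n} (h : Reduced (u ++ [s]))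
    (h' : Reduced (u' ++ [s'])) (e : refl u s = refl u' s') : u = u' ∧ s = s' := by
  have hl : u.length = u'.length := by
    have := congrArg len e
    rw [len_refl h, len_refl h'] at this
    omega
  rw [refl_eq_word, refl_eq_word] at e
  have := (reduced_palindrome h).word_injective (reduced_palindrome h') e
  obtain ⟨h1, h2⟩ := List.append_inj this hl
  exact ⟨h1, (List.cons.inj h2).1⟩

lemma exists_refl_conj_sgen {n : ℕ} (i : Fin n) {u : List (Fin n)} {s : Fin n}
    (h : Reduced (u ++ [s])) :
    ∃ v r, Reduced (v ++ [r]) ∧ sgen i * refl u s * (sgen i)⁻¹ = refl v r := by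
  have key : sgen i * refl u s * (sgen i)⁻¹ = refl (i :: u) s := by
    simp [refl, mul_assoc]
  cases u with
  | nil =>
    by_cases his : i = s
    · subst his
      exact ⟨[], i, h, by simp [refl]⟩
    · exact ⟨[i], s, by simp [Reduced, his], key⟩
  | cons j u =>
    by_cases hij : i = j
    · subst hij
      refine ⟨u, s, List.IsChain.tail h, ?_⟩
      have e : word (i :: i :: u) = word u := by simp [← mul_assoc, sgen_mul_self]
      rw [key, refl, e, refl]
    · exact ⟨i :: j :: u, s, List.isChain_cons_cons.mpr ⟨hij, h⟩, key⟩

lemma exists_refl_conj {n : ℕ} (w : UCox n) {u : List (Fin n)} {s : Fin n}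
    (h : Reduced (u ++ [s])) : ∃ v r, Reduced (v ++ [r]) ∧ w * refl u s * w⁻¹ = refl v r := by
  obtain ⟨l, rfl⟩ := exists_word w
  induction l with
  | nil => exact ⟨u, s, h, by simp⟩
  | cons i l ih =>
    obtain ⟨v, r, hv, e⟩ := ih
    obtain ⟨v', r', hv', e'⟩ := exists_refl_conj_sgen i hv
    refine ⟨v', r', hv', ?_⟩
    rw [← e', ← e]
    simp [mul_assoc]

lemma mem_Refl_iff {n : ℕ} {t : UCox n} :
    t ∈ Refl n ↔ ∃ u s, Reduced (u ++ [s]) ∧ t = refl u s := by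
  constructor
  · rintro ⟨w, i, rfl⟩
    obtain ⟨v, r, h, e⟩ := exists_refl_conj w (u := []) (s := i) (by simp [Reduced])
    exact ⟨v, r, h, by rw [← e]; simp [refl]⟩
  · rintro ⟨u, s, -, rfl⟩
    exact ⟨word u, s, rfl⟩

lemma Refl_conj {n : ℕ} (w : UCox n) {t : UCox n} (h : t ∈ Refl n) : w * t * w⁻¹ ∈ Refl n := by
  obtain ⟨v, i, rfl⟩ := h
  exact ⟨w * v, i, by group⟩

lemma Refl_inv {n : ℕ} {t : UCox n} (h : t ∈ Refl n) : t⁻¹ = t := by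
  obtain ⟨u, s, -, rfl⟩ := mem_Refl_iff.mp h
  exact refl_inv u s

/-- The wall of the reflection `a` separates the identity from the wall of the reflection `b`. -/
def Below {n : ℕ} (a b : UCox n) : Prop :=
  ∃ u s v r, Reduced (u ++ s :: v ++ [r]) ∧ a = refl u s ∧ b = refl (u ++ s :: v) r

lemma reduced_prefix {n : ℕ} {u v : List (Fin n)} {s r : Fin n}
    (h : Reduced (u ++ s :: v ++ [r])) : Reduced (u ++ [s]) := by
  rw [List.append_assoc, List.cons_append] at h
  exact (List.isChain_split.mp h).1

lemma Below.len_lt {n : ℕ} {a b : UCox n} (h : Below a b) : len a < len b := by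
  obtain ⟨u, s, v, r, h, rfl, rfl⟩ := h
  rw [len_refl h, len_refl (reduced_prefix h)]
  simp

lemma refl_conj_refl {n : ℕ} (u : List (Fin n)) (s : Fin n) (v : List (Fin n)) (r : Fin n) :
    refl u s * refl (u ++ s :: v) r * (refl u s)⁻¹ = refl (u ++ v) r := by
  have h : refl u s * word (u ++ s :: v) = word (u ++ v) := by
    simp only [refl, word_append, word_cons]
    rw [show word u * sgen s * (word u)⁻¹ * (word u * (sgen s * word v)) =
      word u * (sgen s * sgen s) * word v by group, sgen_mul_self]
    simp
  calc refl u s * refl (u ++ s :: v) r * (refl u s)⁻¹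
      = (refl u s * word (u ++ s :: v)) * sgen r * (refl u s * word (u ++ s :: v))⁻¹ := by
        rw [refl.eq_def (u ++ s :: v)]; group
    _ = _ := by rw [h, refl]

lemma Below.len_conj_lt {n : ℕ} {a b : UCox n} (h : Below a b) : len (a * b * a⁻¹) < len b := by
  obtain ⟨u, s, v, r, h, rfl, rfl⟩ := h
  rw [refl_conj_refl, len_refl h]
  refine (len_refl_le _ _).trans_lt ?_
  simp

lemma Below.len_conj_conj_lt {n : ℕ} {a b c : UCox n} (h : Below a b) (h' : Below b c) :
    len (a * (b * c * b⁻¹) * a⁻¹) < len c := by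
  obtain ⟨u, s, v, r, h, rfl, rfl⟩ := h
  obtain ⟨u', s', v', r', h', e, rfl⟩ := h'
  obtain ⟨rfl, rfl⟩ := refl_injective h (reduced_prefix h') e
  have e' : u ++ s :: v ++ v' = u ++ s :: (v ++ v') := by simp
  rw [refl_conj_refl, e', refl_conj_refl, len_refl h']
  refine (len_refl_le _ _).trans_lt ?_
  simp

lemma below_of_prefix {n : ℕ} {u u' : List (Fin n)} {s s' : Fin n} (hr : Reduced (u' ++ [s']))
    (hne : refl u s ≠ refl u' s') (hp : u ++ [s] <+: u' ++ [s']) :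
    Below (refl u s) (refl u' s') := by
  obtain ⟨k, hk⟩ := hp
  rcases List.eq_nil_or_concat k with rfl | ⟨k, x, rfl⟩
  · simp only [List.append_nil] at hk
    obtain ⟨rfl, h2⟩ := List.append_inj' hk rfl
    simp only [List.cons.injEq, and_true] at h2
    exact absurd (by rw [h2]) hne
  · have hk' : (u ++ s :: k) ++ [x] = u' ++ [s'] := by simpa using hk
    obtain ⟨rfl, h2⟩ := List.append_inj' hk' rfl
    exact ⟨u, s, k, s', hr, rfl, rfl⟩

lemma Below.comparable {n : ℕ} {a b c : UCox n} (h : Below a b) (h' : Below c b) (hac : a ≠ c) :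
    Below a c ∨ Below c a := by
  obtain ⟨u, s, v, r, h, rfl, rfl⟩ := h
  obtain ⟨u', s', v', r', h', rfl, e⟩ := h'
  obtain ⟨e', rfl⟩ := refl_injective h h' e
  have p1 : u ++ [s] <+: u ++ s :: v := ⟨v, by simp⟩
  have p2 : u' ++ [s'] <+: u ++ s :: v := ⟨v', by simp [e']⟩
  rcases List.prefix_or_prefix_of_prefix p1 p2 with hp | hp
  · exact Or.inl (below_of_prefix (reduced_prefix h') hac hp)
  · exact Or.inr (below_of_prefix (reduced_prefix h) hac.symm hp)

lemma below_or_below_conj {n : ℕ} {a b : UCox n} (ha : a ∈ Refl n) (hb : b ∈ Refl n)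
    (hab : a ≠ b) : Below a b ∨ Below a (a * b * a⁻¹) := by
  obtain ⟨u, s, hu, rfl⟩ := mem_Refl_iff.mp ha
  obtain ⟨v', r', hv', rfl⟩ := mem_Refl_iff.mp hb
  obtain ⟨v, r, hv, e⟩ := exists_refl_conj (word u)⁻¹ hv'
  have eb : refl v' r' = refl (u ++ v) r := by
    have e2 : refl (u ++ v) r = word u * refl v r * (word u)⁻¹ := by
      simp [refl, mul_assoc]
    rw [e2, ← e]
    group
  have econj : refl u s * refl (u ++ v) r * (refl u s)⁻¹ = refl (u ++ s :: v) r := by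
    have h1 := refl_conj_refl u s v r
    rw [← h1]
    simp only [mul_assoc]
    rw [refl_inv, refl_mul_self, ← mul_assoc (refl u s) (refl u s), refl_mul_self]
    simp
  rw [eb] at hab ⊢
  rw [econj]
  have glue : Reduced (s :: (v ++ [r])) → Reduced (u ++ s :: v ++ [r]) := fun h => by
    rw [List.append_assoc, List.cons_append]
    exact List.isChain_split.mpr ⟨hu, h⟩
  cases v with
  | nil =>
    by_cases hrs : s = r
    · subst hrs
      simp at hab
    · exact Or.inr ⟨u, s, [], r, glue (by simp [Reduced, hrs]), rfl, rfl⟩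
  | cons k v =>
    by_cases hk : s = k
    · subst hk
      refine Or.inl ⟨u, s, v, r, ?_, rfl, rfl⟩
      rw [List.append_assoc, List.cons_append]
      exact List.isChain_split.mpr ⟨hu, hv⟩
    · exact Or.inr ⟨u, s, k :: v, r, glue (List.isChain_cons_cons.mpr ⟨hk, hv⟩), rfl, rfl⟩

/-- Two walls beyond the wall of `b` cannot be reached on opposite sides of `b`. -/
lemma not_below_both {n : ℕ} {a b c : UCox n} (hba : Below b a) (hbc : Below b c)
    (h1 : mobius n a ⊤ < mobius n (b * c) ⊤) (h2 : mobius n (b * c) ⊤ < mobius n b ⊤) : False := by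
  obtain ⟨u, s, v, r, ha, rfl, rfl⟩ := hba
  obtain ⟨u', s', v', r', hc, e, rfl⟩ := hbc
  obtain ⟨rfl, rfl⟩ := refl_injective (reduced_prefix ha) (reduced_prefix hc) e
  set x := mobius n (refl (u ++ s :: v) r) ⊤ with hx
  set y := mobius n (refl u s * refl (u ++ s :: v') r') ⊤ with hy
  set z := mobius n (refl u s) ⊤ with hz
  have hz' : z < ⊤ := by
    refine lt_of_le_of_ne le_top fun hzt => ?_
    have hmem := mobius_word_notMem_arc (n := n) (i := s) (l := u.reverse)
      (by simpa using (reduced_prefix ha).reverse)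
    have h3 := mobius_word_mem_arc (n := n) s u.reverse
      (by simpa using (reduced_prefix ha).reverse)
    have h4 : word (s :: u.reverse) = word u.reverse * refl u s := by
      simp [refl, word_reverse, ← mul_assoc]
    rw [h4, map_mul, Equiv.Perm.mul_apply, ← hz, hzt] at h3
    exact hmem h3
  have c1 : Cyc x y z := Or.inl ⟨h1, h2⟩
  have c2 : Cyc z ⊤ x := Or.inr (Or.inr ⟨h1.trans h2, hz'⟩)
  have d1 := c1.mobius (word u)⁻¹
  have d2 := c2.mobius (word u)⁻¹
  have mx : mobius n (word u)⁻¹ x ∈ arc s := by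
    have hr := reduced_palindrome ha
    rw [List.append_assoc, List.cons_append] at hr
    have := mobius_word_mem_arc s _ (List.isChain_split.mp hr).2
    rw [hx, ← Equiv.Perm.mul_apply, ← map_mul, refl_eq_word, List.append_assoc, word_append,
      inv_mul_cancel_left]
    exact this
  have mz : mobius n (word u)⁻¹ z ∈ arc s := by
    have := mobius_word_mem_arc s _ (List.isChain_split.mp (reduced_palindrome
      (reduced_prefix ha))).2
    rw [hz, ← Equiv.Perm.mul_apply, ← map_mul, refl_eq_word, word_append, inv_mul_cancel_left]
    exact this
  have mt : mobius n (word u)⁻¹ ⊤ ∉ arc s := by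
    rw [← word_reverse]
    exact mobius_word_notMem_arc (List.isChain_split.mp (reduced_palindrome
      (reduced_prefix ha))).2
  have my : mobius n (word u)⁻¹ y ∉ arc s := by
    have hr := reduced_palindrome hc
    rw [List.append_assoc, List.cons_append] at hr
    have := mobius_word_notMem_arc (List.isChain_split.mp hr).2
    have e2 : (word u)⁻¹ * (refl u s * refl (u ++ s :: v') r') =
        word (v' ++ r' :: (u ++ s :: v').reverse) := by
      rw [refl_eq_word (u ++ s :: v'), List.append_assoc, word_append u, List.cons_append,
        word_cons, refl]
      calc _ = (sgen s * sgen s) * word (v' ++ r' :: (u ++ s :: v').reverse) := by group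
        _ = _ := by rw [sgen_mul_self, one_mul]
    rw [hy, ← Equiv.Perm.mul_apply, ← map_mul, e2]
    exact this
  have conv : ∀ p q w : WithTop ℚ, p ∈ arc s → q ∈ arc s → p < w → w < q → w ∈ arc s :=
    fun p q w hp hq h h' => ⟨hp.1.trans h, h'.trans hq.2⟩
  rcases d1 with ⟨e1, e2⟩ | ⟨e1, e2⟩ | ⟨e1, e2⟩
  · exact my (conv _ _ _ mx mz e1 e2)
  all_goals
    rcases d2 with ⟨f1, f2⟩ | ⟨f1, f2⟩ | ⟨f1, f2⟩
    · exact mt (conv _ _ _ mz mx f1 f2)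
    all_goals order

lemma exists_common_prefix {α : Type*} (l l' : List α) (h : ¬ l <+: l') (h' : ¬ l' <+: l) :
    ∃ p x xs y ys, x ≠ y ∧ l = p ++ x :: xs ∧ l' = p ++ y :: ys := by
  induction l generalizing l' with
  | nil => simp at h
  | cons a l ih =>
    cases l' with
    | nil => simp at h'
    | cons b l' =>
      by_cases hab : a = b
      · subst hab
        obtain ⟨p, x, xs, y, ys, hxy, rfl, rfl⟩ := ih l' (by simpa using h) (by simpa using h')
        exact ⟨a :: p, x, xs, y, ys, hxy, rfl, rfl⟩
      · exact ⟨[], a, l, b, l', hab, rfl, rfl⟩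

/-- A product of reflections whose neighbours are pairwise incomparable does not lose any of its
central letters under cancellation. -/
lemma prod_of_incomparable {n : ℕ} (ts : List (UCox n)) {u : List (Fin n)} {s : Fin n}
    (hu : Reduced (u ++ [s])) (hts : ∀ t ∈ ts, t ∈ Refl n)
    (hc : (refl u s :: ts).IsChain fun a b => a ≠ b ∧ ¬ Below a b ∧ ¬ Below b a) :
    ∃ q, Reduced (u ++ s :: q) ∧ (refl u s :: ts).prod = word (u ++ s :: q) ∧
      ts.length ≤ u.length + q.length ∧
      (u.length + q.length = ts.length → u = [] ∧ ts = q.map sgen) := by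
  induction ts generalizing u s with
  | nil =>
    refine ⟨u.reverse, reduced_palindrome hu, by simp [refl_eq_word], by simp, ?_⟩
    intro h
    have : u = [] := List.length_eq_zero_iff.mp (by simp at h; simp [h])
    simp [this]
  | cons t ts ih =>
    obtain ⟨u2, s2, hu2, rfl⟩ := mem_Refl_iff.mp (hts t (by simp))
    obtain ⟨⟨hne, hb1, hb2⟩, hc'⟩ := List.isChain_cons_cons.mp hc
    obtain ⟨q2, hq2, hprod, hlen, heq⟩ := ih hu2 (fun t ht => hts t (by simp [ht])) hc'
    obtain ⟨p, x, xs, y, ys, hxy, e1, e2⟩ := exists_common_prefix (u ++ [s]) (u2 ++ [s2])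
      (fun hp => hb1 (below_of_prefix hu2 hne hp)) (fun hp => hb2 (below_of_prefix hu hne.symm hp))
    obtain ⟨X, hX, rfl⟩ : ∃ X, X ++ [s] = x :: xs ∧ u = p ++ X := by
      rcases List.eq_nil_or_concat (x :: xs) with h | ⟨X, z, h⟩
      · simp at h
      · rw [h, List.concat_eq_append, ← List.append_assoc] at e1
        obtain ⟨h1, h2⟩ := List.append_inj' e1 rfl
        simp only [List.cons.injEq, and_true] at h2
        exact ⟨X, by rw [h, h2, List.concat_eq_append], h1⟩
    have e3 : u2 ++ s2 :: q2 = p ++ y :: (ys ++ q2) := by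
      have := congrArg (· ++ q2) e2
      simpa using this
    have el : u2.length = p.length + ys.length := by
      have := congrArg List.length e2
      simp at this
      omega
    refine ⟨X.reverse ++ y :: (ys ++ q2), ?_, ?_, ?_, ?_⟩
    · refine List.isChain_split.mpr ⟨hu, ?_⟩
      have hr : s :: (X.reverse ++ y :: (ys ++ q2)) = xs.reverse ++ x :: y :: (ys ++ q2) := by
        have := congrArg List.reverse hX
        simp only [List.reverse_append, List.reverse_cons, List.reverse_nil, List.nil_append,
          List.cons_append] at this
        rw [← List.cons_append, this]
        simp
      rw [hr, List.isChain_append_cons_cons]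
      refine ⟨?_, hxy, ?_⟩
      · rw [e1] at hu
        have := (List.isChain_append.mp hu).2.1
        simpa using Reduced.reverse this
      · rw [e3] at hq2
        exact (List.isChain_append.mp hq2).2.1
    · rw [List.prod_cons, hprod, e3, refl]
      simp [word_reverse, mul_assoc]
    · simp
      omega
    · intro h
      simp at h
      have hX0 : X = [] := List.length_eq_zero_iff.mp (by omega)
      obtain ⟨rfl, h2⟩ := heq (by omega)
      have hp0 : p = [] := List.length_eq_zero_iff.mp (by simp at el; omega)
      subst hX0 hp0
      refine ⟨rfl, ?_⟩
      simp only [List.nil_append] at e3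
      rw [List.reverse_nil, List.nil_append, ← e3, h2]
      simp [refl]

/-! ### The Hurwitz action -/

section Hurwitz

variable {n : ℕ} {G : Type*}

/-- Replace the entries `i` and `i + 1` of a tuple. -/
def replace₂ (t : Fin n → G) (i : ℕ) (x y : G) : Fin n → G := fun j =>
  if (j : ℕ) = i then x else if (j : ℕ) = i + 1 then y else t j

/-- Replace the entries `i`, `i + 1` and `i + 2` of a tuple. -/
def replace₃ (t : Fin n → G) (i : ℕ) (x y z : G) : Fin n → G := fun j =>
  if (j : ℕ) = i then x else if (j : ℕ) = i + 1 then y else if (j : ℕ) = i + 2 then z else t j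

lemma eq_replace₃ (t : Fin n → G) (i : ℕ) (hi : i + 2 < n) :
    t = replace₃ t i (t ⟨i, by omega⟩) (t ⟨i + 1, by omega⟩) (t ⟨i + 2, hi⟩) := by
  funext j
  simp only [replace₃]
  split_ifs with h1 h2 h3
  · exact congrArg t (Fin.ext h1)
  · exact congrArg t (Fin.ext h2)
  · exact congrArg t (Fin.ext h3)
  · rfl

variable [Group G]

lemma hmove_eq_replace₂ (t : Fin n → G) (i : ℕ) (hi : i + 1 < n) :
    hmove n G i hi t = replace₂ t i
      (t ⟨i, by omega⟩ * t ⟨i + 1, hi⟩ * (t ⟨i, by omega⟩)⁻¹) (t ⟨i, by omega⟩) := rfl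

/-- The inverse of the elementary Hurwitz move. -/
def hmoveInv (n : ℕ) (G : Type*) [Group G] (i : ℕ) (hi : i + 1 < n) (t : Fin n → G) : Fin n → G :=
  replace₂ t i (t ⟨i + 1, hi⟩) ((t ⟨i + 1, hi⟩)⁻¹ * t ⟨i, by omega⟩ * t ⟨i + 1, hi⟩)

lemma hmove_left_replace₃ (t : Fin n → G) (i : ℕ) (hi : i + 1 < n) (x y z : G) :
    hmove n G i hi (replace₃ t i x y z) = replace₃ t i (x * y * x⁻¹) x z := by
  funext j
  simp [hmove, replace₃]
  grind

lemma hmove_right_replace₃ (t : Fin n → G) (i : ℕ) (hi : i + 1 + 1 < n) (x y z : G) :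
    hmove n G (i + 1) hi (replace₃ t i x y z) = replace₃ t i x (y * z * y⁻¹) y := by
  funext j
  simp [hmove, replace₃]
  grind

lemma hmoveInv_left_replace₃ (t : Fin n → G) (i : ℕ) (hi : i + 1 < n) (x y z : G) :
    hmoveInv n G i hi (replace₃ t i x y z) = replace₃ t i y (y⁻¹ * x * y) z := by
  funext j
  simp [hmoveInv, replace₂, replace₃]
  grind

lemma hmoveInv_right_replace₃ (t : Fin n → G) (i : ℕ) (hi : i + 1 + 1 < n) (x y z : G) :
    hmoveInv n G (i + 1) hi (replace₃ t i x y z) = replace₃ t i x z (z⁻¹ * y * z) := by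
  funext j
  simp [hmoveInv, replace₂, replace₃]
  grind

/-- The elementary Hurwitz move as a permutation of the set of tuples. -/
def hmoveEquiv (n : ℕ) (G : Type*) [Group G] (i : ℕ) (hi : i + 1 < n) :
    Equiv.Perm (Fin n → G) where
  toFun := hmove n G i hi
  invFun := hmoveInv n G i hi
  left_inv t := by
    funext j
    simp only [hmoveInv, replace₂, hmove]
    split_ifs with h1 h2
    all_goals simp_all [mul_assoc]
    all_goals exact congrArg t (Fin.ext (by simp_all))
  right_inv t := by
    funext j
    simp only [hmoveInv, replace₂, hmove]
    split_ifs with h1 h2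
    all_goals simp_all [mul_assoc]
    all_goals exact congrArg t (Fin.ext (by simp_all))

lemma hmove_braid (i : ℕ) (hi : i + 1 + 1 < n) (t : Fin n → G) :
    hmove n G i (by omega) (hmove n G (i + 1) hi (hmove n G i (by omega) t)) =
      hmove n G (i + 1) hi (hmove n G i (by omega) (hmove n G (i + 1) hi t)) := by
  rw [eq_replace₃ t i hi]
  simp only [hmove_left_replace₃, hmove_right_replace₃]
  congr 1
  group

lemma hmove_comm (i j : ℕ) (hij : i + 1 < j) (hj : j + 1 < n) (t : Fin n → G) :
    hmove n G i (by omega) (hmove n G j hj t) = hmove n G j hj (hmove n G i (by omega) t) := by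
  funext k
  simp only [hmove]
  grind

/-- The Hurwitz action of the braid group. -/
def hurwitz (n : ℕ) (G : Type*) [Group G] : BraidGroup n →* Equiv.Perm (Fin n → G) :=
  PresentedGroup.toGroup (f := fun i : Fin (n - 1) => hmoveEquiv n G i (by omega)) (by
    rintro r (⟨i, ⟨j, hj'⟩, hij, rfl⟩ | ⟨i, j, hij, rfl⟩)
    · simp only at hij
      subst hij
      simp only [map_mul, map_inv, FreeGroup.lift_apply_of, mul_inv_eq_one]
      ext1 t
      exact hmove_braid (i : ℕ) (by omega) t
    · simp only [map_mul, map_inv, FreeGroup.lift_apply_of, mul_inv_eq_one]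
      ext1 t
      exact hmove_comm (i : ℕ) j hij (by omega) t)

lemma lt_sub_one {i n : ℕ} (hi : i + 1 < n) : i < n - 1 := by omega

/-- The standard generator `σ_i` of the braid group. -/
def sigma (i : ℕ) (hi : i + 1 < n) : BraidGroup n := PresentedGroup.of ⟨i, lt_sub_one hi⟩

lemma hurwitz_sigma (i : ℕ) (hi : i + 1 < n) (t : Fin n → G) :
    hurwitz n G (sigma i hi) t = hmove n G i hi t := by
  simp only [hurwitz, sigma, PresentedGroup.toGroup.of]
  rfl

lemma hurwitz_sigma_inv (i : ℕ) (hi : i + 1 < n) (t : Fin n → G) :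
    hurwitz n G (sigma i hi)⁻¹ t = hmoveInv n G i hi t := by
  rw [map_inv, Equiv.Perm.inv_eq_iff_eq]
  rw [hurwitz_sigma]
  exact ((hmoveEquiv n G i hi).apply_symm_apply t).symm

lemma sigma_braid (i : ℕ) (hi : i + 1 + 1 < n) :
    sigma i (by omega) * sigma (i + 1) hi * sigma i (by omega) =
      sigma (i + 1) hi * sigma i (by omega) * sigma (i + 1) hi := by
  rw [← mul_inv_eq_one]
  exact PresentedGroup.one_of_mem (rels := braidRels n)
    (Or.inl ⟨⟨i, by omega⟩, ⟨i + 1, by omega⟩, rfl, rfl⟩)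

lemma sigma_comm (i j : ℕ) (hij : i + 1 < j) (hj : j + 1 < n) :
    Commute (sigma i (by omega)) (sigma j hj) := by
  rw [Commute, SemiconjBy, ← mul_inv_eq_one]
  exact PresentedGroup.one_of_mem (rels := braidRels n)
    (Or.inr ⟨⟨i, by omega⟩, ⟨j, by omega⟩, hij, rfl⟩)

/-- The standard generators of the braid group and their inverses. -/
def sigmaSet (n : ℕ) : Set (BraidGroup n) :=
  { g | ∃ i hi, g = sigma i hi ∨ g = (sigma i hi)⁻¹ }

lemma sigma_mem (i : ℕ) (hi : i + 1 < n) : sigma i hi ∈ sigmaSet n := ⟨i, hi, Or.inl rfl⟩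

lemma sigma_inv_mem (i : ℕ) (hi : i + 1 < n) : (sigma i hi)⁻¹ ∈ sigmaSet n :=
  ⟨i, hi, Or.inr rfl⟩

lemma inv_mem_sigmaSet {g : BraidGroup n} (hg : g ∈ sigmaSet n) : g⁻¹ ∈ sigmaSet n := by
  obtain ⟨i, hi, rfl | rfl⟩ := hg
  · exact sigma_inv_mem i hi
  · rw [inv_inv]
    exact sigma_mem i hi

lemma closure_sigmaSet (n : ℕ) : Subgroup.closure (sigmaSet n) = ⊤ := by
  rw [eq_top_iff, ← PresentedGroup.closure_range_of (braidRels n), Subgroup.closure_le]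
  rintro _ ⟨i, rfl⟩
  exact Subgroup.subset_closure (sigma_mem (i : ℕ) (by omega))

/-! ### Partial products -/

/-- The product of the first `k` entries of a tuple. -/
def pprod (t : Fin n → G) : ℕ → G
  | 0 => 1
  | k + 1 => pprod t k * if h : k < n then t ⟨k, h⟩ else 1

lemma pprod_succ (t : Fin n → G) {k : ℕ} (h : k < n) :
    pprod t (k + 1) = pprod t k * t ⟨k, h⟩ := by
  simp [pprod, h]

lemma prod_ofFn_eq_pprod (t : Fin n → G) : (List.ofFn t).prod = pprod t n := by
  have : ∀ k ≤ n, ((List.ofFn t).take k).prod = pprod t k := by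
    intro k hk
    induction k with
    | zero => simp [pprod]
    | succ k ih =>
      rw [List.prod_take_succ _ _ (by simpa using hk), ih (by omega), pprod_succ t (by omega)]
      simp
  rw [← this n le_rfl, List.take_of_length_le (by simp)]

lemma pprod_replace₂ (t : Fin n → G) (i : ℕ) (hi : i + 1 < n) {x y : G}
    (h : x * y = t ⟨i, by omega⟩ * t ⟨i + 1, hi⟩) :
    pprod (replace₂ t i x y) (i + 1) = pprod t i * x ∧
      ∀ k, k ≠ i + 1 → pprod (replace₂ t i x y) k = pprod t k := by
  have low : ∀ k ≤ i, pprod (replace₂ t i x y) k = pprod t k := by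
    intro k hk
    induction k with
    | zero => rfl
    | succ k ih =>
      rw [pprod, pprod, ih (by omega)]
      simp [replace₂, show k ≠ i by omega, show k ≠ i + 1 by omega]
  have mid : pprod (replace₂ t i x y) (i + 1) = pprod t i * x := by
    rw [pprod_succ _ (by omega), low i le_rfl]
    simp [replace₂]
  refine ⟨mid, fun k hk => ?_⟩
  rcases Nat.lt_or_ge k (i + 1) with hlt | hge
  · exact low k (by omega)
  · obtain ⟨d, rfl⟩ : ∃ d, k = i + 2 + d := ⟨k - (i + 2), by omega⟩
    clear hk hge
    induction d with
    | zero =>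
      rw [add_zero, pprod_succ _ hi, mid, pprod_succ _ hi, pprod_succ _ (by omega : i < n),
        mul_assoc _ (t _), ← h]
      simp [replace₂, mul_assoc]
    | succ d ih =>
      rw [← add_assoc, pprod, ih, pprod]
      simp [replace₂, show i + 2 + d ≠ i by omega, show i + 2 + d ≠ i + 1 by omega]

end Hurwitz

/-! ### Freeness from local confluence -/

/-- If a complexity function changes along every generator and any two complexity-decreasing
generators at a point can be joined below that point, then the action is free. -/
theorem free_of_confluence {G X : Type*} [Group G] (act : G →* Equiv.Perm X) (E : Set G)
    (hE : Subgroup.closure E = ⊤) (hEinv : ∀ e ∈ E, e⁻¹ ∈ E) (Y : Set X)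
    (hY : ∀ g, ∀ x ∈ Y, act g x ∈ Y) (L : X → ℕ)
    (hL : ∀ x ∈ Y, ∀ e ∈ E, L (act e x) ≠ L x)
    (hconf : ∀ x ∈ Y, ∀ d ∈ E, ∀ d' ∈ E, L (act d x) < L x → L (act d' x) < L x →
      ∀ φ : X → G, (∀ y ∈ Y, ∀ e ∈ E, L y < L x → L (act e y) < L x →
        φ y = φ (act e y) * e) → φ (act d x) * d = φ (act d' x) * d')
    {x : X} (hx : x ∈ Y) {g : G} (hg : act g x = x) : g = 1 := by
  classical
  have hφ : ∀ N, ∃ φ : X → G, ∀ y ∈ Y, ∀ e ∈ E, L y < N → L (act e y) < N →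
      φ y = φ (act e y) * e := by
    intro N
    induction N with
    | zero => exact ⟨fun _ => 1, fun y _ e _ h => absurd h (by omega)⟩
    | succ N ih =>
      obtain ⟨φ, hφ⟩ := ih
      let ψ : X → G := fun y =>
        if L y < N then φ y
        else if h : ∃ d ∈ E, L (act d y) < L y then φ (act h.choose y) * h.choose else 1
      have hψ : ∀ y ∈ Y, ∀ e ∈ E, L y < N + 1 → L (act e y) < L y → ψ y = ψ (act e y) * e := by
        intro y hy e he h1 h2
        have h3 : ψ (act e y) = φ (act e y) := if_pos (by omega)
        rw [h3]
        by_cases h4 : L y < N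
        · rw [show ψ y = φ y from if_pos h4]
          exact hφ y hy e he h4 (by omega)
        · have h5 : ∃ d ∈ E, L (act d y) < L y := ⟨e, he, h2⟩
          rw [show ψ y = φ (act h5.choose y) * h5.choose by simp only [ψ, if_neg h4, dif_pos h5]]
          have hN : L y = N := by omega
          exact hconf y hy _ h5.choose_spec.1 e he h5.choose_spec.2 h2 φ
            (fun z hz f hf h6 h7 => hφ z hz f hf (by omega) (by omega))
      refine ⟨ψ, fun y hy e he h1 h2 => ?_⟩
      rcases lt_or_gt_of_ne (hL y hy e he) with h3 | h3
      · exact hψ y hy e he h1 h3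
      · have h4 := hψ (act e y) (hY e y hy) e⁻¹ (hEinv e he) h2
        rw [← Equiv.Perm.mul_apply, ← map_mul, inv_mul_cancel, map_one, Equiv.Perm.one_apply] at h4
        rw [h4 h3]
        simp
  have hpath : ∀ y ∈ Y, ∃ N, ∀ M ≥ N, ∀ φ : X → G, (∀ y ∈ Y, ∀ e ∈ E, L y < M →
      L (act e y) < M → φ y = φ (act e y) * e) → φ y = φ (act g y) * g := by
    have hgE : g ∈ Subgroup.closure E := hE ▸ Subgroup.mem_top g
    clear hg
    induction hgE using Subgroup.closure_induction with
    | mem e he =>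
      intro y hy
      exact ⟨L y + L (act e y) + 1, fun M hM φ h => h y hy e he (by omega) (by omega)⟩
    | one => exact fun y _ => ⟨0, fun M _ φ _ => by simp⟩
    | mul a b _ _ iha ihb =>
      intro y hy
      obtain ⟨N, hN⟩ := ihb y hy
      obtain ⟨N', hN'⟩ := iha (act b y) (hY b y hy)
      refine ⟨N + N', fun M hM φ h => ?_⟩
      rw [hN M (by omega) φ h, hN' M (by omega) φ h, map_mul, Equiv.Perm.mul_apply, mul_assoc]
    | inv a _ iha =>
      intro y hy
      obtain ⟨N, hN⟩ := iha (act a⁻¹ y) (hY a⁻¹ y hy)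
      refine ⟨N, fun M hM φ h => ?_⟩
      have := hN M hM φ h
      rw [← Equiv.Perm.mul_apply, ← map_mul, mul_inv_cancel, map_one, Equiv.Perm.one_apply] at this
      rw [this, mul_inv_cancel_right]
  obtain ⟨N, hN⟩ := hpath x hx
  obtain ⟨φ, h⟩ := hφ N
  have := hN N le_rfl φ h
  rw [hg] at this
  simpa using this

variable {n : ℕ}

lemma Below.trans {a b c : UCox n} (h : Below a b) (h' : Below b c) : Below a c := by
  obtain ⟨u, s, v, r, hr, rfl, rfl⟩ := h
  obtain ⟨u', s', v', r', hr', e, rfl⟩ := h'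
  obtain ⟨rfl, rfl⟩ := refl_injective hr (reduced_prefix hr') e
  exact ⟨u, s, v ++ r :: v', r', by simpa using hr', rfl, by simp⟩

lemma Refl_mul_self {t : UCox n} (h : t ∈ Refl n) : t * t = 1 := by
  nth_rw 1 [← Refl_inv h]
  exact inv_mul_cancel t

lemma below_of_len_conj_le {a b : UCox n} (ha : a ∈ Refl n) (hb : b ∈ Refl n) (hab : a ≠ b)
    (h : len (a * b * a⁻¹) ≤ len b) : Below a b := by
  refine (below_or_below_conj ha hb hab).resolve_right fun h' => ?_
  have h1 := h'.len_conj_lt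
  have h2 : a * (a * b * a⁻¹) * a⁻¹ = b := by
    rw [Refl_inv ha, mul_assoc a b, ← mul_assoc a a, Refl_mul_self ha, one_mul, mul_assoc,
      Refl_mul_self ha, mul_one]
  rw [h2] at h1
  omega

/-! ### Total length of a tuple -/

/-- The sum of the lengths of the entries of a tuple. -/
noncomputable def size (t : Fin n → UCox n) : ℕ := ∑ j, len (t j)

lemma size_replace₂ (t : Fin n → UCox n) (i : ℕ) (hi : i + 1 < n) (x y : UCox n) :
    size (replace₂ t i x y) + len (t ⟨i, by omega⟩) + len (t ⟨i + 1, hi⟩) =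
      size t + len x + len y := by
  let p : Fin n := ⟨i, by omega⟩
  let q : Fin n := ⟨i + 1, hi⟩
  have key : ∀ j, len (replace₂ t i x y j) + (if j = p then len (t p) else 0) +
      (if j = q then len (t q) else 0) =
      len (t j) + (if j = p then len x else 0) + (if j = q then len y else 0) := by
    intro j
    by_cases h1 : j = p
    · subst h1
      simp [replace₂, p, q]
      omega
    · by_cases h2 : j = q
      · subst h2
        simp [replace₂, p, q]
        omega
      · have h1' : (j : ℕ) ≠ i := fun h => h1 (Fin.ext h)
        have h2' : (j : ℕ) ≠ i + 1 := fun h => h2 (Fin.ext h)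
        simp [replace₂, h1, h2, h1', h2']
  have := Finset.sum_congr (rfl : (Finset.univ : Finset (Fin n)) = _) fun j _ => key j
  simpa [Finset.sum_add_distrib, size] using this

lemma size_replace₃ (t : Fin n → UCox n) (i : ℕ) (hi : i + 2 < n) (a b c x y z : UCox n) :
    size (replace₃ t i x y z) + len a + len b + len c =
      size (replace₃ t i a b c) + len x + len y + len z := by
  let p : Fin n := ⟨i, by omega⟩
  let q : Fin n := ⟨i + 1, by omega⟩
  let r : Fin n := ⟨i + 2, hi⟩
  have key : ∀ j, len (replace₃ t i x y z j) + (if j = p then len a else 0) +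
      (if j = q then len b else 0) + (if j = r then len c else 0) =
      len (replace₃ t i a b c j) + (if j = p then len x else 0) + (if j = q then len y else 0) +
      (if j = r then len z else 0) := by
    intro j
    simp only [replace₃, p, q, r, Fin.ext_iff]
    split_ifs <;> omega
  have := Finset.sum_congr (rfl : (Finset.univ : Finset (Fin n)) = _) fun j _ => key j
  simpa [Finset.sum_add_distrib, size] using this

/-! ### Tuples of reflections with product the Coxeter element -/

lemma replace₂_mem_RedT {t : Fin n → UCox n} (ht : t ∈ RedT n) {i : ℕ} (hi : i + 1 < n)
    {x y : UCox n} (hx : x ∈ Refl n) (hy : y ∈ Refl n)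
    (h : x * y = t ⟨i, by omega⟩ * t ⟨i + 1, hi⟩) : replace₂ t i x y ∈ RedT n := by
  refine ⟨fun j => ?_, ?_⟩
  · simp only [replace₂]
    split_ifs
    exacts [hx, hy, ht.1 j]
  · rw [prod_ofFn_eq_pprod, ← ht.2, prod_ofFn_eq_pprod]
    exact (pprod_replace₂ t i hi h).2 n (by omega)

lemma hmove_mem_RedT {t : Fin n → UCox n} (ht : t ∈ RedT n) {i : ℕ} (hi : i + 1 < n) :
    hmove n (UCox n) i hi t ∈ RedT n :=
  replace₂_mem_RedT ht hi (Refl_conj _ (ht.1 _)) (ht.1 _) (by group)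

lemma hmoveInv_mem_RedT {t : Fin n → UCox n} (ht : t ∈ RedT n) {i : ℕ} (hi : i + 1 < n) :
    hmoveInv n (UCox n) i hi t ∈ RedT n :=
  replace₂_mem_RedT ht hi (ht.1 _)
    (by simpa using Refl_conj (t ⟨i + 1, hi⟩)⁻¹ (ht.1 ⟨i, by omega⟩)) (by group)

/-- The abelianization of `W_n`. -/
def parity (n : ℕ) : UCox n →* Multiplicative (Fin n → ZMod 2) :=
  PresentedGroup.toGroup (f := fun i : Fin n => Multiplicative.ofAdd (Pi.single i 1)) (by
    rintro r ⟨i, rfl⟩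
    simp only [map_mul, FreeGroup.lift_apply_of, ← ofAdd_add, ← Pi.single_add]
    rw [show (1 : ZMod 2) + 1 = 0 from rfl, Pi.single_zero, ofAdd_zero])

lemma parity_sgen (i : Fin n) : parity n (sgen i) = Multiplicative.ofAdd (Pi.single i 1) := by
  simp [parity, sgen]

lemma RedT_injective {t : Fin n → UCox n} (ht : t ∈ RedT n) : Function.Injective t := by
  have hk : ∀ i, ∃ k : Fin n, parity n (t i) = Multiplicative.ofAdd (Pi.single k 1) := by
    intro i
    obtain ⟨w, k, hw⟩ := ht.1 i
    exact ⟨k, by rw [hw, map_mul, map_mul, map_inv, mul_inv_cancel_comm, parity_sgen]⟩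
  choose k hk using hk
  have hsurj : Function.Surjective k := by
    intro j
    by_contra! hj
    have h := congrArg (fun w => Multiplicative.toAdd (parity n w) j) ht.2
    simp only [coxElt, map_list_prod, List.map_ofFn, List.prod_ofFn, Function.comp_apply, hk,
      parity_sgen, toAdd_prod, toAdd_ofAdd, Finset.sum_apply, Pi.single_apply] at h
    simp [fun i => (hj i).symm] at h
  have hinj := Finite.injective_iff_surjective.mpr hsurj
  intro i j hij
  refine hinj ?_
  have := hk i
  rw [hij, hk j] at this
  by_contra hne
  have h := congrFun (Multiplicative.ofAdd.injective this) (k i)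
  simp [hne] at h

lemma RedT_ne {t : Fin n → UCox n} (ht : t ∈ RedT n) {i : ℕ} (hi : i + 1 < n) :
    t ⟨i, by omega⟩ ≠ t ⟨i + 1, hi⟩ := fun h => by
  have := RedT_injective ht h
  simp at this

lemma size_hmove_lt_iff {t : Fin n → UCox n} (ht : t ∈ RedT n) {i : ℕ} (hi : i + 1 < n) :
    size (hmove n (UCox n) i hi t) ≠ size t ∧
    (size (hmove n (UCox n) i hi t) < size t ↔ Below (t ⟨i, by omega⟩) (t ⟨i + 1, hi⟩)) := by
  have h1 := below_of_len_conj_le (ht.1 _) (ht.1 _) (RedT_ne ht hi)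
  have h2 := size_replace₂ t i hi (t ⟨i, by omega⟩ * t ⟨i + 1, hi⟩ * (t ⟨i, by omega⟩)⁻¹)
    (t ⟨i, by omega⟩)
  have h3 := @Below.len_conj_lt n (t ⟨i, by omega⟩) (t ⟨i + 1, hi⟩)
  rw [← hmove_eq_replace₂] at h2
  grind

lemma size_hmoveInv_lt_iff {t : Fin n → UCox n} (ht : t ∈ RedT n) {i : ℕ} (hi : i + 1 < n) :
    size (hmoveInv n (UCox n) i hi t) ≠ size t ∧
    (size (hmoveInv n (UCox n) i hi t) < size t ↔ Below (t ⟨i + 1, hi⟩) (t ⟨i, by omega⟩)) := by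
  have h1 := below_of_len_conj_le (ht.1 _) (ht.1 _) (RedT_ne ht hi).symm
  have h2 := size_replace₂ t i hi (t ⟨i + 1, hi⟩)
    ((t ⟨i + 1, hi⟩)⁻¹ * t ⟨i, by omega⟩ * t ⟨i + 1, hi⟩)
  have h3 := @Below.len_conj_lt n (t ⟨i + 1, hi⟩) (t ⟨i, by omega⟩)
  rw [← hmoveInv] at h2
  rw [Refl_inv (ht.1 _)] at h1 h2 h3
  grind

/-! ### Transitivity -/

lemma coxElt_eq_word (n : ℕ) : coxElt n = word (List.finRange n) := by
  rw [coxElt, word, List.ofFn_eq_map]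

lemma reduced_finRange (n : ℕ) : Reduced (List.finRange n) :=
  (List.nodup_finRange n).isChain

lemma eq_sgen_of_incomparable {t : Fin n → UCox n} (ht : t ∈ RedT n)
    (h : ∀ i (hi : i + 1 < n), ¬ Below (t ⟨i, by omega⟩) (t ⟨i + 1, hi⟩) ∧
      ¬ Below (t ⟨i + 1, hi⟩) (t ⟨i, by omega⟩)) : t = sgen := by
  cases n with
  | zero => exact funext fun i => i.elim0
  | succ m =>
    have hc : (List.ofFn t).IsChain fun a b => a ≠ b ∧ ¬ Below a b ∧ ¬ Below b a :=
      List.isChain_ofFn.mpr fun i hi => ⟨RedT_ne ht hi, h i hi⟩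
    obtain ⟨u, s, hu, h0⟩ := mem_Refl_iff.mp (ht.1 0)
    have hprod := ht.2
    rw [List.ofFn_succ, h0] at hc hprod
    obtain ⟨q, hq, hp, -, heq⟩ := prod_of_incomparable _ hu (by simp [List.mem_ofFn, ht.1]) hc
    rw [hprod, coxElt_eq_word] at hp
    have hw := (reduced_finRange (m + 1)).word_injective hq hp
    have hlen := congrArg List.length hw
    simp only [List.length_finRange, List.length_append, List.length_cons] at hlen
    obtain ⟨rfl, htail⟩ := heq (by simp; omega)
    apply List.ofFn_injective
    rw [List.ofFn_succ, htail, h0, List.ofFn_eq_map (f := sgen), hw]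
    simp [refl]

lemma hurwitz_mem {G : Type*} [Group G] {Y : Set (Fin n → G)}
    (h : ∀ t ∈ Y, ∀ i (hi : i + 1 < n), hmove n G i hi t ∈ Y)
    (h' : ∀ t ∈ Y, ∀ i (hi : i + 1 < n), hmoveInv n G i hi t ∈ Y)
    (β : BraidGroup n) {t : Fin n → G} (ht : t ∈ Y) : hurwitz n G β t ∈ Y := by
  have hgen : ∀ g ∈ sigmaSet n, ∀ t ∈ Y, hurwitz n G g t ∈ Y := by
    rintro _ ⟨i, hi, rfl | rfl⟩ t ht
    · rw [hurwitz_sigma]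
      exact h t ht i hi
    · rw [hurwitz_sigma_inv]
      exact h' t ht i hi
  have hβ : β ∈ Subgroup.closure (sigmaSet n) := closure_sigmaSet n ▸ Subgroup.mem_top β
  induction hβ using Subgroup.closure_induction'' generalizing t with
  | one => simpa using ht
  | mem x hx => exact hgen x hx t ht
  | inv_mem x hx => exact hgen _ (inv_mem_sigmaSet hx) t ht
  | mul x y _ _ ihx ihy =>
    rw [map_mul, Equiv.Perm.mul_apply]
    exact ihx (ihy ht)

lemma hurwitz_mem_RedT (β : BraidGroup n) {t : Fin n → UCox n} (ht : t ∈ RedT n) :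
    hurwitz n (UCox n) β t ∈ RedT n :=
  hurwitz_mem (fun _ ht _ hi => hmove_mem_RedT ht hi) (fun _ ht _ hi => hmoveInv_mem_RedT ht hi) β
    ht

lemma exists_hurwitz_eq_sgen {t : Fin n → UCox n} (ht : t ∈ RedT n) :
    ∃ β, hurwitz n (UCox n) β t = sgen := by
  induction hN : size t using Nat.strong_induction_on generalizing t with
  | _ N ih =>
    subst hN
    have descend : ∀ g, size (hurwitz n (UCox n) g t) < size t →
        ∃ β, hurwitz n (UCox n) β t = sgen := by
      intro g hg
      obtain ⟨β, hβ⟩ := ih _ hg (hurwitz_mem_RedT g ht) rfl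
      exact ⟨β * g, by rw [map_mul, Equiv.Perm.mul_apply, hβ]⟩
    by_cases h : ∀ i (hi : i + 1 < n), ¬ Below (t ⟨i, by omega⟩) (t ⟨i + 1, hi⟩) ∧
      ¬ Below (t ⟨i + 1, hi⟩) (t ⟨i, by omega⟩)
    · exact ⟨1, by simpa using eq_sgen_of_incomparable ht h⟩
    · push Not at h
      obtain ⟨i, hi, h⟩ := h
      by_cases h' : Below (t ⟨i, by omega⟩) (t ⟨i + 1, hi⟩)
      · refine descend (sigma i hi) ?_
        rw [hurwitz_sigma]
        exact (size_hmove_lt_iff ht hi).2.mpr h'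
      · refine descend (sigma i hi)⁻¹ ?_
        rw [hurwitz_sigma_inv]
        exact (size_hmoveInv_lt_iff ht hi).2.mpr (h h')

/-! ### The monotonicity invariant -/

/-- The orbit of `⊤` under the partial products of the tuple is decreasing. -/
def Descending (t : Fin n → UCox n) : Prop :=
  ∀ k < n, mobius n (pprod t (k + 1)) ⊤ < mobius n (pprod t k) ⊤

lemma Descending.cyc {t : Fin n → UCox n} (h : Descending t) {i : ℕ} (hi : i + 1 < n) :
    Cyc (mobius n (pprod t i * t ⟨i, by omega⟩ * t ⟨i + 1, hi⟩) ⊤)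
      (mobius n (pprod t i * t ⟨i, by omega⟩) ⊤) (mobius n (pprod t i) ⊤) := by
  have h1 := h i (by omega)
  have h2 := h (i + 1) hi
  rw [pprod_succ t hi] at h2
  rw [pprod_succ t (by omega : i < n)] at h1 h2
  exact Or.inl ⟨h2, h1⟩

lemma Descending.replace₂ {t : Fin n → UCox n} (h : Descending t) {i : ℕ} (hi : i + 1 < n)
    {x y : UCox n} (hxy : x * y = t ⟨i, by omega⟩ * t ⟨i + 1, hi⟩)
    (h1 : mobius n (pprod t (i + 1 + 1)) ⊤ < mobius n (pprod t i * x) ⊤)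
    (h2 : mobius n (pprod t i * x) ⊤ < mobius n (pprod t i) ⊤) :
    Descending (replace₂ t i x y) := by
  obtain ⟨hmid, hother⟩ := pprod_replace₂ t i hi hxy
  intro k hk
  by_cases hki : k = i
  · subst hki
    rwa [hmid, hother k (by omega)]
  · by_cases hki' : k = i + 1
    · subst hki'
      rwa [hmid, hother _ (by omega)]
    · rw [hother _ (by omega), hother _ hki']
      exact h k hk

lemma Descending.hmove {t : Fin n → UCox n} (h : Descending t) (ht : t ∈ RedT n) {i : ℕ}
    (hi : i + 1 < n) : Descending (hmove n (UCox n) i hi t) := by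
  have hcyc := h.cyc hi
  have h1 := h i (by omega)
  have h2 := h (i + 1) hi
  have hb := Refl_mul_self (ht.1 ⟨i + 1, hi⟩)
  have hxy : t ⟨i, by omega⟩ * t ⟨i + 1, hi⟩ * (t ⟨i, by omega⟩)⁻¹ * t ⟨i, by omega⟩ =
    t ⟨i, by omega⟩ * t ⟨i + 1, hi⟩ := by group
  rw [hmove_eq_replace₂]
  rw [pprod_succ t (by omega : i < n)] at h1
  rw [pprod_succ t hi, pprod_succ t (by omega : i < n)] at h2
  set P := pprod t i with hP
  generalize ha : t ⟨i, by omega⟩ = a at *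
  generalize hb' : t ⟨i + 1, hi⟩ = b at *
  replace hcyc := hcyc.mobius (P * a * b * a⁻¹ * P⁻¹)
  simp only [← Equiv.Perm.mul_apply, ← map_mul] at hcyc
  rw [show P * a * b * a⁻¹ * P⁻¹ * (P * a * b) = P * a * (b * b) by group,
    show P * a * b * a⁻¹ * P⁻¹ * (P * a) = P * a * b by group,
    show P * a * b * a⁻¹ * P⁻¹ * P = P * (a * b * a⁻¹) by group, hb, mul_one] at hcyc
  have hlt : mobius n (P * a * b) ⊤ < mobius n (P * (a * b * a⁻¹)) ⊤ ∧
      mobius n (P * (a * b * a⁻¹)) ⊤ < mobius n (P * a) ⊤ := by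
    rcases hcyc with hcyc | hcyc | hcyc
    · exact absurd hcyc.1 h2.asymm
    · exact hcyc
    · exact absurd hcyc.2 h2.asymm
  subst ha hb'
  refine h.replace₂ hi hxy ?_ (hlt.2.trans h1)
  rw [pprod_succ t hi, pprod_succ t (by omega : i < n)]
  exact hlt.1

lemma Descending.hmoveInv {t : Fin n → UCox n} (h : Descending t) (ht : t ∈ RedT n) {i : ℕ}
    (hi : i + 1 < n) : Descending (hmoveInv n (UCox n) i hi t) := by
  have hcyc := h.cyc hi
  have h1 := h i (by omega)
  have h2 := h (i + 1) hi
  have ha := Refl_inv (ht.1 ⟨i, by omega⟩)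
  have hxy : t ⟨i + 1, hi⟩ * ((t ⟨i + 1, hi⟩)⁻¹ * t ⟨i, by omega⟩ * t ⟨i + 1, hi⟩) =
    t ⟨i, by omega⟩ * t ⟨i + 1, hi⟩ := by group
  rw [UCoxHurwitz.hmoveInv]
  rw [pprod_succ t (by omega : i < n)] at h1
  rw [pprod_succ t hi, pprod_succ t (by omega : i < n)] at h2
  set P := pprod t i with hP
  generalize ha' : t ⟨i, by omega⟩ = a at *
  generalize hb' : t ⟨i + 1, hi⟩ = b at *
  replace hcyc := hcyc.mobius (P * a⁻¹ * P⁻¹)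
  simp only [← Equiv.Perm.mul_apply, ← map_mul] at hcyc
  rw [show P * a⁻¹ * P⁻¹ * (P * a * b) = P * b by group,
    show P * a⁻¹ * P⁻¹ * (P * a) = P by group,
    show P * a⁻¹ * P⁻¹ * P = P * a⁻¹ by group, ha] at hcyc
  have hlt : mobius n (P * a) ⊤ < mobius n (P * b) ⊤ ∧ mobius n (P * b) ⊤ < mobius n P ⊤ := by
    rcases hcyc with hcyc | hcyc | hcyc
    · exact absurd hcyc.2 h1.asymm
    · exact absurd hcyc.1 h1.asymm
    · exact hcyc
  subst ha' hb'
  refine h.replace₂ hi hxy ?_ hlt.2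
  rw [pprod_succ t hi, pprod_succ t (by omega : i < n)]
  exact h2.trans hlt.1

lemma Descending.not_below_both {t : Fin n → UCox n} (h : Descending t) (ht : t ∈ RedT n) {i : ℕ}
    (hi : i + 2 < n) (hba : Below (t ⟨i + 1, by omega⟩) (t ⟨i, by omega⟩))
    (hbc : Below (t ⟨i + 1, by omega⟩) (t ⟨i + 2, hi⟩)) : False := by
  have h1 := h i (by omega)
  have h2 := h (i + 1) (by omega)
  have h3 := h (i + 2) hi
  have ha := Refl_mul_self (ht.1 ⟨i, by omega⟩)
  rw [pprod_succ t hi] at h3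
  rw [pprod_succ t (by omega : i + 1 < n)] at h2 h3
  rw [pprod_succ t (by omega : i < n)] at h1 h2 h3
  set P := pprod t i with hP
  generalize t ⟨i, by omega⟩ = a at *
  generalize t ⟨i + 1, by omega⟩ = b at *
  generalize t ⟨i + 2, hi⟩ = c at *
  have c1 : Cyc _ _ _ := Or.inl ⟨h2, h1⟩
  have c2 : Cyc _ _ _ := Or.inl ⟨h3, h2⟩
  have c3 : Cyc _ _ _ := Or.inl ⟨h3.trans h2, h1⟩
  replace c1 := c1.mobius (a * P⁻¹)
  replace c2 := c2.mobius (a * P⁻¹)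
  replace c3 := c3.mobius (a * P⁻¹)
  simp only [← Equiv.Perm.mul_apply, ← map_mul] at c1 c2 c3
  have e1 : a * P⁻¹ * P = a := by group
  have e2 : a * P⁻¹ * (P * a) = 1 := by rw [← ha]; group
  have e3 : a * P⁻¹ * (P * a * b) = b := by
    rw [← mul_assoc, e2, one_mul]
  have e4 : a * P⁻¹ * (P * a * b * c) = b * c := by
    rw [← mul_assoc, e3]
  rw [e1, e2, e3, map_one, Equiv.Perm.one_apply] at c1
  rw [e2, e3, e4, map_one, Equiv.Perm.one_apply] at c2
  rw [e1, e2, e4, map_one, Equiv.Perm.one_apply] at c3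
  simp only [Cyc, not_top_lt, false_and, and_false, or_false, false_or] at c1 c2 c3
  exact UCoxHurwitz.not_below_both hba hbc c3.1 c2.1

lemma lt_halfTurn {m : ℚ} {x : WithTop ℚ} (h : ((m + 1 : ℚ) : WithTop ℚ) < x) :
    ((m - 1 : ℚ) : WithTop ℚ) < halfTurn m x := by
  induction x using WithTop.recTopCoe with
  | top =>
    rw [halfTurn_top, WithTop.coe_lt_coe]
    linarith
  | coe q =>
    have hq := WithTop.coe_lt_coe.mp h
    rw [halfTurn_coe, if_neg (by linarith), WithTop.coe_lt_coe]
    have : 1 / (q - m) < 1 := by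
      rw [div_lt_one (by linarith)]
      linarith
    linarith

lemma mobius_pprod_sgen_lt (k : ℕ) {x y : WithTop ℚ} (hx : ((3 * k - 2 : ℚ) : WithTop ℚ) < x)
    (hxy : x < y) (hk : k ≤ n) :
    mobius n (pprod sgen k) x < mobius n (pprod sgen k) y := by
  induction k generalizing x y with
  | zero => simpa [pprod] using hxy
  | succ k ih =>
    have hx' : ((3 * k + 1 : ℚ) : WithTop ℚ) < x := by
      refine lt_of_eq_of_lt ?_ hx
      congr 1
      push_cast
      ring
    have hx'' : ((3 * k : ℚ) : WithTop ℚ) < x :=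
      lt_trans (WithTop.coe_lt_coe.mpr (by linarith)) hx'
    rw [pprod_succ sgen hk, map_mul, Equiv.Perm.mul_apply, Equiv.Perm.mul_apply, mobius_sgen,
      mobius_sgen]
    exact ih (lt_trans (WithTop.coe_lt_coe.mpr (by linarith)) (lt_halfTurn hx'))
      (halfTurn_lt_of_gt hx'' hxy) (by omega)

lemma descending_sgen (n : ℕ) : Descending (sgen : Fin n → UCox n) := by
  intro k hk
  rw [pprod_succ sgen hk, map_mul, Equiv.Perm.mul_apply, mobius_sgen, halfTurn_top]
  exact mobius_pprod_sgen_lt k (WithTop.coe_lt_coe.mpr (by simp)) (WithTop.coe_lt_top _) hk.le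

lemma sgen_mem_RedT (n : ℕ) : (sgen : Fin n → UCox n) ∈ RedT n :=
  ⟨fun i => ⟨1, i, by simp⟩, rfl⟩

lemma descending_of_mem_RedT {t : Fin n → UCox n} (ht : t ∈ RedT n) : Descending t := by
  obtain ⟨β, hβ⟩ := exists_hurwitz_eq_sgen ht
  have h : hurwitz n (UCox n) β⁻¹ sgen = t := by
    rw [← hβ, ← Equiv.Perm.mul_apply, ← map_mul, inv_mul_cancel, map_one, Equiv.Perm.one_apply]
  rw [← h]
  exact (hurwitz_mem (Y := RedT n ∩ {t | Descending t})
    (fun t ht i hi => ⟨hmove_mem_RedT ht.1 hi, ht.2.hmove ht.1 hi⟩)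
    (fun t ht i hi => ⟨hmoveInv_mem_RedT ht.1 hi, ht.2.hmoveInv ht.1 hi⟩) β⁻¹
    ⟨sgen_mem_RedT n, descending_sgen n⟩).2

/-! ### Local confluence -/

/-- `φ` is compatible with all generators between tuples of size less than `N`. -/
def CompatibleBelow (N : ℕ) (φ : (Fin n → UCox n) → BraidGroup n) : Prop :=
  ∀ t ∈ RedT n, ∀ e ∈ sigmaSet n, size t < N → size (hurwitz n (UCox n) e t) < N →
    φ t = φ (hurwitz n (UCox n) e t) * e

section

variable {N : ℕ} {φ : (Fin n → UCox n) → BraidGroup n} {t : Fin n → UCox n}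

lemma CompatibleBelow.join₂ (hφ : CompatibleBelow N φ) (ht : t ∈ RedT n)
    {e₁ e₂ : BraidGroup n} (he₁ : e₁ ∈ sigmaSet n) (he₂ : e₂ ∈ sigmaSet n) (h : Commute e₁ e₂)
    (h1 : size (hurwitz n (UCox n) e₁ t) < N) (h2 : size (hurwitz n (UCox n) e₂ t) < N)
    (h12 : size (hurwitz n (UCox n) e₂ (hurwitz n (UCox n) e₁ t)) < N) :
    φ (hurwitz n (UCox n) e₁ t) * e₁ = φ (hurwitz n (UCox n) e₂ t) * e₂ := by
  have hcomm : hurwitz n (UCox n) e₁ (hurwitz n (UCox n) e₂ t) =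
      hurwitz n (UCox n) e₂ (hurwitz n (UCox n) e₁ t) := by
    rw [← Equiv.Perm.mul_apply, ← map_mul, h.eq, map_mul, Equiv.Perm.mul_apply]
  rw [hφ _ (hurwitz_mem_RedT e₁ ht) e₂ he₂ h1 h12,
    hφ _ (hurwitz_mem_RedT e₂ ht) e₁ he₁ h2 (hcomm ▸ h12), hcomm, mul_assoc, mul_assoc, h.eq]

lemma CompatibleBelow.join₃ (hφ : CompatibleBelow N φ) (ht : t ∈ RedT n)
    {e₁ e₂ e₃ f₁ f₂ f₃ : BraidGroup n} (he₂ : e₂ ∈ sigmaSet n) (he₃ : e₃ ∈ sigmaSet n)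
    (hf₂ : f₂ ∈ sigmaSet n) (hf₃ : f₃ ∈ sigmaSet n) (h : e₃ * e₂ * e₁ = f₃ * f₂ * f₁)
    (h1 : size (hurwitz n (UCox n) e₁ t) < N)
    (h2 : size (hurwitz n (UCox n) e₂ (hurwitz n (UCox n) e₁ t)) < N)
    (h3 : size (hurwitz n (UCox n) e₃ (hurwitz n (UCox n) e₂ (hurwitz n (UCox n) e₁ t))) < N)
    (h4 : size (hurwitz n (UCox n) f₁ t) < N)
    (h5 : size (hurwitz n (UCox n) f₂ (hurwitz n (UCox n) f₁ t)) < N) :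
    φ (hurwitz n (UCox n) e₁ t) * e₁ = φ (hurwitz n (UCox n) f₁ t) * f₁ := by
  have heq : hurwitz n (UCox n) f₃ (hurwitz n (UCox n) f₂ (hurwitz n (UCox n) f₁ t)) =
      hurwitz n (UCox n) e₃ (hurwitz n (UCox n) e₂ (hurwitz n (UCox n) e₁ t)) := by
    simp only [← Equiv.Perm.mul_apply, ← map_mul, ← mul_assoc, h]
  rw [hφ _ (hurwitz_mem_RedT e₁ ht) e₂ he₂ h1 h2,
    hφ _ (hurwitz_mem_RedT e₂ (hurwitz_mem_RedT e₁ ht)) e₃ he₃ h2 h3,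
    hφ _ (hurwitz_mem_RedT f₁ ht) f₂ hf₂ h4 h5,
    hφ _ (hurwitz_mem_RedT f₂ (hurwitz_mem_RedT f₁ ht)) f₃ hf₃ h5 (heq ▸ h3), heq]
  simp only [mul_assoc] at h ⊢
  rw [h]

end

lemma exists_hurwitz_eq_replace₂ {j : ℕ} (hj : j + 1 < n) {d : BraidGroup n}
    (hd : d = sigma j hj ∨ d = (sigma j hj)⁻¹) (t : Fin n → UCox n) :
    ∃ x y, ∀ t' : Fin n → UCox n, t' ⟨j, by omega⟩ = t ⟨j, by omega⟩ →
      t' ⟨j + 1, hj⟩ = t ⟨j + 1, hj⟩ → hurwitz n (UCox n) d t' = replace₂ t' j x y := by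
  rcases hd with rfl | rfl
  · refine ⟨t ⟨j, by omega⟩ * t ⟨j + 1, hj⟩ * (t ⟨j, by omega⟩)⁻¹, t ⟨j, by omega⟩,
      fun t' h h' => ?_⟩
    rw [hurwitz_sigma, hmove_eq_replace₂, h, h']
  · refine ⟨t ⟨j + 1, hj⟩, (t ⟨j + 1, hj⟩)⁻¹ * t ⟨j, by omega⟩ * t ⟨j + 1, hj⟩,
      fun t' h h' => ?_⟩
    rw [hurwitz_sigma_inv, hmoveInv, h, h']

lemma size_hurwitz_hurwitz {i j : ℕ} (hij : i + 1 < j) (hj : j + 1 < n) {d d' : BraidGroup n}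
    (hd : d = sigma i (by omega) ∨ d = (sigma i (by omega))⁻¹)
    (hd' : d' = sigma j hj ∨ d' = (sigma j hj)⁻¹) (t : Fin n → UCox n) :
    size (hurwitz n (UCox n) d' (hurwitz n (UCox n) d t)) + size t =
      size (hurwitz n (UCox n) d t) + size (hurwitz n (UCox n) d' t) := by
  obtain ⟨x, y, h⟩ := exists_hurwitz_eq_replace₂ _ hd t
  obtain ⟨x', y', h'⟩ := exists_hurwitz_eq_replace₂ _ hd' t
  have e1 : replace₂ t i x y ⟨j, by omega⟩ = t ⟨j, by omega⟩ := by
    simp [replace₂, show j ≠ i by omega, show j ≠ i + 1 by omega]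
  have e2 : replace₂ t i x y ⟨j + 1, hj⟩ = t ⟨j + 1, hj⟩ := by
    simp [replace₂, show j + 1 ≠ i by omega, show j ≠ i by omega]
  rw [h t rfl rfl, h' t rfl rfl, h' _ e1 e2]
  have h1 := size_replace₂ t j hj x' y'
  have h2 := size_replace₂ (replace₂ t i x y) j hj x' y'
  rw [e1, e2] at h2
  omega

lemma commute_of_far {i j : ℕ} (hij : i + 1 < j) (hj : j + 1 < n) {d d' : BraidGroup n}
    (hd : d = sigma i (by omega) ∨ d = (sigma i (by omega))⁻¹)
    (hd' : d' = sigma j hj ∨ d' = (sigma j hj)⁻¹) : Commute d d' := by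
  have h := sigma_comm i j hij hj
  rcases hd with rfl | rfl <;> rcases hd' with rfl | rfl
  exacts [h, h.inv_right, h.inv_left, h.inv_left.inv_right]

lemma join_adjacent {i : ℕ} (hi : i + 2 < n) {T : Fin n → UCox n} {a b c : UCox n}
    (ht : replace₃ T i a b c ∈ RedT n)
    (ha : a ∈ Refl n) (hb : b ∈ Refl n) (hc : c ∈ Refl n) (hac : a ≠ c)
    (hsource : ¬ (Below b a ∧ Below b c)) {φ : (Fin n → UCox n) → BraidGroup n}
    (hφ : CompatibleBelow (size (replace₃ T i a b c)) φ)
    {d d' : BraidGroup n}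
    (hd : (d = sigma i (by omega) ∧ Below a b) ∨ (d = (sigma i (by omega))⁻¹ ∧ Below b a))
    (hd' : (d' = sigma (i + 1) hi ∧ Below b c) ∨ (d' = (sigma (i + 1) hi)⁻¹ ∧ Below c b)) :
    φ (hurwitz n (UCox n) d (replace₃ T i a b c)) * d =
      φ (hurwitz n (UCox n) d' (replace₃ T i a b c)) * d' := by
  have hbr := sigma_braid i hi
  have haa : ∀ x, a * (a * x) = x := fun x => by rw [← mul_assoc, Refl_mul_self ha, one_mul]
  have hs := size_replace₃ T i hi a b c
  have m1 := sigma_mem i (by omega : i + 1 < n)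
  have m2 := sigma_mem (i + 1) hi
  have m1' := sigma_inv_mem i (by omega : i + 1 < n)
  have m2' := sigma_inv_mem (i + 1) hi
  generalize hs1 : sigma i (by omega : i + 1 < n) = s₁ at *
  generalize hs2 : sigma (i + 1) hi = s₂ at *
  have key : ∀ x y z, len x + len y + len z < len a + len b + len c →
      size (replace₃ T i x y z) < size (replace₃ T i a b c) := by
    intro x y z h
    have := hs x y z
    omega
  have r1 : ∀ x y z, hurwitz n (UCox n) s₁ (replace₃ T i x y z) =
      replace₃ T i (x * y * x⁻¹) x z := by
    intro x y z
    rw [← hs1, hurwitz_sigma, hmove_left_replace₃]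
  have r2 : ∀ x y z, hurwitz n (UCox n) s₂ (replace₃ T i x y z) =
      replace₃ T i x (y * z * y⁻¹) y := by
    intro x y z
    rw [← hs2, hurwitz_sigma, hmove_right_replace₃]
  have r1' : ∀ x y z, hurwitz n (UCox n) s₁⁻¹ (replace₃ T i x y z) =
      replace₃ T i y (y⁻¹ * x * y) z := by
    intro x y z
    rw [← hs1, hurwitz_sigma_inv, hmoveInv_left_replace₃]
  have r2' : ∀ x y z, hurwitz n (UCox n) s₂⁻¹ (replace₃ T i x y z) =
      replace₃ T i x z (z⁻¹ * y * z) := by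
    intro x y z
    rw [← hs2, hurwitz_sigma_inv, hmoveInv_right_replace₃]
  rcases hd with ⟨rfl, hab⟩ | ⟨rfl, hba⟩ <;> rcases hd' with ⟨rfl, hbc⟩ | ⟨rfl, hcb⟩
  · have l1 := hab.len_conj_lt
    have l2 := hbc.len_conj_lt
    have l3 := (hab.trans hbc).len_conj_lt
    have l4 := hab.len_conj_conj_lt hbc
    refine hφ.join₃ ht (e₂ := d') (e₃ := d) (f₂ := d) (f₃ := d') m2 m1 m1 m2 hbr ?_ ?_ ?_ ?_ ?_
    all_goals
      simp only [r1, r2]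
      apply key
      simp only [mul_inv_rev, Refl_inv ha, Refl_inv hb, mul_assoc, haa] at l1 l2 l3 l4 ⊢
      omega
  · rcases hab.comparable hcb hac with hac | hca
    · have l1 := hab.len_conj_lt
      have l2 := hcb.len_conj_lt
      have l3 := hac.len_conj_lt
      have l4 := hac.len_conj_conj_lt hcb
      refine hφ.join₃ ht (e₂ := s₂) (e₃ := d⁻¹) (f₂ := d) (f₃ := s₂) m2 m1' m1 m2 ?_ ?_ ?_ ?_ ?_ ?_
      · rw [eq_mul_inv_iff_mul_eq, mul_assoc, mul_assoc, inv_mul_eq_iff_eq_mul]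
        simpa only [mul_assoc] using hbr.symm
      all_goals
        simp only [r1, r2, r1', r2']
        apply key
        simp only [mul_inv_rev, Refl_inv ha, Refl_inv hc, mul_assoc, haa] at l1 l2 l3 l4 ⊢
        omega
    · have l1 := hab.len_conj_lt
      have l2 := hcb.len_conj_lt
      have l3 := hca.len_conj_lt
      have l4 := hca.len_conj_conj_lt hab
      refine hφ.join₃ ht (e₂ := s₂⁻¹) (e₃ := d⁻¹) (f₂ := d⁻¹) (f₃ := s₂) m2' m1' m1' m2
        ?_ ?_ ?_ ?_ ?_ ?_
      · rw [eq_mul_inv_iff_mul_eq, eq_mul_inv_iff_mul_eq, mul_assoc, mul_assoc, ← mul_assoc d, hbr]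
        group
      all_goals
        simp only [r1, r1', r2']
        apply key
        simp only [Refl_inv ha, Refl_inv hc, mul_assoc] at l1 l2 l3 l4 ⊢
        omega
  · exact absurd ⟨hba, hbc⟩ hsource
  · have l1 := hba.len_conj_lt
    have l2 := hcb.len_conj_lt
    have l3 := (hcb.trans hba).len_conj_lt
    have l4 := hcb.len_conj_conj_lt hba
    refine hφ.join₃ ht (e₂ := s₂⁻¹) (e₃ := s₁⁻¹) (f₂ := s₁⁻¹) (f₃ := s₂⁻¹) m2' m1' m1' m2'
      ?_ ?_ ?_ ?_ ?_ ?_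
    · simpa [mul_assoc] using congrArg (·⁻¹) hbr
    all_goals
      simp only [r1', r2']
      apply key
      simp only [Refl_inv hb, Refl_inv hc, mul_assoc] at l1 l2 l3 l4 ⊢
      omega

lemma size_hurwitz_lt {t : Fin n → UCox n} (ht : t ∈ RedT n) {i : ℕ} (hi : i + 1 < n)
    {d : BraidGroup n} (hd : d = sigma i hi ∨ d = (sigma i hi)⁻¹)
    (h : size (hurwitz n (UCox n) d t) < size t) :
    (d = sigma i hi ∧ Below (t ⟨i, by omega⟩) (t ⟨i + 1, hi⟩)) ∨
      (d = (sigma i hi)⁻¹ ∧ Below (t ⟨i + 1, hi⟩) (t ⟨i, by omega⟩)) := by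
  rcases hd with rfl | rfl
  · rw [hurwitz_sigma] at h
    exact Or.inl ⟨rfl, (size_hmove_lt_iff ht hi).2.mp h⟩
  · rw [hurwitz_sigma_inv] at h
    exact Or.inr ⟨rfl, (size_hmoveInv_lt_iff ht hi).2.mp h⟩

lemma CompatibleBelow.join_of_le {t : Fin n → UCox n} (ht : t ∈ RedT n)
    {φ : (Fin n → UCox n) → BraidGroup n} (hφ : CompatibleBelow (size t) φ)
    {i j : ℕ} (hij : i ≤ j) (hj : j + 1 < n) {d d' : BraidGroup n}
    (hd : d = sigma i (by omega) ∨ d = (sigma i (by omega))⁻¹)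
    (hd' : d' = sigma j hj ∨ d' = (sigma j hj)⁻¹)
    (h : size (hurwitz n (UCox n) d t) < size t) (h' : size (hurwitz n (UCox n) d' t) < size t) :
    φ (hurwitz n (UCox n) d t) * d = φ (hurwitz n (UCox n) d' t) * d' := by
  rcases lt_or_ge (i + 1) j with hfar | hnear
  · have hs := size_hurwitz_hurwitz hfar hj hd hd' t
    exact hφ.join₂ ht ⟨i, _, hd⟩ ⟨j, _, hd'⟩ (commute_of_far hfar hj hd hd') h h' (by omega)
  have hb := size_hurwitz_lt ht _ hd h
  have hb' := size_hurwitz_lt ht _ hd' h'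
  rcases hij.eq_or_lt with rfl | hlt
  · rcases hb with ⟨rfl, hb⟩ | ⟨rfl, hb⟩ <;> rcases hb' with ⟨rfl, hb'⟩ | ⟨rfl, hb'⟩
    · rfl
    · exact absurd hb.len_lt hb'.len_lt.asymm
    · exact absurd hb.len_lt hb'.len_lt.asymm
    · rfl
  · obtain rfl : j = i + 1 := by omega
    have e := eq_replace₃ t i hj
    have hac : t ⟨i, by omega⟩ ≠ t ⟨i + 2, hj⟩ := fun h => by
      have := RedT_injective ht h
      simp at this
    have := join_adjacent (T := t) hj (e ▸ ht) (ht.1 _) (ht.1 _) (ht.1 _) hac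
      (fun h => (descending_of_mem_RedT ht).not_below_both ht hj h.1 h.2) (e ▸ hφ) hb hb'
    rwa [← e] at this

theorem hurwitz_free {t : Fin n → UCox n} (ht : t ∈ RedT n) {β : BraidGroup n}
    (h : hurwitz n (UCox n) β t = t) : β = 1 := by
  refine free_of_confluence (hurwitz n (UCox n)) (sigmaSet n) (closure_sigmaSet n)
    (fun _ => inv_mem_sigmaSet) (RedT n) (fun β _ => hurwitz_mem_RedT β) size ?_ ?_ ht h
  · rintro t ht _ ⟨i, hi, rfl | rfl⟩
    · rw [hurwitz_sigma]
      exact (size_hmove_lt_iff ht hi).1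
    · rw [hurwitz_sigma_inv]
      exact (size_hmoveInv_lt_iff ht hi).1
  · rintro t ht d ⟨i, hi, hd⟩ d' ⟨j, hj, hd'⟩ h h' φ hφ
    rcases le_total i j with hij | hij
    · exact CompatibleBelow.join_of_le ht hφ hij hj hd hd' h h'
    · exact (CompatibleBelow.join_of_le ht hφ hij hi hd' hd h' h).symm

end UCoxHurwitz

/-- The Hurwitz action of `B_n` on `Red_T(c)` is simply transitive. -/
theorem hurwitz_simply_transitive_RedT (n : ℕ) :
    ∃ act : BraidGroup n →* Equiv.Perm (Fin n → UCox n),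
      (∀ (i : ℕ) (hi : i + 1 < n),
        ⇑(act (PresentedGroup.of ⟨i, by omega⟩)) = hmove n (UCox n) i hi) ∧
      ∀ a ∈ RedT n, ∀ b ∈ RedT n, ∃! β : BraidGroup n, act β a = b := by
  refine ⟨UCoxHurwitz.hurwitz n (UCox n),
    fun i hi => funext (UCoxHurwitz.hurwitz_sigma i hi), fun a ha b hb => ?_⟩
  obtain ⟨α, hα⟩ := UCoxHurwitz.exists_hurwitz_eq_sgen ha
  obtain ⟨β, hβ⟩ := UCoxHurwitz.exists_hurwitz_eq_sgen hb
  refine ⟨β⁻¹ * α, ?_, fun γ hγ => ?_⟩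
  · simp only [map_mul, Equiv.Perm.mul_apply, hα, map_inv, Equiv.Perm.inv_eq_iff_eq, hβ]
  · have h : UCoxHurwitz.hurwitz n (UCox n) (α⁻¹ * (β * γ)) a = a := by
      simp only [map_mul, Equiv.Perm.mul_apply, hγ, hβ, map_inv, Equiv.Perm.inv_eq_iff_eq, hα]
    have := UCoxHurwitz.hurwitz_free ha h
    rw [inv_mul_eq_one] at this
    rw [this, inv_mul_cancel_left]
end

section
/- The standard (Hurwitz/Artin) representation of the braid group B_n in Aut(F_n), sending σ_i to the automorphism f_i ↦ f_i f_{i+1} f_i^{-1}, f_{i+1} ↦ f_i, f_j ↦ f_j (j ≠ i, i+1), is faithful (injective). -/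
/-- The endomorphism of the free group on `Fin N` given by the elementary Hurwitz move. -/
def artinHom (N i : ℕ) (hi : i + 1 < N) : FreeGroup (Fin N) →* FreeGroup (Fin N) :=
  FreeGroup.lift (hmove N _ i hi FreeGroup.of)

/-- The inverse of `artinHom`. -/
def artinInvHom (N i : ℕ) (hi : i + 1 < N) : FreeGroup (Fin N) →* FreeGroup (Fin N) :=
  FreeGroup.lift fun j =>
    if (j : ℕ) = i then FreeGroup.of ⟨i + 1, hi⟩
    else if (j : ℕ) = i + 1 then
      (FreeGroup.of ⟨i + 1, hi⟩)⁻¹ * FreeGroup.of ⟨i, by omega⟩ * FreeGroup.of ⟨i + 1, hi⟩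
    else FreeGroup.of j

/-- The automorphism of the free group by which a braid generator acts. -/
def artinAut (N i : ℕ) (hi : i + 1 < N) : MulAut (FreeGroup (Fin N)) :=
  MonoidHom.toMulEquiv (artinHom N i hi) (artinInvHom N i hi)
    (by
      ext ⟨j, hj⟩
      by_cases h : j = i
      · subst h; simp [artinHom, artinInvHom, hmove]; group
      by_cases h' : j = i + 1
      · subst h'; simp [artinHom, artinInvHom, hmove]
      simp [artinHom, artinInvHom, hmove, h, h'])
    (by
      ext ⟨j, hj⟩
      by_cases h : j = i
      · subst h; simp [artinHom, artinInvHom, hmove]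
      by_cases h' : j = i + 1
      · subst h'; simp [artinHom, artinInvHom, hmove]; group
      simp [artinHom, artinInvHom, hmove, h, h'])

theorem artinAut_of (N i : ℕ) (hi : i + 1 < N) (j : Fin N) :
    artinAut N i hi (FreeGroup.of j) = hmove N _ i hi FreeGroup.of j := by
  simp [artinAut, artinHom]

theorem mulAut_freeGroup_ext {α : Type*} {a b : MulAut (FreeGroup α)}
    (h : ∀ j, a (FreeGroup.of j) = b (FreeGroup.of j)) : a = b := by
  have : a.toMonoidHom = b.toMonoidHom := FreeGroup.ext_hom _ _ h
  ext x
  exact DFunLike.congr_fun this x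

theorem artinAut_braid (N i : ℕ) (hi : i + 2 < N) :
    artinAut N i (by omega) * artinAut N (i + 1) hi * artinAut N i (by omega) =
      artinAut N (i + 1) hi * artinAut N i (by omega) * artinAut N (i + 1) hi := by
  refine mulAut_freeGroup_ext ?_
  rintro ⟨j, hj⟩
  have hne : i ≠ i + 1 + 1 := by omega
  by_cases h : j = i
  · subst h; simp [artinAut_of, hmove, hne, hne.symm, mul_assoc]
  by_cases h' : j = i + 1
  · subst h'; simp [artinAut_of, hmove, hne, hne.symm]
  by_cases h'' : j = i + 2
  · subst h''; simp [artinAut_of, hmove, hne]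
  simp [artinAut_of, hmove, h, h', h'']

theorem artinAut_commute (N i j : ℕ) (hij : i + 1 < j) (hj : j + 1 < N) :
    artinAut N i (by omega) * artinAut N j hj = artinAut N j hj * artinAut N i (by omega) := by
  refine mulAut_freeGroup_ext ?_
  rintro ⟨l, hl⟩
  have h1 : i ≠ j := by omega
  have h2 : i ≠ j + 1 := by omega
  have h3 : i + 1 ≠ j := by omega
  by_cases h : l = i
  · subst h; simp [artinAut_of, hmove, *]
  by_cases h' : l = i + 1
  · subst h'; simp [artinAut_of, hmove, *]
  by_cases h4 : l = j
  · subst h4; simp [artinAut_of, hmove, *, h1.symm, h2.symm, h3.symm]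
  by_cases h5 : l = j + 1
  · subst h5; simp [artinAut_of, hmove, *, h1.symm, h2.symm, h3.symm]
  simp [artinAut_of, hmove, *]

/-- Elements `s 0, s 1, …` of a group satisfy the braid relations of `B_N` and act on the free
group on `Fin N` through the elementary Hurwitz moves. -/
structure IsArtinAction {G : Type*} [Group G] (N : ℕ) (s : ℕ → G)
    (act : G →* MulAut (FreeGroup (Fin N))) : Prop where
  braid : ∀ i, i + 2 < N → s i * s (i + 1) * s i = s (i + 1) * s i * s (i + 1)
  comm : ∀ i j, i + 1 < j → j + 1 < N → Commute (s i) (s j)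
  act_of : ∀ i (hi : i + 1 < N) j,
    act (s i) (FreeGroup.of j) = hmove N _ i hi FreeGroup.of j

/-- The endomorphism of the free group killing the generators of index greater than `m`. -/
def truncHom (N m : ℕ) : FreeGroup (Fin N) →* FreeGroup (Fin N) :=
  FreeGroup.lift fun j => if (j : ℕ) ≤ m then FreeGroup.of j else 1

theorem truncHom_of_le {N m : ℕ} {j : Fin N} (h : (j : ℕ) ≤ m) :
    truncHom N m (FreeGroup.of j) = FreeGroup.of j := by
  simp [truncHom, h]

theorem truncHom_of_lt {N m : ℕ} {j : Fin N} (h : m < (j : ℕ)) :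
    truncHom N m (FreeGroup.of j) = 1 := by
  simp [truncHom, h]

/-- An element commuting with the generator of index `m + 1` dies under truncation. -/
theorem truncHom_eq_one_of_commute {N m : ℕ} (hm : m + 1 < N) {v : FreeGroup (Fin N)}
    (hv : v * FreeGroup.of ⟨m + 1, hm⟩ = FreeGroup.of ⟨m + 1, hm⟩ * v) :
    truncHom N m v = 1 := by
  classical
  let ρ : FreeGroup (Fin N) →* Equiv.Perm (FreeGroup (Fin N) × Bool) := FreeGroup.lift fun j =>
    if (j : ℕ) = m + 1 then Equiv.swap (1, true) (1, false)
    else (Equiv.mulLeft (truncHom N m (FreeGroup.of j))).prodCongr (Equiv.refl Bool)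
  have hρ : ∀ (x : FreeGroup (Fin N)) (p : FreeGroup (Fin N) × Bool),
      (ρ x p).1 = truncHom N m x * p.1 := by
    intro x
    induction x using FreeGroup.induction_on with
    | C1 => simp
    | of j =>
      intro p
      by_cases h : (j : ℕ) = m + 1
      · rw [truncHom_of_lt (by omega)]
        simp only [ρ, FreeGroup.lift_apply_of, h, if_true, Equiv.swap_apply_def]
        split_ifs with h1 h2
        · simp [h1]
        · simp [h2]
        · simp
      · simp [ρ, h]
    | inv_of j ih =>
      intro p
      have := ih ((ρ (FreeGroup.of j))⁻¹ p)
      rw [← Equiv.Perm.mul_apply, mul_inv_cancel, Equiv.Perm.one_apply] at this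
      rw [map_inv, map_inv, this, inv_mul_cancel_left]
    | mul x y hx hy =>
      intro p
      rw [map_mul, Equiv.Perm.mul_apply, hx, hy, map_mul, mul_assoc]
  by_contra hne
  have hf : ρ (FreeGroup.of ⟨m + 1, hm⟩) = Equiv.swap (1, true) (1, false) := by simp [ρ]
  have h := congrArg (fun x => ρ x (1, true)) hv
  simp only [map_mul, Equiv.Perm.mul_apply, hf, Equiv.swap_apply_left] at h
  have h1 : (ρ v (1, true)).1 ≠ 1 := by rw [hρ]; simpa using hne
  rw [Equiv.swap_apply_of_ne_of_ne (fun e => h1 (by rw [e])) (fun e => h1 (by rw [e]))] at h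
  simpa using (ρ v).injective h

/-- A sequence with prescribed value at `m` and prescribed downward recursion. -/
theorem exists_downward_rec {α : Type*} (m : ℕ) (a : α) (step : ℕ → α → α) :
    ∃ A : ℕ → α, A m = a ∧ ∀ i < m, A i = step i (A (i + 1)) := by
  let E : ℕ → α := fun d => Nat.rec a (fun d x => step (m - 1 - d) x) d
  refine ⟨fun j => E (m - j), by simp [E], fun i hi => ?_⟩
  obtain ⟨d, rfl⟩ : ∃ d, m = i + 1 + d := ⟨m - (i + 1), by omega⟩
  have h1 : i + 1 + d - i = d + 1 := by omega
  have h2 : i + 1 + d - (i + 1) = d := by omega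
  have h3 : i + 1 + d - 1 - d = i := by omega
  simp only [h1, h2]
  change step (i + 1 + d - 1 - d) (E d) = _
  rw [h3]

theorem conj_conj_of_commute {G : Type*} [Group G] {s x : G}
    (h : x * (s * x * s) = s * x * s * x) :
    s * (s * x⁻¹ * s⁻¹) * s⁻¹ = s * x⁻¹ * s⁻¹ * x⁻¹ * (s * x⁻¹ * s⁻¹)⁻¹ := by
  have e : x⁻¹ * s⁻¹ * x⁻¹ * s⁻¹ = s⁻¹ * x⁻¹ * s⁻¹ * x⁻¹ := by
    simpa [mul_assoc] using (congrArg (·⁻¹) h).symm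
  calc s * (s * x⁻¹ * s⁻¹) * s⁻¹
      = s * (s * (x⁻¹ * s⁻¹ * x⁻¹ * s⁻¹) * s⁻¹) * s * s * x * s⁻¹ := by group
    _ = s * (x⁻¹ * s⁻¹ * x⁻¹ * s⁻¹) * s * s * x * s⁻¹ := by
      nth_rw 1 [e]; group
    _ = _ := by group

namespace IsArtinAction

variable {G : Type*} [Group G] {N : ℕ} {s : ℕ → G} {act : G →* MulAut (FreeGroup (Fin N))}

/-- Coset decomposition of the subgroup generated by `s 0, …, s m`. -/
theorem exists_coset_rep (h : IsArtinAction N s act) {m : ℕ} (hm : m + 1 < N) (K : Subgroup G)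
    (hK : ∀ i < m, s i ∈ K) (hK2 : s m * s m ∈ K) {g : G}
    (hg : g ∈ Subgroup.closure (s '' Set.Iio (m + 1))) :
    ∃ κ ∈ K, g = κ ∨ ∃ x ∈ Subgroup.closure (s '' Set.Iio m), g = κ * s m * x := by
  obtain ⟨c, hc, hcs⟩ := exists_downward_rec (m + 1) (1 : G) (fun i x => x * s i)
  have hfar : ∀ j ≤ m + 1, ∀ i, i + 1 < j → Commute (s i) (c j) := by
    intro j hj
    induction hj using Nat.decreasingInduction with
    | self => intro i _; rw [hc]; exact Commute.one_right _
    | of_succ j hj ih =>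
      intro i hi
      rw [hcs j (by omega)]
      exact (ih i (by omega)).mul_right (h.comm i j hi (by omega))
  have hnear : ∀ j ≤ m + 1, ∀ i, j ≤ i → i + 1 ≤ m → c j * s (i + 1) = s i * c j := by
    intro j hj
    induction hj using Nat.decreasingInduction with
    | self => intro i _ _; omega
    | of_succ j hj ih =>
      intro i hi hi'
      rw [hcs j (by omega)]
      rcases hi.eq_or_lt with rfl | hlt
      · rw [hcs (j + 1) (by omega)]
        have := (hfar (j + 1 + 1) (by omega) j (by omega)).eq
        have hb := h.braid j (by omega)
        calc c (j + 1 + 1) * s (j + 1) * s j * s (j + 1)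
            = c (j + 1 + 1) * (s (j + 1) * s j * s (j + 1)) := by group
          _ = c (j + 1 + 1) * s j * s (j + 1) * s j := by rw [← hb]; group
          _ = _ := by rw [← this]; group
      · rw [mul_assoc, (h.comm j (i + 1) (by omega) (by omega)).eq, ← mul_assoc,
          ih i (by omega) hi', mul_assoc]
  have hD : ∀ j ≤ m, c (j + 1) * (s j * s j) * (c (j + 1))⁻¹ ∈ K := by
    intro j hj
    induction hj using Nat.decreasingInduction with
    | self => simpa [hc] using hK2
    | of_succ j hj ih =>
      have hb := h.braid j (by omega)
      have hs := hK j hj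
      have : c (j + 1) * (s j * s j) * (c (j + 1))⁻¹ =
          (s j)⁻¹ * (c (j + 1 + 1) * (s (j + 1) * s (j + 1)) * (c (j + 1 + 1))⁻¹) * s j := by
        rw [hcs (j + 1) (by omega)]
        have h1 : s (j + 1) * (s j * s j) * (s (j + 1))⁻¹ =
            (s j)⁻¹ * (s (j + 1) * s (j + 1)) * s j := by
          have e1 : s (j + 1) * s j * (s (j + 1))⁻¹ = (s j)⁻¹ * s (j + 1) * s j := by
            rw [mul_inv_eq_iff_eq_mul, mul_assoc, mul_assoc, eq_inv_mul_iff_mul_eq]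
            simpa [mul_assoc] using hb
          calc _ = (s (j + 1) * s j * (s (j + 1))⁻¹) * (s (j + 1) * s j * (s (j + 1))⁻¹) := by
                group
            _ = _ := by rw [e1]; group
        have h2 : c (j + 1 + 1) * (s j)⁻¹ = (s j)⁻¹ * c (j + 1 + 1) :=
          ((hfar (j + 1 + 1) (by omega) j (by omega)).inv_left).eq.symm
        have h3 : s j * (c (j + 1 + 1))⁻¹ = (c (j + 1 + 1))⁻¹ * s j :=
          ((hfar (j + 1 + 1) (by omega) j (by omega)).inv_right).eq
        calc _ = c (j + 1 + 1) * (s (j + 1) * (s j * s j) * (s (j + 1))⁻¹) *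
              (c (j + 1 + 1))⁻¹ := by group
          _ = c (j + 1 + 1) * (s j)⁻¹ * (s (j + 1) * s (j + 1)) *
              (s j * (c (j + 1 + 1))⁻¹) := by rw [h1]; group
          _ = _ := by rw [h2, h3]; group
      rw [this]
      exact K.mul_mem (K.mul_mem (K.inv_mem hs) ih) hs
  have hconj : ∀ j ≤ m + 1, ∀ i < m + 1, i ≠ j → i + 1 ≠ j →
      ∃ x ∈ K, c j * s i = x * c j := by
    intro j hj i hi h1 h2
    rcases Nat.lt_or_ge (i + 1) j with h3 | h3
    · exact ⟨s i, hK i (by omega), ((hfar j hj i h3).eq).symm⟩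
    · obtain ⟨i, rfl⟩ : ∃ i', i = i' + 1 := ⟨i - 1, by omega⟩
      exact ⟨s i, hK i (by omega), hnear j hj i (by omega) (by omega)⟩
  have hcover : ∃ κ ∈ K, ∃ j ≤ m + 1, g = κ * c j := by
    induction hg using Subgroup.closure_induction_right with
    | one => exact ⟨1, K.one_mem, m + 1, le_rfl, by simp [hc]⟩
    | mul_right g y _ hy ih =>
      obtain ⟨i, hi, rfl⟩ := hy
      simp only [Set.mem_Iio] at hi
      obtain ⟨κ, hκ, j, hj, rfl⟩ := ih
      by_cases h1 : i = j
      · subst h1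
        refine ⟨κ * (c (i + 1) * (s i * s i) * (c (i + 1))⁻¹), K.mul_mem hκ (hD i (by omega)),
          i + 1, by omega, ?_⟩
        rw [hcs i hi]; group
      by_cases h2 : i + 1 = j
      · subst h2
        exact ⟨κ, hκ, i, by omega, by rw [hcs i hi, mul_assoc]⟩
      obtain ⟨x, hx, e⟩ := hconj j hj i hi h1 h2
      exact ⟨κ * x, K.mul_mem hκ hx, j, hj, by rw [mul_assoc, e, mul_assoc]⟩
    | mul_inv_cancel g y _ hy ih =>
      obtain ⟨i, hi, rfl⟩ := hy
      simp only [Set.mem_Iio] at hi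
      obtain ⟨κ, hκ, j, hj, rfl⟩ := ih
      by_cases h1 : i = j
      · subst h1
        exact ⟨κ, hκ, i + 1, by omega, by rw [hcs i hi]; group⟩
      by_cases h2 : i + 1 = j
      · subst h2
        refine ⟨κ * (c (i + 1) * (s i * s i) * (c (i + 1))⁻¹)⁻¹,
          K.mul_mem hκ (K.inv_mem (hD i (by omega))), i, by omega, ?_⟩
        rw [hcs i hi]; group
      obtain ⟨x, hx, e⟩ := hconj j hj i hi h1 h2
      refine ⟨κ * x⁻¹, K.mul_mem hκ (K.inv_mem hx), j, hj, ?_⟩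
      rw [mul_assoc, mul_assoc, mul_right_inj, mul_inv_eq_iff_eq_mul, mul_assoc, e,
        inv_mul_cancel_left]
  obtain ⟨κ, hκ, j, hj, rfl⟩ := hcover
  refine ⟨κ, hκ, ?_⟩
  have hform : ∀ j ≤ m, ∃ x ∈ Subgroup.closure (s '' Set.Iio m), c j = s m * x := by
    intro j hj
    induction hj using Nat.decreasingInduction with
    | self => exact ⟨1, Subgroup.one_mem _, by rw [hcs m (by omega), hc]; simp⟩
    | of_succ j hj ih =>
      obtain ⟨x, hx, e⟩ := ih
      exact ⟨x * s j, Subgroup.mul_mem _ hx (Subgroup.subset_closure ⟨j, hj, rfl⟩),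
        by rw [hcs j (by omega), e, mul_assoc]⟩
  rcases hj.eq_or_lt with rfl | hlt
  · left; simp [hc]
  · obtain ⟨x, hx, e⟩ := hform j (by omega)
    exact Or.inr ⟨x, hx, by rw [e, mul_assoc]⟩

/-- Braids on the first `m + 1` strands commute with truncation. -/
theorem truncHom_act (h : IsArtinAction N s act) {m : ℕ} (hm : m + 1 < N) {b : G}
    (hb : b ∈ Subgroup.closure (s '' Set.Iio m)) (x : FreeGroup (Fin N)) :
    truncHom N m (act b x) = act b (truncHom N m x) := by
  induction hb using Subgroup.closure_induction generalizing x with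
  | mem y hy =>
    obtain ⟨i, hi, rfl⟩ := hy
    simp only [Set.mem_Iio] at hi
    have : (truncHom N m).comp (act (s i)).toMonoidHom =
        (act (s i)).toMonoidHom.comp (truncHom N m) := by
      ext ⟨j, hj⟩
      by_cases h1 : j = i
      · subst h1
        simp [h.act_of _ (by omega : j + 1 < N), hmove, truncHom, hi.le, Nat.succ_le_of_lt hi]
      by_cases h2 : j = i + 1
      · subst h2
        simp [h.act_of _ (by omega : i + 1 < N), hmove, truncHom, hi.le, Nat.succ_le_of_lt hi]
      by_cases h3 : j ≤ m
      · simp [h.act_of _ (by omega : i + 1 < N), hmove, truncHom, h1, h2, h3]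
      · simp [h.act_of _ (by omega : i + 1 < N), hmove, truncHom, h1, h2, h3]
    exact DFunLike.congr_fun this x
  | one => simp
  | mul a b _ _ iha ihb => simp [iha, ihb]
  | inv a _ ih =>
    have := ih ((act a)⁻¹ x)
    rw [MulAut.apply_inv_self] at this
    rw [map_inv, this, MulAut.inv_apply_self]

/-- Braids on the first `m + 1` strands fix the later generators. -/
theorem act_of_of_lt (h : IsArtinAction N s act) {m : ℕ} {b : G}
    (hb : b ∈ Subgroup.closure (s '' Set.Iio m)) {j : Fin N} (hj : m < j) :
    act b (FreeGroup.of j) = FreeGroup.of j := by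
  induction hb using Subgroup.closure_induction with
  | mem y hy =>
    obtain ⟨i, hi, rfl⟩ := hy
    simp only [Set.mem_Iio] at hi
    rw [h.act_of i (by omega), hmove, if_neg (by omega), if_neg (by omega)]
  | one => simp
  | mul a b _ _ iha ihb => simp [iha, ihb]
  | inv a _ ih =>
    nth_rw 1 [← ih]
    rw [map_inv, MulAut.inv_apply_self]

theorem truncHom_act_sq (h : IsArtinAction N s act) {m : ℕ} (hm : m + 1 < N)
    (x : FreeGroup (Fin N)) : truncHom N m (act (s m * s m) x) = truncHom N m x := by
  have : (truncHom N m).comp (act (s m * s m)).toMonoidHom = truncHom N m := by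
    ext ⟨j, hj⟩
    by_cases h1 : j = m
    · subst h1
      simp [h.act_of _ hm, hmove, truncHom]
    by_cases h2 : j = m + 1
    · subst h2
      simp [h.act_of _ hm, hmove, truncHom]
    simp [h.act_of _ hm, hmove, truncHom, h1, h2]
  exact DFunLike.congr_fun this x

/-- The point-pushing homomorphism: its values carry strand `m + 1` around the earlier strands,
equivariantly for the braids on the first `m + 1` strands. -/
theorem exists_pushHom (h : IsArtinAction N s act) {m : ℕ} (hm : m + 1 < N) :
    ∃ φ : FreeGroup (Fin N) →* G,
      φ (FreeGroup.of ⟨m, by omega⟩) = (s m * s m)⁻¹ ∧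
      (∀ w, φ (truncHom N m w) = φ w) ∧
      ∀ b ∈ Subgroup.closure (s '' Set.Iio m), ∀ w, φ (act b w) = b * φ w * b⁻¹ := by
  obtain ⟨A, hA, hAs⟩ := exists_downward_rec m (s m * s m)⁻¹ (fun i x => s i * x * (s i)⁻¹)
  have hfar : ∀ j ≤ m, ∀ i, i + 1 < j → Commute (s i) (A j) := by
    intro j hj
    induction hj using Nat.decreasingInduction with
    | self =>
      intro i hi
      rw [hA]
      have := h.comm i m hi hm
      exact (this.mul_right this).inv_right
    | of_succ j hj ih =>
      intro i hi
      rw [hAs j hj]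
      have := h.comm i j hi (by omega)
      exact (this.mul_right (ih i (by omega))).mul_right this.inv_right
  have hnear : ∀ i < m, ∀ j < i, Commute (s i) (A j) := by
    intro i hi j hj
    induction Nat.le_sub_one_of_lt hj using Nat.decreasingInduction with
    | self =>
      obtain ⟨i, rfl⟩ : ∃ i', i = i' + 1 := ⟨i - 1, by omega⟩
      have hb := h.braid i (by omega)
      have hc := hfar (i + 1 + 1) (by omega) i (by omega)
      rw [Nat.add_sub_cancel, hAs i (by omega), hAs (i + 1) hi]
      have e : s i * (s (i + 1) * A (i + 1 + 1) * (s (i + 1))⁻¹) * (s i)⁻¹ =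
          (s i * s (i + 1)) * A (i + 1 + 1) * (s i * s (i + 1))⁻¹ := by group
      have e' : s (i + 1) = (s i * s (i + 1)) * s i * (s i * s (i + 1))⁻¹ := by
        rw [eq_mul_inv_iff_mul_eq, hb, mul_assoc]
      rw [e]
      nth_rw 1 [e']
      exact (Commute.conj_iff _).2 hc
    | of_succ j hj' ih =>
      rw [hAs j (by omega)]
      have := (h.comm j i (by omega) (by omega)).symm
      exact (this.mul_right (ih (by omega))).mul_right this.inv_right
  have hself : ∀ i, i + 1 ≤ m → s i * A i * (s i)⁻¹ = A i * A (i + 1) * (A i)⁻¹ := by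
    intro i hi
    obtain ⟨m, rfl⟩ : ∃ m', m = m' + 1 := ⟨m - 1, by omega⟩
    induction Nat.le_of_succ_le_succ hi using Nat.decreasingInduction with
    | self =>
      rw [hAs m (by omega), hA]
      have hb := h.braid m (by omega)
      refine conj_conj_of_commute ?_
      calc s (m + 1) * s (m + 1) * (s m * (s (m + 1) * s (m + 1)) * s m)
          = s (m + 1) * (s (m + 1) * s m * s (m + 1)) * s (m + 1) * s m := by group
        _ = s (m + 1) * (s m * s (m + 1) * s m) * s (m + 1) * s m := by rw [hb]
        _ = (s (m + 1) * s m * s (m + 1)) * (s m * s (m + 1) * s m) := by group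
        _ = (s m * s (m + 1) * s m) * (s (m + 1) * s m * s (m + 1)) := by rw [hb]
        _ = s m * s (m + 1) * (s m * s (m + 1) * s m) * s (m + 1) := by group
        _ = s m * s (m + 1) * (s (m + 1) * s m * s (m + 1)) * s (m + 1) := by rw [hb]
        _ = _ := by group
    | of_succ i hi' ih =>
      have ih := ih (by omega)
      obtain ⟨g, hgdef⟩ : ∃ g, g = s (i + 1) * s i := ⟨_, rfl⟩
      have hb := h.braid i (by omega)
      have e1 : s i = g * s (i + 1) * g⁻¹ := by
        rw [eq_mul_inv_iff_mul_eq, hgdef, ← mul_assoc, hb]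
      have e3 : A (i + 1) = g * A (i + 1 + 1) * g⁻¹ := by
        have hc := (hfar (i + 1 + 1) (by omega) i (by omega)).eq
        rw [hAs (i + 1) (by omega), hgdef, mul_inv_rev]
        have : s i * A (i + 1 + 1) * (s i)⁻¹ = A (i + 1 + 1) := by
          rw [hc, mul_inv_cancel_right]
        calc _ = s (i + 1) * (s i * A (i + 1 + 1) * (s i)⁻¹) * (s (i + 1))⁻¹ := by rw [this]
          _ = _ := by group
      have e2 : A i = g * A (i + 1) * g⁻¹ := by
        have hc := (hnear (i + 1) (by omega) i (by omega)).eq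
        have : A i = s (i + 1) * A i * (s (i + 1))⁻¹ := by rw [hc, mul_inv_cancel_right]
        rw [this, hAs i (by omega), hgdef]
        group
      calc s i * A i * (s i)⁻¹
          = g * (s (i + 1) * A (i + 1) * (s (i + 1))⁻¹) * g⁻¹ := by rw [e1, e2]; group
        _ = (g * A (i + 1) * g⁻¹) * (g * A (i + 1 + 1) * g⁻¹) * (g * A (i + 1) * g⁻¹)⁻¹ := by
          rw [ih]; group
        _ = _ := by rw [← e2, ← e3]
  let φ : FreeGroup (Fin N) →* G :=
    FreeGroup.lift fun j => if (j : ℕ) ≤ m then A j else 1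
  refine ⟨φ, by simp [φ, hA], fun w => ?_, fun b hb => ?_⟩
  · have : φ.comp (truncHom N m) = φ := by
      ext ⟨j, hj⟩
      by_cases h1 : j ≤ m <;> simp [φ, truncHom, h1]
    exact DFunLike.congr_fun this w
  · induction hb using Subgroup.closure_induction with
    | mem y hy =>
      obtain ⟨i, hi, rfl⟩ := hy
      simp only [Set.mem_Iio] at hi
      intro w
      have : φ.comp (act (s i)).toMonoidHom = (MulAut.conj (s i)).toMonoidHom.comp φ := by
        ext ⟨j, hj⟩
        by_cases h1 : j = i
        · subst h1
          simp [h.act_of _ (by omega : j + 1 < N), hmove, φ, hi.le, Nat.succ_le_of_lt hi,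
            hself j hi]
        by_cases h2 : j = i + 1
        · subst h2
          simp [h.act_of _ (by omega : i + 1 < N), hmove, φ, hi.le, Nat.succ_le_of_lt hi,
            hAs i hi]
        by_cases h3 : j ≤ m
        · have : Commute (s i) (A j) := by
            rcases Nat.lt_or_ge j i with h4 | h4
            · exact hnear i hi j h4
            · exact hfar j h3 i (by omega)
          simp [h.act_of _ (by omega : i + 1 < N), hmove, φ, h1, h2, h3, this.eq]
        · simp [h.act_of _ (by omega : i + 1 < N), hmove, φ, h1, h2, h3]
      exact DFunLike.congr_fun this w
    | one => simp
    | mul a b _ _ iha ihb => intro w; simp [iha, ihb, mul_assoc]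
    | inv a _ ih =>
      intro w
      have := ih ((act a)⁻¹ w)
      rw [MulAut.apply_inv_self] at this
      rw [map_inv, this]; group

/-- An element of the subgroup generated by `s 0, …, s (m - 1)` that acts trivially is trivial. -/
theorem eq_one_of_act_eq_one (h : IsArtinAction N s act) (m : ℕ) (hm : m < N) {g : G}
    (hg : g ∈ Subgroup.closure (s '' Set.Iio m)) (hact : act g = 1) : g = 1 := by
  induction m generalizing g with
  | zero => simpa using hg
  | succ m ih =>
    obtain ⟨φ, hφm, hφt, hφ⟩ := h.exists_pushHom hm
    set H := Subgroup.closure (s '' Set.Iio m)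
    have hshift : ∀ j (hj : j ≤ m), ∃ b ∈ H,
        act b (FreeGroup.of ⟨m, by omega⟩) = FreeGroup.of ⟨j, by omega⟩ := by
      intro j hj
      induction hj using Nat.decreasingInduction with
      | self => exact ⟨1, H.one_mem, by simp⟩
      | of_succ j hj ihj =>
        obtain ⟨b, hb, e⟩ := ihj
        refine ⟨s j * b, H.mul_mem (Subgroup.subset_closure ⟨j, hj, rfl⟩) hb, ?_⟩
        rw [map_mul, MulAut.mul_apply, e, h.act_of j (by omega)]
        simp [hmove]
    have htrunc : ∀ w x, truncHom N m (act (φ w) x) = truncHom N m x := by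
      have hinv : ∀ g, (∀ x, truncHom N m (act g x) = truncHom N m x) →
          ∀ x, truncHom N m (act g⁻¹ x) = truncHom N m x := by
        intro g hg x
        rw [← hg, map_inv, MulAut.apply_inv_self]
      intro w
      induction w using FreeGroup.induction_on with
      | C1 => simp
      | of j =>
        intro x
        rcases Nat.lt_or_ge m j with hj | hj
        · rw [← hφt, truncHom_of_lt hj]; simp
        · obtain ⟨b, hb, e⟩ := hshift j hj
          rw [← e, hφ b hb, hφm, map_mul, map_mul, MulAut.mul_apply, MulAut.mul_apply,
            h.truncHom_act hm hb, hinv _ (h.truncHom_act_sq hm), ← h.truncHom_act hm hb,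
            map_inv, MulAut.apply_inv_self]
      | inv_of j ihj => rw [map_inv]; exact hinv _ ihj
      | mul a b iha ihb => intro x; rw [map_mul, map_mul, MulAut.mul_apply, iha, ihb]
    have hpush : ∀ w, ∃ v, truncHom N m v = (truncHom N m w)⁻¹ ∧
        act (φ w) (FreeGroup.of ⟨m + 1, hm⟩) = v * FreeGroup.of ⟨m + 1, hm⟩ * v⁻¹ := by
      have hinv : ∀ w, (∃ v, truncHom N m v = (truncHom N m w)⁻¹ ∧
          act (φ w) (FreeGroup.of ⟨m + 1, hm⟩) = v * FreeGroup.of ⟨m + 1, hm⟩ * v⁻¹) →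
          ∃ v, truncHom N m v = (truncHom N m w⁻¹)⁻¹ ∧
          act (φ w⁻¹) (FreeGroup.of ⟨m + 1, hm⟩) = v * FreeGroup.of ⟨m + 1, hm⟩ * v⁻¹ := by
        rintro w ⟨v, hv, e⟩
        refine ⟨(act (φ w⁻¹) v)⁻¹, by rw [map_inv, htrunc, hv, map_inv], ?_⟩
        have e' := congrArg (act (φ w⁻¹)) e
        rw [map_inv φ, map_inv act, MulAut.inv_apply_self, map_mul, map_mul, map_inv] at e'
        rw [map_inv φ, map_inv act]
        nth_rw 2 [e']
        group
      intro w
      induction w using FreeGroup.induction_on with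
      | C1 => exact ⟨1, by simp⟩
      | of j =>
        rcases Nat.lt_or_ge m j with hj | hj
        · exact ⟨1, by simp [truncHom_of_lt hj], by rw [← hφt, truncHom_of_lt hj]; simp⟩
        · obtain ⟨b, hb, e⟩ := hshift j hj
          obtain ⟨v, hv, ev⟩ := hinv (FreeGroup.of ⟨m, by omega⟩)⁻¹
            ⟨FreeGroup.of ⟨m, by omega⟩, by simp, by
              rw [map_inv φ, hφm, inv_inv, map_mul, MulAut.mul_apply, h.act_of m hm]
              simp [hmove, h.act_of m hm]⟩
          rw [inv_inv] at hv ev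
          refine ⟨act b v, ?_, ?_⟩
          · rw [h.truncHom_act hm hb, hv, ← e, h.truncHom_act hm hb, map_inv]
          · have hfix : act b (FreeGroup.of ⟨m + 1, hm⟩) = FreeGroup.of ⟨m + 1, hm⟩ :=
              h.act_of_of_lt hb (by simp)
            have hfix' : act b⁻¹ (FreeGroup.of ⟨m + 1, hm⟩) = FreeGroup.of ⟨m + 1, hm⟩ :=
              h.act_of_of_lt (H.inv_mem hb) (by simp)
            rw [← e, hφ b hb, map_mul, map_mul, MulAut.mul_apply, MulAut.mul_apply, hfix', ev,
              map_mul, map_mul, hfix, map_inv]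
      | inv_of j ihj => exact hinv _ ihj
      | mul a b iha ihb =>
        obtain ⟨v, hv, ev⟩ := iha
        obtain ⟨v', hv', ev'⟩ := ihb
        refine ⟨act (φ a) v' * v, by rw [map_mul, htrunc, hv, hv', map_mul, mul_inv_rev], ?_⟩
        rw [map_mul, map_mul, MulAut.mul_apply, ev', map_mul, map_mul, ev, map_inv]
        group
    let K : Subgroup G :=
      { carrier := {g | ∃ w, ∃ b ∈ H, g = φ w * b}
        one_mem' := ⟨1, 1, H.one_mem, by simp⟩
        mul_mem' := by
          rintro _ _ ⟨w, b, hb, rfl⟩ ⟨w', b', hb', rfl⟩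
          refine ⟨w * act b w', b * b', H.mul_mem hb hb', ?_⟩
          rw [map_mul, hφ b hb]; group
        inv_mem' := by
          rintro _ ⟨w, b, hb, rfl⟩
          refine ⟨act b⁻¹ w⁻¹, b⁻¹, H.inv_mem hb, ?_⟩
          rw [hφ _ (H.inv_mem hb), map_inv]; group }
    obtain ⟨_, ⟨w, b, hb, rfl⟩, hcase⟩ := h.exists_coset_rep hm K
      (fun i hi => ⟨1, s i, Subgroup.subset_closure ⟨i, hi, rfl⟩, by simp⟩)
      ⟨(FreeGroup.of ⟨m, by omega⟩)⁻¹, 1, H.one_mem, by simp [hφm]⟩ hg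
    rcases hcase with rfl | ⟨x, hx, rfl⟩
    · have hb1 : b = 1 := by
        refine ih (by omega) hb (mulAut_freeGroup_ext fun j => ?_)
        rcases Nat.lt_or_ge m j with hj | hj
        · exact h.act_of_of_lt hb hj
        · have e := congrArg (truncHom N m) (DFunLike.congr_fun hact (FreeGroup.of j))
          rw [map_mul, MulAut.mul_apply, htrunc, h.truncHom_act hm hb, MulAut.one_apply,
            truncHom_of_le hj] at e
          exact e
      subst hb1
      rw [mul_one] at hact ⊢
      obtain ⟨v, hv, e⟩ := hpush w
      rw [hact, MulAut.one_apply, eq_mul_inv_iff_mul_eq] at e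
      rw [truncHom_eq_one_of_commute hm e.symm, eq_comm, inv_eq_one] at hv
      rw [← hφt, hv, map_one]
    · exfalso
      have e := congrArg (truncHom N m) (DFunLike.congr_fun hact (FreeGroup.of ⟨m + 1, hm⟩))
      have e' : act (s m) (FreeGroup.of ⟨m + 1, hm⟩) = FreeGroup.of ⟨m, by omega⟩ := by
        rw [h.act_of m hm]; simp [hmove]
      rw [map_mul, map_mul, map_mul, MulAut.mul_apply, MulAut.mul_apply, MulAut.mul_apply,
        h.act_of_of_lt hx (by simp), e', htrunc, h.truncHom_act hm hb,
        MulAut.one_apply, truncHom_of_le (j := ⟨m, by omega⟩) le_rfl, truncHom_of_lt (by simp)] at e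
      have := (MulEquiv.map_eq_one_iff (act b)).1 e
      exact FreeGroup.of_ne_one _ this

end IsArtinAction

/-- The standard Hurwitz/Artin representation `B_n → Aut(F_n)` exists and is faithful. -/
theorem artin_representation_faithful (n : ℕ) :
    (∃ act : BraidGroup n →* MulAut (FreeGroup (Fin n)),
      ∀ (i : ℕ) (hi : i + 1 < n),
        (fun j => act (PresentedGroup.of ⟨i, by omega⟩) (FreeGroup.of j)) =
          hmove n (FreeGroup (Fin n)) i hi FreeGroup.of) ∧
    (∀ act : BraidGroup n →* MulAut (FreeGroup (Fin n)),
      (∀ (i : ℕ) (hi : i + 1 < n),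
        (fun j => act (PresentedGroup.of ⟨i, by omega⟩) (FreeGroup.of j)) =
          hmove n (FreeGroup (Fin n)) i hi FreeGroup.of) →
      Function.Injective act) := by
  refine ⟨?_, fun act hact => ?_⟩
  · refine ⟨PresentedGroup.toGroup
      (f := fun i : Fin (n - 1) => artinAut n i (by omega)) ?_, fun i hi => ?_⟩
    · rintro r (⟨i, ⟨j, hj⟩, hij, rfl⟩ | ⟨i, j, hij, rfl⟩)
      · dsimp only at hij
        subst hij
        simp only [map_mul, map_inv, FreeGroup.lift_apply_of]
        rw [mul_inv_eq_one]
        exact artinAut_braid n i (by omega)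
      · simp only [map_mul, map_inv, FreeGroup.lift_apply_of]
        rw [mul_inv_eq_one]
        exact artinAut_commute n i j hij (by omega)
    · funext j
      rw [PresentedGroup.toGroup.of]
      exact artinAut_of n i hi j
  · rcases Nat.eq_zero_or_pos n with rfl | hn
    · have : Subsingleton (BraidGroup 0) := by
        refine ⟨fun a b => ?_⟩
        induction a using PresentedGroup.induction_on with | _ a
        induction b using PresentedGroup.induction_on with | _ b
        have : IsEmpty (Fin (0 - 1)) := by simp; infer_instance
        rw [Subsingleton.elim a b]
      exact Function.injective_of_subsingleton _
    let s : ℕ → BraidGroup n := fun i =>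
      if h : i < n - 1 then PresentedGroup.of ⟨i, h⟩ else 1
    have hs : ∀ i (hi : i + 1 < n), s i = PresentedGroup.of ⟨i, by omega⟩ :=
      fun i hi => dif_pos (by omega)
    have h : IsArtinAction n s act := by
      refine ⟨fun i hi => ?_, fun i j hij hj => ?_, fun i hi j => ?_⟩
      · rw [hs i (by omega), hs (i + 1) hi, ← mul_inv_eq_one]
        exact PresentedGroup.one_of_mem (Or.inl ⟨⟨i, by omega⟩, ⟨i + 1, by omega⟩, rfl, rfl⟩)
      · rw [Commute, SemiconjBy, hs i (by omega), hs j hj, ← mul_inv_eq_one]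
        exact PresentedGroup.one_of_mem (Or.inr ⟨⟨i, by omega⟩, ⟨j, by omega⟩, hij, rfl⟩)
      · rw [hs i hi]
        exact congrFun (hact i hi) j
    refine (injective_iff_map_eq_one act).2 fun g hg => ?_
    refine h.eq_one_of_act_eq_one (n - 1) (by omega) ?_ hg
    have hr : Set.range (PresentedGroup.of : Fin (n - 1) → BraidGroup n) ⊆
        s '' Set.Iio (n - 1) := by
      rintro _ ⟨i, rfl⟩
      exact ⟨i, i.2, hs i (by omega)⟩
    refine Subgroup.closure_mono hr ?_
    rw [PresentedGroup.closure_range_of]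
    trivial
end

section
/- The Hurwitz action of B_n on Red_R(g), where g = f_1⋯f_n in the free group F_n and R is the set of conjugates of the free generators, is simply transitive: the stabilizer of (f_1,…,f_n) is trivial and the action is transitive. -/
section BraidRelations

open scoped Pointwise

variable {B : Type*} [Group B]

/-- The product `s k * s (k + 1) * ⋯ * s (m - 1)`. -/
def tailProd (s : ℕ → B) (m k : ℕ) : B := ((List.Ico k m).map s).prod

/-- The pure braid in which strand `k` turns once around strand `m`, written in terms of a
sequence `s` satisfying the braid relations. -/
def pureTwist (s : ℕ → B) (m k : ℕ) : B :=
  (tailProd s m (k + 1))⁻¹ * (s k * s k) * tailProd s m (k + 1)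

/-- The braid relations between `s 0, …, s (m - 1)`. -/
structure BraidSeq (s : ℕ → B) (m : ℕ) : Prop where
  comm : ∀ i j, i + 1 < j → j < m → s i * s j = s j * s i
  braid : ∀ i, i + 1 < m → s i * s (i + 1) * s i = s (i + 1) * s i * s (i + 1)

theorem tailProd_self (s : ℕ → B) (m : ℕ) : tailProd s m m = 1 := by
  simp [tailProd]

theorem tailProd_eq_mul (s : ℕ → B) {m k : ℕ} (h : k < m) :
    tailProd s m k = s k * tailProd s m (k + 1) := by
  simp [tailProd, List.Ico.eq_cons h]

namespace BraidSeq

variable {s : ℕ → B} {m : ℕ}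

theorem commute_tailProd (hs : BraidSeq s m) {i k : ℕ} (hik : i + 1 < k) :
    Commute (s i) (tailProd s m k) := by
  refine Commute.list_prod_right _ _ fun x hx => ?_
  obtain ⟨j, hj, rfl⟩ := List.mem_map.1 hx
  rw [List.Ico.mem] at hj
  exact hs.comm i j (by omega) hj.2

theorem succ_mul_tailProd (hs : BraidSeq s m) {i k : ℕ} (hki : k ≤ i) (him : i + 1 < m) :
    s (i + 1) * tailProd s m k = tailProd s m k * s i := by
  induction hki using Nat.decreasingInduction with
  | self =>
    have h := (hs.commute_tailProd (i := i) (k := i + 1 + 1) (by omega)).eq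
    rw [tailProd_eq_mul s (by omega), tailProd_eq_mul s him]
    calc _ = s (i + 1) * s i * s (i + 1) * tailProd s m (i + 1 + 1) := by group
      _ = s i * s (i + 1) * (s i * tailProd s m (i + 1 + 1)) := by
        rw [← hs.braid i him]; group
      _ = _ := by rw [h]; group
  | of_succ k hk ih =>
    rw [tailProd_eq_mul s (by omega), ← mul_assoc, ← hs.comm k (i + 1) (by omega) him, mul_assoc,
      ih, mul_assoc]

theorem commute_pureTwist_of_lt (hs : BraidSeq s m) {i k : ℕ} (hik : i + 1 < k) (hk : k < m) :
    Commute (s i) (pureTwist s m k) := by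
  have h : Commute (s i) (s k) := hs.comm i k hik hk
  have h' := hs.commute_tailProd (i := i) (k := k + 1) (by omega)
  exact (h'.inv_right.mul_right (h.mul_right h)).mul_right h'

theorem commute_pureTwist_of_gt (hs : BraidSeq s m) {i k : ℕ} (hki : k < i) (him : i + 1 < m) :
    Commute (s i) (pureTwist s m k) := by
  have h : Commute (s (i + 1)) (s k * s k) :=
    have h : Commute (s (i + 1)) (s k) := (hs.comm k (i + 1) (by omega) him).symm
    h.mul_right h
  have h' : s i = (tailProd s m (k + 1))⁻¹ * s (i + 1) * tailProd s m (k + 1) := by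
    rw [mul_assoc, hs.succ_mul_tailProd hki him, inv_mul_cancel_left]
  rw [h', pureTwist]
  simpa [MulAut.conj_apply] using h.map (MulAut.conj (tailProd s m (k + 1))⁻¹)

theorem conj_pureTwist_succ (hs : BraidSeq s m) {k : ℕ} (hk : k + 1 < m) :
    s k * pureTwist s m (k + 1) * (s k)⁻¹ = pureTwist s m k := by
  have h := (hs.commute_tailProd (i := k) (k := k + 1 + 1) (by omega))
  have hb := hs.braid k hk
  rw [pureTwist, pureTwist, tailProd_eq_mul s hk]
  have key : s k * (s (k + 1) * s (k + 1)) * (s k)⁻¹ =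
      (s (k + 1))⁻¹ * (s k * s k) * s (k + 1) := by
    rw [mul_inv_eq_iff_eq_mul, eq_comm]
    calc _ = (s (k + 1))⁻¹ * s k * (s k * s (k + 1) * s k) := by group
      _ = (s (k + 1))⁻¹ * s k * (s (k + 1) * s k * s (k + 1)) := by rw [hb]
      _ = (s (k + 1))⁻¹ * (s k * s (k + 1) * s k) * s (k + 1) := by group
      _ = _ := by rw [hb]; group
  calc _ = (s k * (tailProd s m (k + 1 + 1))⁻¹) * (s (k + 1) * s (k + 1)) *
        (tailProd s m (k + 1 + 1) * (s k)⁻¹) := by group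
    _ = (tailProd s m (k + 1 + 1))⁻¹ * (s k * (s (k + 1) * s (k + 1)) * (s k)⁻¹) *
        tailProd s m (k + 1 + 1) := by
      rw [h.inv_right.eq, ← h.inv_left.eq]; group
    _ = _ := by rw [key]; group

theorem commute_pureTwist_mul (hs : BraidSeq s m) {k : ℕ} (hk : k + 1 < m) :
    Commute (s k) (pureTwist s m (k + 1) * pureTwist s m k) := by
  have h := (hs.commute_tailProd (i := k) (k := k + 1 + 1) (by omega))
  have hb := hs.braid k hk
  have key : Commute (s k) (s (k + 1) * s k * s k * s (k + 1)) := by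
    calc _ = (s k * s (k + 1) * s k) * s k * s (k + 1) := by group
      _ = s (k + 1) * s k * (s (k + 1) * s k * s (k + 1)) := by rw [hb]; group
      _ = _ := by rw [← hb]; group
  have : pureTwist s m (k + 1) * pureTwist s m k = (tailProd s m (k + 1 + 1))⁻¹ *
      (s (k + 1) * s k * s k * s (k + 1)) * tailProd s m (k + 1 + 1) := by
    rw [pureTwist, pureTwist, tailProd_eq_mul s hk]; group
  rw [this]
  exact (h.inv_right.mul_right key).mul_right h

/-- The subgroup generated by the pure twists around strand `m` is normalized by the braids not
involving strand `m`. -/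
theorem closure_le_normalizer (hs : BraidSeq s m) :
    Subgroup.closure (s '' {i | i + 1 < m}) ≤
      Subgroup.normalizer (Subgroup.closure (pureTwist s m '' {k | k < m}) : Set B) := by
  set N := Subgroup.closure (pureTwist s m '' {k | k < m})
  have mem {k : ℕ} (hk : k < m) : pureTwist s m k ∈ N := Subgroup.subset_closure ⟨k, hk, rfl⟩
  have map_le {x : B} (hx : ∀ k < m, x * pureTwist s m k * x⁻¹ ∈ N) :
      ∀ y ∈ N, x * y * x⁻¹ ∈ N := by
    have : N ≤ N.comap (MulAut.conj x).toMonoidHom := by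
      rw [Subgroup.closure_le]
      rintro _ ⟨k, hk, rfl⟩
      exact hx k hk
    exact this
  rw [Subgroup.closure_le]
  rintro _ ⟨i, hi, rfl⟩
  have hi : i + 1 < m := hi
  have hfix {k : ℕ} (h : Commute (s i) (pureTwist s m k)) (hk : k < m) :
      s i * pureTwist s m k * (s i)⁻¹ ∈ N ∧ (s i)⁻¹ * pureTwist s m k * (s i)⁻¹⁻¹ ∈ N := by
    rw [h.eq, h.inv_left.eq]
    simpa using mem hk
  have hconj : ∀ k < m, s i * pureTwist s m k * (s i)⁻¹ ∈ N ∧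
      (s i)⁻¹ * pureTwist s m k * (s i)⁻¹⁻¹ ∈ N := by
    have h1 := hs.conj_pureTwist_succ hi
    have h2 := (hs.commute_pureTwist_mul hi).eq
    intro k hk
    rcases lt_trichotomy k i with h | rfl | h
    · exact hfix (hs.commute_pureTwist_of_gt h hi) hk
    · have e1 : s k * pureTwist s m k * (s k)⁻¹ =
          (pureTwist s m k)⁻¹ * pureTwist s m (k + 1) * pureTwist s m k := by
        rw [mul_assoc _ (pureTwist s m (k + 1)), eq_inv_mul_iff_mul_eq]
        nth_rw 1 [← h1]
        rw [← mul_inv_eq_iff_eq_mul.2 h2]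
        group
      have e2 : (s k)⁻¹ * pureTwist s m k * (s k)⁻¹⁻¹ = pureTwist s m (k + 1) := by
        rw [← h1]; group
      rw [e1, e2]
      exact ⟨N.mul_mem (N.mul_mem (N.inv_mem (mem hk)) (mem hi)) (mem hk), mem hi⟩
    · rcases Nat.lt_or_ge (i + 1) k with h' | h'
      · exact hfix (hs.commute_pureTwist_of_lt h' hk) hk
      · obtain rfl : k = i + 1 := by omega
        have e2 : (s i)⁻¹ * pureTwist s m (i + 1) * (s i)⁻¹⁻¹ =
            pureTwist s m (i + 1) * pureTwist s m i * (pureTwist s m (i + 1))⁻¹ := by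
          rw [eq_mul_inv_iff_mul_eq, mul_assoc, inv_inv]
          rw [mul_assoc, inv_mul_eq_iff_eq_mul, h2, ← h1]
          group
        rw [h1, e2]
        exact ⟨mem (by omega), N.mul_mem (N.mul_mem (mem hk) (mem (by omega)))
          (N.inv_mem (mem hk))⟩
  rw [SetLike.mem_coe, Subgroup.mem_normalizer_iff]
  refine fun y => ⟨map_le (fun k hk => (hconj k hk).1) y, fun hy => ?_⟩
  simpa [mul_assoc] using map_le (fun k hk => (hconj k hk).2) _ hy

/-- Coset decomposition with respect to the braids fixing the endpoint of strand `m`. -/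
theorem exists_eq_tailProd_mul (hs : BraidSeq s m) {x : B}
    (hx : x ∈ Subgroup.closure (s '' {i | i < m})) :
    ∃ k ≤ m, ∃ y ∈ Subgroup.closure (pureTwist s m '' {k | k < m}),
      ∃ z ∈ Subgroup.closure (s '' {i | i + 1 < m}), x = tailProd s m k * (y * z) := by
  set N := Subgroup.closure (pureTwist s m '' {k | k < m}) with hN
  set K := Subgroup.closure (s '' {i | i + 1 < m}) with hK
  have hNK : ((N ⊔ K : Subgroup B) : Set B) = (N : Set B) * (K : Set B) :=
    Subgroup.coe_mul_of_right_le_normalizer_left N K hs.closure_le_normalizer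
  suffices ∃ k ≤ m, ∃ y ∈ N ⊔ K, x = tailProd s m k * y by
    obtain ⟨k, hk, y, hy, rfl⟩ := this
    rw [← SetLike.mem_coe, hNK] at hy
    obtain ⟨y, hy, z, hz, rfl⟩ := hy
    exact ⟨k, hk, y, hy, z, hz, rfl⟩
  have memK {i : ℕ} (hi : i + 1 < m) : s i ∈ N ⊔ K :=
    Subgroup.mem_sup_right (Subgroup.subset_closure ⟨i, hi, rfl⟩)
  have step : ∀ i < m, ∀ k ≤ m, (∃ k' ≤ m, ∃ y ∈ N ⊔ K, s i * tailProd s m k = tailProd s m k' * y)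
      ∧ (∃ k' ≤ m, ∃ y ∈ N ⊔ K, (s i)⁻¹ * tailProd s m k = tailProd s m k' * y) := by
    intro i hi k hk
    have fix {y : B} (hy : y ∈ N ⊔ K) (h : s i * tailProd s m k = tailProd s m k * y) :
        (∃ k' ≤ m, ∃ y ∈ N ⊔ K, s i * tailProd s m k = tailProd s m k' * y)
          ∧ (∃ k' ≤ m, ∃ y ∈ N ⊔ K, (s i)⁻¹ * tailProd s m k = tailProd s m k' * y) := by
      refine ⟨⟨k, hk, y, hy, h⟩, k, hk, y⁻¹, Subgroup.inv_mem _ hy, ?_⟩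
      rw [inv_mul_eq_iff_eq_mul, ← mul_assoc, h, mul_inv_cancel_right]
    have htw : s i * s i * tailProd s m (i + 1) = tailProd s m (i + 1) * pureTwist s m i := by
      rw [pureTwist]; group
    have hmem : pureTwist s m i ∈ N ⊔ K :=
      Subgroup.mem_sup_left (Subgroup.subset_closure ⟨i, hi, rfl⟩)
    rcases lt_trichotomy k i with h | rfl | h
    · obtain ⟨i, rfl⟩ : ∃ j, i = j + 1 := ⟨i - 1, by omega⟩
      exact fix (memK hi) (hs.succ_mul_tailProd (by omega) hi)
    · refine ⟨⟨k + 1, hi, _, hmem, ?_⟩, k + 1, hi, 1, Subgroup.one_mem _, ?_⟩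
      · rw [tailProd_eq_mul s hi, ← mul_assoc, htw]
      · rw [tailProd_eq_mul s hi, inv_mul_cancel_left, mul_one]
    · rcases Nat.lt_or_ge (i + 1) k with h' | h'
      · exact fix (memK (by omega)) (hs.commute_tailProd h')
      · obtain rfl : k = i + 1 := by omega
        refine ⟨⟨i, hi.le, 1, Subgroup.one_mem _, ?_⟩, i, hi.le, _, Subgroup.inv_mem _ hmem, ?_⟩
        · rw [tailProd_eq_mul s hi, mul_one]
        · rw [tailProd_eq_mul s hi, eq_mul_inv_iff_mul_eq, mul_assoc, ← htw]; group
  induction hx using Subgroup.closure_induction_left with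
  | one => exact ⟨m, le_rfl, 1, Subgroup.one_mem _, by simp [tailProd_self]⟩
  | mul_left x hx y hy ih =>
    obtain ⟨i, hi, rfl⟩ := hx
    obtain ⟨k, hk, z, hz, rfl⟩ := ih
    obtain ⟨k', hk', w, hw, h⟩ := (step i hi k hk).1
    exact ⟨k', hk', w * z, Subgroup.mul_mem _ hw hz, by rw [← mul_assoc, h, mul_assoc]⟩
  | inv_mul_cancel x hx y hy ih =>
    obtain ⟨i, hi, rfl⟩ := hx
    obtain ⟨k, hk, z, hz, rfl⟩ := ih
    obtain ⟨k', hk', w, hw, h⟩ := (step i hi k hk).2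
    exact ⟨k', hk', w * z, Subgroup.mul_mem _ hw hz, by rw [← mul_assoc, h, mul_assoc]⟩

end BraidSeq

end BraidRelations

section HurwitzAction

variable {ι G : Type*} [DecidableEq ι] [Group G]

/-- The elementary Hurwitz move on positions `i ≠ j` of a family of group elements. -/
def hurwitzPerm (G : Type*) [Group G] (i j : ι) (h : i ≠ j) : Equiv.Perm (ι → G) where
  toFun v l := if l = i then v i * v j * (v i)⁻¹ else if l = j then v i else v l
  invFun v l := if l = i then v j else if l = j then (v j)⁻¹ * v i * v j else v l
  left_inv v := by
    funext l
    by_cases hi : l = i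
    · simp [hi, h.symm]
    · by_cases hj : l = j
      · subst hj
        simp [hi, mul_assoc]
      · simp [hi, hj]
  right_inv v := by
    funext l
    by_cases hi : l = i
    · simp [hi, h.symm, mul_assoc]
    · by_cases hj : l = j
      · subst hj
        simp [hi]
      · simp [hi, hj]

theorem hurwitzPerm_apply (i j : ι) (h : i ≠ j) (v : ι → G) (l : ι) :
    hurwitzPerm G i j h v l =
      if l = i then v i * v j * (v i)⁻¹ else if l = j then v i else v l := rfl

theorem hurwitzPerm_symm_apply (i j : ι) (h : i ≠ j) (v : ι → G) (l : ι) :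
    (hurwitzPerm G i j h).symm v l =
      if l = i then v j else if l = j then (v j)⁻¹ * v i * v j else v l := rfl

theorem hurwitzPerm_braid {i j k : ι} (hij : i ≠ j) (hjk : j ≠ k) (hik : i ≠ k) :
    hurwitzPerm G i j hij * hurwitzPerm G j k hjk * hurwitzPerm G i j hij =
      hurwitzPerm G j k hjk * hurwitzPerm G i j hij * hurwitzPerm G j k hjk := by
  ext v l
  simp only [Equiv.Perm.mul_apply, hurwitzPerm_apply]
  by_cases hi : l = i
  · subst hi
    simp [hij, hij.symm, hjk.symm, hik, hik.symm, mul_assoc]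
  · by_cases hj : l = j
    · subst hj
      simp [hi, hij, hjk.symm, hik, hik.symm, mul_assoc]
    · by_cases hk : l = k
      · subst hk
        simp [hi, hj, hij, hij.symm, hik]
      · simp [hi, hj, hk]

theorem hurwitzPerm_comm {i j k l : ι} (hij : i ≠ j) (hkl : k ≠ l) (hik : i ≠ k) (hil : i ≠ l)
    (hjk : j ≠ k) (hjl : j ≠ l) :
    hurwitzPerm G i j hij * hurwitzPerm G k l hkl =
      hurwitzPerm G k l hkl * hurwitzPerm G i j hij := by
  ext v a
  simp only [Equiv.Perm.mul_apply, hurwitzPerm_apply]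
  by_cases hi : a = i
  · subst hi
    simp [hik, hil, hjk, hjl]
  · by_cases hj : a = j
    · subst hj
      simp [hi, hik, hil, hjk, hjl]
    · simp [hi, hj, hik.symm, hil.symm, hjk.symm, hjl.symm]

variable {n : ℕ}

/-- A family satisfying the braid relations induces a homomorphism from the braid group. -/
def braidLift {B : Type*} [Group B] (t : Fin (n - 1) → B)
    (braid : ∀ i j : Fin (n - 1), (i : ℕ) + 1 = j → t i * t j * t i = t j * t i * t j)
    (comm : ∀ i j : Fin (n - 1), (i : ℕ) + 1 < j → t i * t j = t j * t i) :
    BraidGroup n →* B :=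
  PresentedGroup.toGroup (f := t) <| by
    rintro r (⟨i, j, h, rfl⟩ | ⟨i, j, h, rfl⟩)
    · simp only [map_mul, map_inv, FreeGroup.lift_apply_of]
      rw [braid i j h, mul_inv_cancel]
    · simp only [map_mul, map_inv, FreeGroup.lift_apply_of]
      rw [comm i j h, mul_inv_cancel]

theorem braidLift_of {B : Type*} [Group B] (t : Fin (n - 1) → B) (braid) (comm)
    (i : Fin (n - 1)) : braidLift t braid comm (PresentedGroup.of i) = t i :=
  PresentedGroup.toGroup.of _

theorem braidGroup_braid {i j : Fin (n - 1)} (h : (i : ℕ) + 1 = j) :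
    (PresentedGroup.of i * PresentedGroup.of j * PresentedGroup.of i : BraidGroup n) =
      PresentedGroup.of j * PresentedGroup.of i * PresentedGroup.of j :=
  PresentedGroup.mk_eq_mk_of_mul_inv_mem (Or.inl ⟨i, j, h, rfl⟩)

theorem braidGroup_comm {i j : Fin (n - 1)} (h : (i : ℕ) + 1 < j) :
    (PresentedGroup.of i * PresentedGroup.of j : BraidGroup n) =
      PresentedGroup.of j * PresentedGroup.of i :=
  PresentedGroup.mk_eq_mk_of_mul_inv_mem (Or.inr ⟨i, j, h, rfl⟩)

/-- The Hurwitz action of the braid group on the positions in the range of `e`. -/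
def braidAct (G : Type*) [Group G] (e : Fin n ↪ ι) : BraidGroup n →* Equiv.Perm (ι → G) :=
  braidLift
    (fun i => hurwitzPerm G (e ⟨i, by omega⟩) (e ⟨i + 1, by omega⟩) (by simp [Fin.ext_iff]))
    (by
      rintro ⟨i, hi⟩ ⟨_, hj⟩ rfl
      apply hurwitzPerm_braid
      simp only [ne_eq, EmbeddingLike.apply_eq_iff_eq, Fin.ext_iff]
      omega)
    (by
      rintro ⟨i, hi⟩ ⟨j, hj⟩ h
      change i + 1 < j at h
      apply hurwitzPerm_comm <;>
      · simp only [ne_eq, EmbeddingLike.apply_eq_iff_eq, Fin.ext_iff]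
        omega)

theorem braidAct_of (e : Fin n ↪ ι) (i : Fin (n - 1)) :
    braidAct G e (PresentedGroup.of i) =
      hurwitzPerm G (e ⟨i, by omega⟩) (e ⟨i + 1, by omega⟩) (by simp [Fin.ext_iff]) :=
  braidLift_of _ _ _ i

/-- A map that intertwines the actions of the generators intertwines two actions. -/
theorem PresentedGroup.apply_perm_eq {α X Y : Type*} {rels : Set (FreeGroup α)}
    (φ : PresentedGroup rels →* Equiv.Perm X) (χ : PresentedGroup rels →* Equiv.Perm Y)
    (T : X → Y) (h : ∀ a x, T (φ (.of a) x) = χ (.of a) (T x)) (b : PresentedGroup rels) (x : X) :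
    T (φ b x) = χ b (T x) := by
  let H : Subgroup (PresentedGroup rels) :=
    { carrier := {b | ∀ x, T (φ b x) = χ b (T x)}
      mul_mem' := fun {b c} hb hc x => by simp [hb _, hc _]
      one_mem' := fun x => by simp
      inv_mem' := fun {b} hb x => by
        rw [map_inv χ, Equiv.Perm.eq_inv_iff_eq, ← hb, ← Equiv.Perm.mul_apply, ← map_mul]
        simp }
  exact PresentedGroup.generated_by rels H h b x

theorem map_braidAct {H : Type*} [Group H] (e : Fin n ↪ ι) (f : G →* H) (β : BraidGroup n)
    (v : ι → G) : f ∘ braidAct G e β v = braidAct H e β (f ∘ v) := by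
  refine PresentedGroup.apply_perm_eq (braidAct G e) (braidAct H e) (f ∘ ·) ?_ β v
  intro i x
  funext l
  simp only [braidAct_of, Function.comp_apply, hurwitzPerm_apply]
  split_ifs <;> simp

theorem braidAct_apply_of_notMem (e : Fin n ↪ ι) {l : ι} (hl : ∀ i, e i ≠ l) (β : BraidGroup n)
    (v : ι → G) : braidAct G e β v l = v l := by
  refine PresentedGroup.apply_perm_eq (braidAct G e) (1 : BraidGroup n →* Equiv.Perm G)
    (· l) ?_ β v
  intro i x
  simp [braidAct_of, hurwitzPerm_apply, (hl _).symm]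

theorem braidAct_comp (e : Fin n ↪ ι) (β : BraidGroup n) (v : ι → G) :
    braidAct G e β v ∘ e = braidAct G (.refl _) β (v ∘ e) := by
  refine PresentedGroup.apply_perm_eq (braidAct G e) (braidAct G (.refl _)) (· ∘ e) ?_ β v
  intro i x
  funext l
  simp [braidAct_of, hurwitzPerm_apply]

/-- The standard inclusion of the braid group on `n` strands into that on `n + 1` strands. -/
def braidIncl (n : ℕ) : BraidGroup n →* BraidGroup (n + 1) :=
  braidLift (fun i => PresentedGroup.of ⟨i, by omega⟩)
    (fun _ _ h => braidGroup_braid h) (fun _ _ h => braidGroup_comm h)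

theorem braidIncl_of (i : Fin (n - 1)) :
    braidIncl n (PresentedGroup.of i) = PresentedGroup.of ⟨i, by omega⟩ :=
  braidLift_of _ _ _ i

/-- The Hurwitz action of the braid group on the first `n` entries of a sequence. -/
abbrev natAct (n : ℕ) (G : Type*) [Group G] : BraidGroup n →* Equiv.Perm (ℕ → G) :=
  braidAct G Fin.valEmbedding

theorem natAct_braidIncl (β : BraidGroup n) : natAct (n + 1) G (braidIncl n β) = natAct n G β := by
  suffices (natAct (n + 1) G).comp (braidIncl n) = natAct n G from DFunLike.congr_fun this β
  refine PresentedGroup.ext fun i => ?_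
  rw [MonoidHom.comp_apply, braidIncl_of]
  exact (braidAct_of _ _).trans (braidAct_of _ _).symm

/-- The inverses of the standard generators of the braid group on `m + 1` strands. -/
def invGen (m i : ℕ) : BraidGroup (m + 1) :=
  if h : i < m then (PresentedGroup.of ⟨i, h⟩)⁻¹ else 1

theorem braidSeq_invGen (m : ℕ) : BraidSeq (invGen m) m where
  comm i j h hj := by
    have hi : i < m := by omega
    have := braidGroup_comm (n := m + 1) (i := ⟨i, hi⟩) (j := ⟨j, hj⟩) h
    simp only [invGen, hi, hj, dif_pos, ← mul_inv_rev, this]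
  braid i h := by
    have hi : i < m := by omega
    have := braidGroup_braid (n := m + 1) (i := ⟨i, hi⟩) (j := ⟨i + 1, h⟩) rfl
    simp only [invGen, hi, h, dif_pos, ← mul_inv_rev, ← mul_assoc, this]

variable {m : ℕ}

theorem closure_invGen (m : ℕ) : Subgroup.closure (invGen m '' {i | i < m}) = ⊤ := by
  rw [eq_top_iff]
  intro x _
  refine PresentedGroup.generated_by _ _ (fun i => ?_) x
  rw [← inv_inv (PresentedGroup.of i)]
  refine Subgroup.inv_mem _ (Subgroup.subset_closure ⟨i, i.2, ?_⟩)
  have : (i : ℕ) < m := i.2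
  simp [invGen, this]

theorem exists_braidIncl_eq {x : BraidGroup (m + 1)}
    (hx : x ∈ Subgroup.closure (invGen m '' {i | i + 1 < m})) : ∃ β, braidIncl m β = x := by
  suffices Subgroup.closure (invGen m '' {i | i + 1 < m}) ≤ (braidIncl m).range from this hx
  rw [Subgroup.closure_le]
  rintro _ ⟨i, hi, rfl⟩
  have hi : i + 1 < m := hi
  have hi' : i < m := by omega
  exact ⟨(PresentedGroup.of ⟨i, by omega⟩)⁻¹, by simp [braidIncl_of, invGen, hi']⟩

theorem natAct_invGen_apply {i : ℕ} (hi : i < m) (v : ℕ → G) (l : ℕ) :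
    natAct (m + 1) G (invGen m i) v l =
      if l = i then v (i + 1) else if l = i + 1 then (v (i + 1))⁻¹ * v i * v (i + 1) else v l := by
  simp only [natAct, invGen, hi, dif_pos, map_inv, braidAct_of]
  exact hurwitzPerm_symm_apply _ _ _ v l

theorem natAct_invGen_inv_apply {i : ℕ} (hi : i < m) (v : ℕ → G) (l : ℕ) :
    natAct (m + 1) G (invGen m i)⁻¹ v l =
      if l = i then v i * v (i + 1) * (v i)⁻¹ else if l = i + 1 then v i else v l := by
  simp only [natAct, invGen, hi, dif_pos, inv_inv, braidAct_of]
  exact hurwitzPerm_apply _ _ _ v l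

theorem natAct_tailProd_apply_self {k : ℕ} (hk : k ≤ m) (v : ℕ → G) :
    natAct (m + 1) G (tailProd (invGen m) m k) v k = v m := by
  induction hk using Nat.decreasingInduction with
  | self => simp [tailProd_self]
  | of_succ k hk ih =>
    rw [tailProd_eq_mul _ hk, map_mul, Equiv.Perm.mul_apply, natAct_invGen_apply hk, if_pos rfl, ih]

theorem natAct_tailProd_apply_of_lt {k l : ℕ} (hk : k ≤ m) (hl : l < k) (v : ℕ → G) :
    natAct (m + 1) G (tailProd (invGen m) m k) v l = v l := by
  induction hk using Nat.decreasingInduction with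
  | self => simp [tailProd_self]
  | of_succ k hk ih =>
    rw [tailProd_eq_mul _ hk, map_mul, Equiv.Perm.mul_apply, natAct_invGen_apply hk,
      if_neg (by omega), if_neg (by omega), ih (by omega)]

/-- The inverse of the twist of strand `k` around strand `m` conjugates entry `m` by entry `k`. -/
theorem natAct_pureTwist_inv_apply {k : ℕ} (hk : k < m) (v : ℕ → G) :
    natAct (m + 1) G (pureTwist (invGen m) m k)⁻¹ v m = v k * v m * (v k)⁻¹ := by
  have h : (pureTwist (invGen m) m k)⁻¹ = (tailProd (invGen m) m (k + 1))⁻¹ *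
      ((invGen m k)⁻¹ * ((invGen m k)⁻¹ * tailProd (invGen m) m (k + 1))) := by
    rw [pureTwist]; group
  rw [← natAct_tailProd_apply_self (k := k + 1) hk (natAct _ _ _ v), ← Equiv.Perm.mul_apply,
    ← map_mul, h, mul_inv_cancel_left]
  simp only [map_mul, Equiv.Perm.mul_apply, natAct_invGen_inv_apply hk,
    natAct_tailProd_apply_self (k := k + 1) hk]
  simp [natAct_tailProd_apply_of_lt (k := k + 1) hk]

theorem natAct_pureTwist_inv_eq_self {k : ℕ} (hk : k < m) {v : ℕ → G} (hv : v m = 1) :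
    natAct (m + 1) G (pureTwist (invGen m) m k)⁻¹ v = v := by
  have h : (pureTwist (invGen m) m k)⁻¹ = (tailProd (invGen m) m (k + 1))⁻¹ *
      ((invGen m k)⁻¹ * ((invGen m k)⁻¹ * tailProd (invGen m) m (k + 1))) := by
    rw [pureTwist]; group
  rw [h, map_mul, map_inv, Equiv.Perm.mul_apply, Equiv.Perm.inv_eq_iff_eq]
  have h1 := natAct_tailProd_apply_self (k := k + 1) hk v
  rw [hv] at h1
  simp only [map_mul, Equiv.Perm.mul_apply]
  generalize natAct (m + 1) G (tailProd (invGen m) m (k + 1)) v = u at h1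
  funext l
  simp only [natAct_invGen_inv_apply hk]
  by_cases hl : l = k
  · simp [hl, h1]
  · by_cases hl' : l = k + 1
    · simp [hl', h1]
    · simp [hl, hl']

/-- The free group of pure twists around the last strand. -/
def twistHom (m : ℕ) : FreeGroup (Fin m) →* BraidGroup (m + 1) :=
  FreeGroup.lift fun k => (pureTwist (invGen m) m k)⁻¹

theorem exists_twistHom_eq {x : BraidGroup (m + 1)}
    (hx : x ∈ Subgroup.closure (pureTwist (invGen m) m '' {k | k < m})) :
    ∃ a, twistHom m a = x := by
  suffices Subgroup.closure (pureTwist (invGen m) m '' {k | k < m}) ≤ (twistHom m).range from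
    this hx
  rw [Subgroup.closure_le]
  rintro _ ⟨k, hk, rfl⟩
  exact ⟨(FreeGroup.of ⟨k, hk⟩)⁻¹, by simp [twistHom]⟩

theorem natAct_twistHom_eq_self (a : FreeGroup (Fin m)) {v : ℕ → G} (hv : v m = 1) :
    natAct (m + 1) G (twistHom m a) v = v := by
  induction a using FreeGroup.induction_on with
  | C1 => simp
  | of k => simpa [twistHom] using natAct_pureTwist_inv_eq_self k.2 hv
  | inv_of k ih => rwa [map_inv, map_inv, Equiv.Perm.inv_eq_iff_eq, eq_comm]
  | mul a b ha hb => rw [map_mul, map_mul, Equiv.Perm.mul_apply, hb, ha]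

theorem natAct_twistHom_apply_of_comm {A : Type*} [CommGroup A] (a : FreeGroup (Fin m))
    (v : ℕ → A) : natAct (m + 1) A (twistHom m a) v m = v m := by
  induction a using FreeGroup.induction_on generalizing v with
  | C1 => simp
  | of k => simpa [twistHom] using natAct_pureTwist_inv_apply k.2 v
  | inv_of k ih =>
    rw [← ih (natAct (m + 1) A (twistHom m (FreeGroup.of k)⁻¹) v), ← Equiv.Perm.mul_apply,
      ← map_mul, ← map_mul, mul_inv_cancel, map_one, map_one, Equiv.Perm.one_apply]
  | mul a b ha hb => rw [map_mul, map_mul, Equiv.Perm.mul_apply, ha, hb]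

open RegularWreathProduct in
/-- On sequences in a wreath product with commutative base, lifting the standard generators, the
twist `a` conjugates entry `m` by `a`, provided that entry lies in the base. -/
theorem natAct_twistHom_apply_wreath {A : Type*} [CommGroup A] (a : FreeGroup (Fin m))
    {v : ℕ → A ≀ᵣ FreeGroup (Fin m)} (hv : ∀ k : Fin m, (v k).right = FreeGroup.of k)
    (hm : (v m).right = 1) :
    natAct (m + 1) _ (twistHom m a) v m = inl a * v m * (inl a)⁻¹ := by
  have hright (a : FreeGroup (Fin m)) {v : ℕ → A ≀ᵣ FreeGroup (Fin m)} (hm : (v m).right = 1)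
      (k : ℕ) : (natAct (m + 1) _ (twistHom m a) v k).right = (v k).right := by
    have h := map_braidAct Fin.valEmbedding (rightHom : A ≀ᵣ FreeGroup (Fin m) →* _)
      (twistHom m a) v
    rw [natAct_twistHom_eq_self a (v := rightHom ∘ v) hm] at h
    exact congr_fun h k
  induction a using FreeGroup.induction_on generalizing v with
  | C1 => simp
  | of k =>
    have := natAct_pureTwist_inv_apply k.2 v
    simp only [twistHom, FreeGroup.lift_apply_of]
    rw [this]
    ext1
    · funext x
      simp [hv, hm, mul_comm]
    · simp [hm]
  | inv_of k ih =>
    have h := ih (v := natAct (m + 1) _ (twistHom m (FreeGroup.of k)⁻¹) v)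
      (fun j => by rw [hright _ hm, hv]) (by rw [hright _ hm, hm])
    rw [← Equiv.Perm.mul_apply, ← map_mul, ← map_mul, mul_inv_cancel, map_one, map_one,
      Equiv.Perm.one_apply] at h
    rw [h]
    simp [mul_assoc]
  | mul a b ha hb =>
    rw [map_mul, map_mul, Equiv.Perm.mul_apply, ha (fun j => by rw [hright _ hm, hv])
      (by rw [hright _ hm, hm]), hb hv hm]
    simp [mul_assoc]

/-- Faithfulness of the Hurwitz action on sequences. -/
theorem eq_one_of_natAct_eq (n : ℕ) (β : BraidGroup n)
    (h : ∀ (G : Type) [Group G] (v : ℕ → G), (∀ j, n ≤ j → v j = 1) → natAct n G β v = v) :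
    β = 1 := by
  induction n with
  | zero => exact PresentedGroup.generated_by _ ⊥ (fun j => j.elim0) β
  | succ m ih =>
    obtain ⟨k, hk, y, hy, z, hz, rfl⟩ := (braidSeq_invGen m).exists_eq_tailProd_mul
      (x := β) (by rw [closure_invGen]; trivial)
    obtain ⟨a, rfl⟩ := exists_twistHom_eq hy
    obtain ⟨γ, rfl⟩ := exists_braidIncl_eq hz
    have hγ {G : Type} [Group G] (v : ℕ → G) :
        natAct (m + 1) G (braidIncl m γ) v m = v m := by
      rw [natAct_braidIncl]
      exact braidAct_apply_of_notMem _ (fun i => i.2.ne) γ v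
    obtain rfl : k = m := by
      let t : Multiplicative ℤ := Multiplicative.ofAdd 1
      have h1 := congr_fun (h (Multiplicative ℤ) (Pi.mulSingle m t)
        (fun j hj => Pi.mulSingle_eq_of_ne (by omega) _)) k
      rw [map_mul, Equiv.Perm.mul_apply, natAct_tailProd_apply_self hk, map_mul,
        Equiv.Perm.mul_apply, natAct_twistHom_apply_of_comm, hγ, Pi.mulSingle_eq_same] at h1
      by_contra hkm
      rw [Pi.mulSingle_eq_of_ne hkm] at h1
      exact one_ne_zero (α := ℤ) (congrArg Multiplicative.toAdd h1)
    rw [tailProd_self, one_mul] at h ⊢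
    have hγ1 : γ = 1 := ih γ fun G _ v hv => by
      have := h G v fun j hj => hv j (by omega)
      rwa [map_mul, Equiv.Perm.mul_apply,
        natAct_twistHom_eq_self a ((hγ v).trans (hv k le_rfl)), natAct_braidIncl] at this
    rw [hγ1, map_one, mul_one] at h ⊢
    let t : Multiplicative ℤ := Multiplicative.ofAdd 1
    let v : ℕ → Multiplicative ℤ ≀ᵣ FreeGroup (Fin k) := fun j =>
      if hj : j < k then RegularWreathProduct.inl (FreeGroup.of ⟨j, hj⟩)
      else if j = k then ⟨Pi.mulSingle 1 t, 1⟩ else 1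
    have hvk : v k = ⟨Pi.mulSingle 1 t, 1⟩ := by simp [v]
    have h1 := natAct_twistHom_apply_wreath a (v := v) (fun j => by simp [v]) (by rw [hvk])
    rw [h _ v fun j hj => by simp [v, show ¬ j < k by omega, show j ≠ k by omega], hvk] at h1
    have h2 := congr_fun (congrArg RegularWreathProduct.left h1) 1
    have ha : a = 1 := by
      by_contra ha
      simp [Pi.mulSingle_apply, ha, t] at h2
    rw [ha, map_one]

theorem eq_one_of_braidAct_of_eq {β : BraidGroup n}
    (h : braidAct (FreeGroup (Fin n)) (.refl _) β FreeGroup.of = FreeGroup.of) : β = 1 := by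
  refine eq_one_of_natAct_eq n β fun G _ v _ => ?_
  funext l
  by_cases hl : l < n
  · have h1 := map_braidAct (.refl _) (FreeGroup.lift (v ∘ Fin.val)) β FreeGroup.of
    have h2 : ⇑(FreeGroup.lift (v ∘ Fin.val)) ∘ FreeGroup.of = v ∘ (Fin.val : Fin n → ℕ) := by
      funext i
      simp
    rw [h, h2] at h1
    have h3 := braidAct_comp Fin.valEmbedding β v
    exact congr_fun (h3.trans h1.symm) ⟨l, hl⟩
  · exact braidAct_apply_of_notMem _ (fun i => by have := i.2; simp; omega) β v

end HurwitzAction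

section ConjugateLength

open FreeGroup

variable {α : Type*}

theorem FreeGroup.exists_eq_append_of_not_isReduced {L : List (α × Bool)} {a : α} {b : Bool}
    (hL : IsReduced L) (h : ¬ IsReduced (L ++ [(a, b)])) : ∃ L', L = L' ++ [(a, !b)] := by
  rcases List.eq_nil_or_concat' L with rfl | ⟨L', ⟨c, d⟩, rfl⟩
  · exact absurd IsReduced.singleton h
  · have : ¬ (c = a → d = b) := fun hcd => h <| by
      have := IsReduced.append_overlap hL (L₃ := [(a, b)]) (by simpa using hcd) (by simp)
      simpa using this
    obtain ⟨rfl, hd⟩ := Classical.not_imp.1 this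
    exact ⟨L', by rw [Bool.eq_not.2 hd]⟩

theorem FreeGroup.exists_eq_cons_of_not_isReduced {L : List (α × Bool)} {a : α} {b : Bool}
    (hL : IsReduced L) (h : ¬ IsReduced ((a, b) :: L)) : ∃ L', L = (a, !b) :: L' := by
  cases L with
  | nil => exact absurd IsReduced.singleton h
  | cons x L =>
    obtain ⟨c, d⟩ := x
    rw [isReduced_cons_cons] at h
    have : ¬ (a = c → b = d) := fun hcd => h ⟨hcd, hL⟩
    obtain ⟨rfl, hd⟩ := Classical.not_imp.1 this
    exact ⟨L, by rw [Bool.eq_not.2 (Ne.symm hd)]⟩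

theorem FreeGroup.mk_append (L M : List (α × Bool)) : mk (L ++ M) = mk L * mk M := mul_mk.symm

theorem FreeGroup.mk_not_singleton (a : α) (b : Bool) : mk [(a, !b)] = (mk [(a, b)])⁻¹ := by
  simp [invRev]

variable [DecidableEq α]

theorem FreeGroup.norm_mk_of_isReduced {L : List (α × Bool)} (h : IsReduced L) :
    FreeGroup.norm (mk L) = L.length := by
  rw [FreeGroup.norm, toWord_mk, h.reduce_eq]

/-- The least length of `w` in an expression `w * of a * w⁻¹` of a given conjugate of a
generator. -/
noncomputable def conjLen (r : FreeGroup α) : ℕ :=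
  sInf {k | ∃ w a, r = w * of a * w⁻¹ ∧ FreeGroup.norm w = k}

theorem conjLen_le (w : FreeGroup α) (a : α) : conjLen (w * of a * w⁻¹) ≤ FreeGroup.norm w :=
  Nat.sInf_le ⟨w, a, rfl, rfl⟩

theorem exists_norm_eq_conjLen (w : FreeGroup α) (a : α) :
    ∃ w' a', w * of a * w⁻¹ = w' * of a' * w'⁻¹ ∧ FreeGroup.norm w' = conjLen (w * of a * w⁻¹) :=
  Nat.sInf_mem (s := {k | ∃ w' a', w * of a * w⁻¹ = w' * of a' * w'⁻¹ ∧ FreeGroup.norm w' = k})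
    ⟨_, w, a, rfl, rfl⟩

theorem isReduced_append_of_norm_eq {w : FreeGroup α} {a : α}
    (h : FreeGroup.norm w = conjLen (w * of a * w⁻¹)) (b : Bool) :
    IsReduced (w.toWord ++ [(a, b)]) := by
  by_contra hred
  obtain ⟨L, hL⟩ := exists_eq_append_of_not_isReduced isReduced_toWord hred
  have hw : w = mk L * mk [(a, !b)] := by rw [← mk_append, ← hL, mk_toWord]
  have hconj : mk [(a, !b)] * of a * (mk [(a, !b)])⁻¹ = of a := by
    have hof : of a = mk [(a, true)] := rfl
    cases b
    · change of a * of a * (of a)⁻¹ = of a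
      simp
    · rw [mk_not_singleton, ← hof]; simp
  have : w * of a * w⁻¹ = mk L * of a * (mk L)⁻¹ := by
    nth_rw 2 [← hconj]
    rw [hw]; group
  have h1 := conjLen_le (mk L) a
  have h2 : FreeGroup.norm (mk L) ≤ L.length := norm_mk_le
  have h3 : FreeGroup.norm w = L.length + 1 := by simp [FreeGroup.norm, hL]
  rw [← this] at h1
  omega

theorem norm_conj_mul_lt {w w' : FreeGroup α} {a : α} {b : Bool} {E : List (α × Bool)}
    (hw : IsReduced (w.toWord ++ [(a, b)])) (hE : (w⁻¹ * w').toWord = (a, b) :: E) :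
    FreeGroup.norm (w * mk [(a, !b)] * w⁻¹ * w') < FreeGroup.norm w' := by
  have hd : w⁻¹ * w' = mk [(a, b)] * mk E := by
    rw [← mk_append, List.singleton_append, ← hE, mk_toWord]
  have hw' : w' = mk (w.toWord ++ [(a, b)] ++ E) := by
    rw [mk_append, mk_append, mk_toWord, mul_assoc, ← hd, mul_inv_cancel_left]
  have hred : IsReduced (w.toWord ++ [(a, b)] ++ E) :=
    hw.append_overlap (by simpa [← hE] using isReduced_toWord) (by simp)
  have h1 : w * mk [(a, !b)] * w⁻¹ * w' = w * mk E := by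
    rw [mul_assoc, hd, mk_not_singleton]; group
  have h2 := norm_mul_le w (mk E)
  have h3 : FreeGroup.norm (mk E) ≤ E.length := norm_mk_le
  have h4 : FreeGroup.norm w' = FreeGroup.norm w + 1 + E.length := by
    rw [hw', norm_mk_of_isReduced hred]; simp [FreeGroup.norm]
    omega
  rw [h1]
  omega

/-- If a central letter cancels in the product of two conjugates of generators, then one of the
Hurwitz moves makes a conjugating word shorter. -/
theorem conjLen_lt_or_lt {w w' : FreeGroup α} {a a' : α}
    (h : FreeGroup.norm w = conjLen (w * of a * w⁻¹))
    (h' : FreeGroup.norm w' = conjLen (w' * of a' * w'⁻¹))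
    (hred : ¬ IsReduced ((a, true) :: (w⁻¹ * w').toWord ++ [(a', true)])) :
    conjLen (w * of a * w⁻¹ * (w' * of a' * w'⁻¹) * (w * of a * w⁻¹)⁻¹) <
        conjLen (w' * of a' * w'⁻¹) ∨
      conjLen ((w' * of a' * w'⁻¹)⁻¹ * (w * of a * w⁻¹) * (w' * of a' * w'⁻¹)) <
        conjLen (w * of a * w⁻¹) := by
  by_cases hD : (w⁻¹ * w').toWord = []
  · refine absurd ?_ hred
    simp [hD]
  by_cases h1 : IsReduced ((a, true) :: (w⁻¹ * w').toWord)
  · have h2 : ¬ IsReduced ((w⁻¹ * w').toWord ++ [(a', true)]) := fun h2 =>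
      hred (IsReduced.append_overlap (L₁ := [(a, true)]) h1 h2 hD)
    obtain ⟨E, hE⟩ := exists_eq_append_of_not_isReduced isReduced_toWord h2
    right
    have hE' : (w'⁻¹ * w).toWord = (a', true) :: invRev E := by
      rw [← inv_inv (w'⁻¹ * w), toWord_inv, mul_inv_rev, inv_inv, hE, invRev_append]
      simp [invRev]
    have hlt := norm_conj_mul_lt (isReduced_append_of_norm_eq h' true) hE'
    rw [mk_not_singleton] at hlt
    refine lt_of_le_of_lt ?_ (hlt.trans_eq h)
    convert! conjLen_le (w' * (of a')⁻¹ * w'⁻¹ * w) a using 2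
    group
  · obtain ⟨E, hE⟩ := exists_eq_cons_of_not_isReduced isReduced_toWord h1
    left
    have hlt := norm_conj_mul_lt (isReduced_append_of_norm_eq h false) hE
    refine lt_of_le_of_lt ?_ (hlt.trans_eq h')
    convert! conjLen_le (w * of a * w⁻¹ * w') a' using 2
    group

/-- The reduced word of a product of conjugates of generators none of whose central letters
cancel. -/
theorem exists_isReduced_mk_eq_prod (L : List (FreeGroup α × α)) (w : FreeGroup α) (a : α)
    (hred : ∀ q ∈ (w, a) :: L, IsReduced (q.1.toWord ++ [(q.2, false)]))
    (hchain : ((w, a) :: L).IsChain fun p q =>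
      IsReduced ((p.2, true) :: (p.1⁻¹ * q.1).toWord ++ [(q.2, true)])) :
    ∃ T, IsReduced ((a, true) :: T) ∧
      mk ((a, true) :: T) = of a * w⁻¹ * (L.map fun q => q.1 * of q.2 * q.1⁻¹).prod ∧
      L.length ≤ T.length ∧ (T.length = L.length → ∀ q ∈ (w, a) :: L, q.1 = 1) := by
  have mk_cons (a : α) (T : List (α × Bool)) : mk ((a, true) :: T) = of a * mk T :=
    mk_append [(a, true)] T
  induction L generalizing w a with
  | nil =>
    refine ⟨w⁻¹.toWord, ?_, by simp [mk_cons, mk_toWord, -toWord_inv], by simp, ?_⟩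
    · have h : (mk (w.toWord ++ [(a, false)]))⁻¹.toWord = (a, true) :: w⁻¹.toWord := by
        rw [toWord_inv, toWord_mk, (hred (w, a) (by simp)).reduce_eq, invRev_append, toWord_inv]
        simp [invRev]
      rw [← h]
      exact isReduced_toWord
    · intro h q hq
      obtain rfl : q = (w, a) := by simpa using hq
      simpa using h
  | cons p L ih =>
    obtain ⟨w', a'⟩ := p
    rw [List.isChain_cons_cons] at hchain
    obtain ⟨T, hT, hmk, hlen, heq⟩ := ih w' a' (fun q hq => hred q (by simp [hq])) hchain.2
    refine ⟨(w⁻¹ * w').toWord ++ (a', true) :: T, ?_, ?_, ?_, ?_⟩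
    · have := IsReduced.append_overlap (L₁ := (a, true) :: (w⁻¹ * w').toWord)
        (L₂ := [(a', true)]) (L₃ := T) hchain.1 hT (by simp)
      simpa using this
    · rw [mk_cons, mk_append, mk_toWord, hmk]
      simp [mul_assoc]
    · simp; omega
    · intro h
      simp only [List.length_append, List.length_cons] at h
      have h1 := heq (by omega)
      have h2 : (w⁻¹ * w').toWord = [] := List.length_eq_zero_iff.1 (by omega)
      have h3 : w' = 1 := h1 (w', a') (by simp)
      rw [toWord_eq_nil_iff, h3, mul_one, inv_eq_one] at h2
      intro q hq
      rcases List.mem_cons.1 hq with rfl | hq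
      · exact h2
      · exact h1 q hq

theorem FreeGroup.toWord_prod_ofFn_of {n : ℕ} (x : Fin n → α) :
    (List.ofFn fun i => of (x i)).prod.toWord = List.ofFn fun i => (x i, true) := by
  have hmk : ∀ {n : ℕ} (x : Fin n → α),
      (List.ofFn fun i => of (x i)).prod = mk (List.ofFn fun i => (x i, true)) := by
    intro n
    induction n with
    | zero => intro x; simp [one_eq_mk]
    | succ n ih =>
      intro x
      rw [List.ofFn_succ, List.ofFn_succ, List.prod_cons, ih]
      rfl
  rw [hmk, toWord_mk]
  refine IsReduced.reduce_eq ?_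
  rw [IsReduced, List.isChain_ofFn]
  simp

end ConjugateLength

section Transitivity

variable {n : ℕ}

theorem prod_ofFn_hmove {G : Type*} [Group G] (i : ℕ) (hi : i + 1 < n) (v : Fin n → G) :
    (List.ofFn (hmove n G i hi v)).prod = (List.ofFn v).prod := by
  induction n generalizing i with
  | zero => omega
  | succ n ih =>
    cases i with
    | zero =>
      obtain ⟨n, rfl⟩ : ∃ k, n = k + 1 := ⟨n - 1, by omega⟩
      simp [List.ofFn_succ, hmove, ← mul_assoc]
    | succ i =>
      rw [List.ofFn_succ, List.ofFn_succ, List.prod_cons, List.prod_cons,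
        ← ih i (by omega) (fun j => v j.succ)]
      congr 1
      · congr 2
        funext j
        simp [hmove]

theorem hurwitzPerm_eq_hmove {G : Type*} [Group G] (i : ℕ) (hi : i + 1 < n) :
    ⇑(hurwitzPerm G (⟨i, by omega⟩ : Fin n) ⟨i + 1, hi⟩ (by simp)) = hmove n G i hi := by
  funext v l
  simp [hurwitzPerm_apply, hmove, Fin.ext_iff]

theorem sum_hurwitzPerm_lt {ι G : Type*} [DecidableEq ι] [Fintype ι] [Group G] (φ : G → ℕ)
    {i j : ι} (h : i ≠ j) {v : ι → G} (hv : φ (v i * v j * (v i)⁻¹) < φ (v j)) :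
    ∑ l, φ (hurwitzPerm G i j h v l) < ∑ l, φ (v l) := by
  rw [← Equiv.sum_comp (Equiv.swap i j) fun l => φ (v l)]
  refine Finset.sum_lt_sum (fun l _ => ?_) ⟨i, Finset.mem_univ i, by simpa [hurwitzPerm_apply]⟩
  rw [hurwitzPerm_apply]
  split_ifs with h1 h2
  · simpa [h1] using hv.le
  · simp [h2]
  · rw [Equiv.swap_apply_of_ne_of_ne h1 h2]

theorem sum_hurwitzPerm_symm_lt {ι G : Type*} [DecidableEq ι] [Fintype ι] [Group G] (φ : G → ℕ)
    {i j : ι} (h : i ≠ j) {v : ι → G} (hv : φ ((v j)⁻¹ * v i * v j) < φ (v i)) :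
    ∑ l, φ ((hurwitzPerm G i j h).symm v l) < ∑ l, φ (v l) := by
  rw [← Equiv.sum_comp (Equiv.swap i j) fun l => φ (v l)]
  refine Finset.sum_lt_sum (fun l _ => ?_)
    ⟨j, Finset.mem_univ j, by simpa [hurwitzPerm_symm_apply, h.symm]⟩
  rw [hurwitzPerm_symm_apply]
  split_ifs with h1 h2
  · simp [h1]
  · simpa [h2] using hv.le
  · rw [Equiv.swap_apply_of_ne_of_ne h1 h2]

theorem conj_mem_Rset {r : FreeGroup (Fin n)} (hr : r ∈ Rset n) (g : FreeGroup (Fin n)) :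
    g * r * g⁻¹ ∈ Rset n := by
  obtain ⟨w, a, rfl⟩ := hr
  exact ⟨g * w, a, by group⟩

theorem hurwitzPerm_mem_RedR {i : ℕ} (hi : i + 1 < n) {v : Fin n → FreeGroup (Fin n)}
    (hv : v ∈ RedR n) : hurwitzPerm _ (⟨i, by omega⟩ : Fin n) ⟨i + 1, hi⟩ (by simp) v ∈ RedR n := by
  refine ⟨fun l => ?_, ?_⟩
  · rw [hurwitzPerm_apply]
    split_ifs
    exacts [conj_mem_Rset (hv.1 _) _, hv.1 _, hv.1 _]
  · rw [hurwitzPerm_eq_hmove, prod_ofFn_hmove, hv.2]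

theorem hurwitzPerm_symm_mem_RedR {i : ℕ} (hi : i + 1 < n) {v : Fin n → FreeGroup (Fin n)}
    (hv : v ∈ RedR n) :
    (hurwitzPerm _ (⟨i, by omega⟩ : Fin n) ⟨i + 1, hi⟩ (by simp)).symm v ∈ RedR n := by
  refine ⟨fun l => ?_, ?_⟩
  · rw [hurwitzPerm_symm_apply]
    split_ifs
    · exact hv.1 _
    · simpa using conj_mem_Rset (hv.1 _) (v ⟨i + 1, hi⟩)⁻¹
    · exact hv.1 _
  · rw [← prod_ofFn_hmove i hi, ← hurwitzPerm_eq_hmove, Equiv.apply_symm_apply, hv.2]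

/-- A factorization in `RedR n` that no Hurwitz move shortens is the standard one. -/
theorem eq_of_of_conjLen_le {v : Fin n → FreeGroup (Fin n)} (hv : v ∈ RedR n)
    (h : ∀ (i : ℕ) (hi : i + 1 < n),
      conjLen (v ⟨i + 1, hi⟩) ≤
          conjLen (v ⟨i, by omega⟩ * v ⟨i + 1, hi⟩ * (v ⟨i, by omega⟩)⁻¹) ∧
        conjLen (v ⟨i, by omega⟩) ≤
          conjLen ((v ⟨i + 1, hi⟩)⁻¹ * v ⟨i, by omega⟩ * v ⟨i + 1, hi⟩)) :
    v = FreeGroup.of := by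
  have hex (j : Fin n) :
      ∃ w a, v j = w * FreeGroup.of a * w⁻¹ ∧ FreeGroup.norm w = conjLen (v j) := by
    obtain ⟨w, a, hwa⟩ := hv.1 j
    rw [hwa]
    exact exists_norm_eq_conjLen w a
  choose w x hwx hnorm using hex
  have hg : (gElt n).toWord = List.ofFn fun i => (i, true) := FreeGroup.toWord_prod_ofFn_of id
  have hw : ∀ j, w j = 1 := by
    have hchain : (List.ofFn fun j => (w j, x j)).IsChain fun p q =>
        FreeGroup.IsReduced ((p.2, true) :: (p.1⁻¹ * q.1).toWord ++ [(q.2, true)]) := by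
      rw [List.isChain_ofFn]
      intro i hi
      by_contra hred
      have h1 := hnorm ⟨i, by omega⟩
      have h2 := hnorm ⟨i + 1, hi⟩
      have h3 := h i hi
      rw [hwx] at h1 h2
      rw [hwx ⟨i, _⟩, hwx ⟨i + 1, _⟩] at h3
      rcases conjLen_lt_or_lt h1 h2 hred with h4 | h4 <;> omega
    have hred : ∀ q ∈ List.ofFn fun j => (w j, x j), ∀ b,
        FreeGroup.IsReduced (q.1.toWord ++ [(q.2, b)]) := by
      intro q hq b
      obtain ⟨j, rfl⟩ := List.mem_ofFn.1 hq
      exact isReduced_append_of_norm_eq (by rw [← hwx, hnorm]) b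
    have hprod : ((List.ofFn fun j => (w j, x j)).map
        fun q => q.1 * FreeGroup.of q.2 * q.1⁻¹).prod = gElt n := by
      rw [← hv.2, List.map_ofFn]
      congr 2
      funext j
      exact (hwx j).symm
    suffices ∀ q ∈ List.ofFn fun j => (w j, x j), q.1 = 1 from
      fun j => this (w j, x j) (List.mem_ofFn.2 ⟨j, rfl⟩)
    have hlen : (List.ofFn fun j => (w j, x j)).length = n := List.length_ofFn
    generalize (List.ofFn fun j => (w j, x j)) = L at *
    cases L with
    | nil => simp
    | cons p L =>
      obtain ⟨w₀, a⟩ := p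
      obtain ⟨T, hT, hmk, hle, heq⟩ :=
        exists_isReduced_mk_eq_prod L w₀ a (fun q hq => hred q hq false) hchain
      have hgw : gElt n = FreeGroup.mk (w₀.toWord ++ [(a, true)] ++ T) := by
        rw [List.append_assoc, FreeGroup.mk_append, List.singleton_append, hmk, FreeGroup.mk_toWord,
          ← hprod]
        simp [mul_assoc]
      have hredw : FreeGroup.IsReduced (w₀.toWord ++ [(a, true)] ++ T) :=
        (hred (w₀, a) (by simp) true).append_overlap hT (by simp)
      have hnormg : (w₀.toWord ++ [(a, true)] ++ T).length = n := by
        rw [← FreeGroup.norm_mk_of_isReduced hredw, ← hgw, FreeGroup.norm, hg, List.length_ofFn]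
      simp only [List.length_append, List.length_cons, List.length_nil] at hnormg hlen
      exact heq (by omega)
  have hvx (j : Fin n) : v j = FreeGroup.of (x j) := by rw [hwx, hw]; simp
  have hprod := congrArg FreeGroup.toWord hv.2
  rw [hg, funext hvx, FreeGroup.toWord_prod_ofFn_of, List.ofFn_inj] at hprod
  funext j
  have hj : x j = j := congrArg Prod.fst (congr_fun hprod j)
  rw [hvx, hj]

theorem exists_braidAct_of_eq {v : Fin n → FreeGroup (Fin n)} (hv : v ∈ RedR n) :
    ∃ β, braidAct (FreeGroup (Fin n)) (.refl _) β FreeGroup.of = v := by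
  induction hN : ∑ l, conjLen (v l) using Nat.strong_induction_on generalizing v with
  | _ N ih =>
    subst hN
    by_cases h : ∃ (i : ℕ) (hi : i + 1 < n),
        conjLen (v ⟨i, by omega⟩ * v ⟨i + 1, hi⟩ * (v ⟨i, by omega⟩)⁻¹) <
            conjLen (v ⟨i + 1, hi⟩) ∨
          conjLen ((v ⟨i + 1, hi⟩)⁻¹ * v ⟨i, by omega⟩ * v ⟨i + 1, hi⟩) <
            conjLen (v ⟨i, by omega⟩)
    · obtain ⟨i, hi, hlt⟩ := h
      have hact := braidAct_of (G := FreeGroup (Fin n)) (.refl (Fin n)) ⟨i, by omega⟩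
      rcases hlt with hlt | hlt
      · obtain ⟨β, hβ⟩ := ih _ (sum_hurwitzPerm_lt conjLen (by simp) hlt)
          (hurwitzPerm_mem_RedR hi hv) rfl
        refine ⟨(PresentedGroup.of ⟨i, by omega⟩)⁻¹ * β, ?_⟩
        rw [map_mul, map_inv, Equiv.Perm.mul_apply, Equiv.Perm.inv_eq_iff_eq, hβ, hact]
        rfl
      · obtain ⟨β, hβ⟩ := ih _ (sum_hurwitzPerm_symm_lt conjLen (by simp) hlt)
          (hurwitzPerm_symm_mem_RedR hi hv) rfl
        refine ⟨PresentedGroup.of ⟨i, by omega⟩ * β, ?_⟩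
        rw [map_mul, Equiv.Perm.mul_apply, hβ, hact]
        exact Equiv.apply_symm_apply _ v
    · push Not at h
      exact ⟨1, by simp [eq_of_of_conjLen_le hv h]⟩

end Transitivity

/-- The Hurwitz action of `B_n` on `Red_R(g)` is simply transitive. -/
theorem hurwitz_simply_transitive_RedR (n : ℕ) :
    ∃ act : BraidGroup n →* Equiv.Perm (Fin n → FreeGroup (Fin n)),
      (∀ (i : ℕ) (hi : i + 1 < n),
        ⇑(act (PresentedGroup.of ⟨i, by omega⟩)) = hmove n (FreeGroup (Fin n)) i hi) ∧
      ∀ a ∈ RedR n, ∀ b ∈ RedR n, ∃! β : BraidGroup n, act β a = b := by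
  refine ⟨braidAct _ (.refl _), fun i hi => ?_, fun a ha b hb => ?_⟩
  · rw [braidAct_of]
    exact hurwitzPerm_eq_hmove i hi
  · obtain ⟨γ, rfl⟩ := exists_braidAct_of_eq ha
    obtain ⟨δ, rfl⟩ := exists_braidAct_of_eq hb
    refine ⟨δ * γ⁻¹, by simp, fun β hβ => ?_⟩
    have : δ⁻¹ * (β * γ) = 1 := eq_one_of_braidAct_of_eq <| by
      rw [map_mul, map_inv, Equiv.Perm.mul_apply, Equiv.Perm.inv_eq_iff_eq, ← hβ, map_mul,
        Equiv.Perm.mul_apply]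
    rw [eq_mul_inv_iff_mul_eq, ← inv_mul_eq_one.1 this]
end
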